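/- arXiv:1002.2786 — 2 statements merged into one kernel-verified Lean document; each statement's English description precedes it below -/
import Mathlib

section
/- There is no algorithm (partial recursive function on codes) that, on input of codes of two finite presentations P = (m, R) and Q = (m', S) such that there exists an injective group homomorphism from the presented group of P into the presented group of Q, halts and outputs a code of a function θ : Fin m → List (Fin m' × Bool) such that there exists an injective group homomorphism φ from the presented group of P to the presented group of Q sending, for each i < m, the image of the i-th free generator of P to the image in the presented group of Q of the word θ(i). -/
/-- A word in `m` generators. -/
abbrev Word (m : ℕ) : Type := List (Fin m × Bool)

/-- A finite presentation: a number of generators together with a finite list of relator words. -/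
abbrev FinPres : Type := Σ m : ℕ, List (Word m)

/-- The set of relators of a finite presentation, as elements of the free group. -/
def FinPres.rels (P : FinPres) : Set (FreeGroup (Fin P.1)) :=
  {x | ∃ r ∈ P.2, x = FreeGroup.mk r}

/-- The group presented by a finite presentation. -/
abbrev FinPres.Grp (P : FinPres) : Type := PresentedGroup P.rels

/-- The projection from the free group onto the presented group. -/
def FinPres.proj (P : FinPres) : FreeGroup (Fin P.1) →* P.Grp :=
  PresentedGroup.mk P.rels

/-- The `n`-th recursively enumerable set: the domain of the `n`-th partial recursive
function under the canonical numbering. -/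
def W (n : ℕ) : Set ℕ := {x | ((Denumerable.ofNat Nat.Partrec.Code n).eval x).Dom}

/-- The set of orders of nontrivial torsion elements of a group. -/
def TorOrd (G : Type*) [Group G] : Set ℕ := {n | 2 ≤ n ∧ ∃ g : G, orderOf g = n}

namespace HNNExtension

open NormalWord

variable {G : Type*} [Group G] {A B : Subgroup G} {φ : A ≃* B}

theorem exists_t_zpow_mul_of (u : ℤˣ) {a : G} (ha : a ∈ toSubgroup A B u) {S : Subgroup G}
    (hS : ∀ a : A, (a : G) ∈ S ↔ (φ a : G) ∈ S) :
    ∃ b : G, (a ∈ S → b ∈ S) ∧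
      (t : HNNExtension G A B φ) ^ (u : ℤ) * of a * t ^ (((-u : ℤˣ)) : ℤ) = of b := by
  rcases Int.units_eq_one_or u with rfl | rfl
  · refine ⟨φ ⟨a, ha⟩, fun h => (hS ⟨a, ha⟩).1 h, ?_⟩
    rw [equiv_eq_conj]
    simp
  · refine ⟨φ.symm ⟨a, ha⟩, fun h => (hS _).2 (by simpa using h), ?_⟩
    rw [equiv_symm_eq_conj]
    simp

/-- Words whose group entries all lie in the subgroup `S`. -/
def WordIn (S : Subgroup G) (w : ReducedWord G A B) : Prop :=
  w.head ∈ S ∧ ∀ p ∈ w.toList, p.2 ∈ S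

theorem exists_wordIn_of_mul {S : Subgroup G} {w : ReducedWord G A B} (hw : WordIn S w)
    {g : G} (hg : g ∈ S) :
    ∃ w' : ReducedWord G A B, WordIn S w' ∧ w'.prod φ = of g * w.prod φ :=
  ⟨⟨g * w.head, w.toList, w.chain⟩, ⟨mul_mem hg hw.1, hw.2⟩, by
    simp [ReducedWord.prod, mul_assoc]⟩

theorem exists_wordIn_t_zpow_mul {S : Subgroup G}
    (hS : ∀ a : A, (a : G) ∈ S ↔ (φ a : G) ∈ S) {w : ReducedWord G A B} (hw : WordIn S w)
    (u : ℤˣ) :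
    ∃ w' : ReducedWord G A B, WordIn S w' ∧ w'.prod φ = t ^ (u : ℤ) * w.prod φ := by
  obtain ⟨h, l, hl⟩ := w
  by_cases hc : ∀ p ∈ l.head?, h ∈ toSubgroup A B u → u = p.1
  · refine ⟨⟨1, (u, h) :: l, List.isChain_cons.2 ⟨hc, hl⟩⟩, ⟨one_mem _, ?_⟩, ?_⟩
    · rintro p hp
      rcases List.mem_cons.1 hp with rfl | hp
      · exact hw.1
      · exact hw.2 p hp
    · simp [ReducedWord.prod, mul_assoc]
  · push Not at hc
    obtain ⟨⟨v, k⟩, hp, hmem, hne⟩ := hc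
    obtain ⟨l', rfl⟩ : ∃ l', l = (v, k) :: l' := by
      cases l with
      | nil => simp at hp
      | cons a l => exact ⟨l, by simp at hp; rw [hp]⟩
    have hv : v = -u := by
      rcases Int.units_eq_one_or u with rfl | rfl <;>
      rcases Int.units_eq_one_or v with rfl | rfl <;> simp_all
    subst hv
    obtain ⟨b, hb, e⟩ := exists_t_zpow_mul_of (φ := φ) u hmem hS
    refine ⟨⟨b * k, l', (List.isChain_cons.1 hl).2⟩, ⟨?_, ?_⟩, ?_⟩
    · exact mul_mem (hb hw.1) (hw.2 (-u, k) (by simp))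
    · exact fun p hp => hw.2 p (by simp [hp])
    · simp only [ReducedWord.prod, List.map_cons, List.prod_cons, map_mul, ← e]
      group

theorem exists_wordIn_of_mem_closure {S : Subgroup G}
    (hS : ∀ a : A, (a : G) ∈ S ↔ (φ a : G) ∈ S) {g : HNNExtension G A B φ}
    (hg : g ∈ Subgroup.closure ((of '' (S : Set G)) ∪ {t})) :
    ∃ w : ReducedWord G A B, WordIn S w ∧ w.prod φ = g := by
  induction hg using Subgroup.closure_induction_left with
  | one => exact ⟨ReducedWord.empty G A B, ⟨one_mem _, by simp⟩, by simp [ReducedWord.prod]⟩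
  | mul_left x hx y hy ih =>
    obtain ⟨w, hw, rfl⟩ := ih
    rcases hx with ⟨s, hs, rfl⟩ | rfl
    · exact exists_wordIn_of_mul hw hs
    · simpa using exists_wordIn_t_zpow_mul hS hw 1
  | inv_mul_cancel x hx y hy ih =>
    obtain ⟨w, hw, rfl⟩ := ih
    rcases hx with ⟨s, hs, rfl⟩ | rfl
    · simpa using exists_wordIn_of_mul (φ := φ) hw (inv_mem hs)
    · simpa using exists_wordIn_t_zpow_mul hS hw (-1)

/-- A subgroup `S` of the base compatible with `φ` generates together with the stable letter a
subgroup which meets the base only in `S`. -/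
theorem mem_of_of_mem_closure {S : Subgroup G}
    (hS : ∀ a : A, (a : G) ∈ S ↔ (φ a : G) ∈ S) {g : G}
    (hg : (of g : HNNExtension G A B φ) ∈ Subgroup.closure ((of '' (S : Set G)) ∪ {t})) :
    g ∈ S := by
  obtain ⟨w, hw, e⟩ := exists_wordIn_of_mem_closure hS hg
  have hnil := ReducedWord.toList_eq_nil_of_mem_of_range φ w ⟨g, e.symm⟩
  simp only [ReducedWord.prod, hnil, List.map_nil, List.prod_nil, mul_one] at e
  exact of_injective φ e ▸ hw.1

theorem exists_reducedWord_prod_eq (g : HNNExtension G A B φ) :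
    ∃ w : ReducedWord G A B, w.prod φ = g := by
  obtain ⟨d⟩ := TransversalPair.nonempty G A B
  exact ⟨(g • (NormalWord.empty : NormalWord d)).toReducedWord, by
    simp⟩

theorem exists_reducedWord_pow {l : List (ℤˣ × G)} (hl : l ≠ [])
    (hc : l.IsChain (fun a b => a.2 ∈ toSubgroup A B a.1 → a.1 = b.1))
    (hj : ∀ a ∈ l.getLast?, ∀ b ∈ l.head?, a.2 ∈ toSubgroup A B a.1 → a.1 = b.1) (n : ℕ) :
    ∃ w : ReducedWord G A B, w.head = 1 ∧ w.toList ≠ [] ∧ w.toList.getLast? = l.getLast? ∧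
      w.prod φ = (l.map fun x => (t : HNNExtension G A B φ) ^ (x.1 : ℤ) * of x.2).prod ^ (n + 1) := by
  induction n with
  | zero => exact ⟨⟨1, l, hc⟩, rfl, hl, rfl, by simp [ReducedWord.prod]⟩
  | succ n ih =>
    obtain ⟨w, h1, h2, h3, h4⟩ := ih
    refine ⟨⟨1, w.toList ++ l, List.isChain_append.2 ⟨w.chain, hc, ?_⟩⟩, rfl, by simp [hl], ?_, ?_⟩
    · rw [h3]; exact hj
    · simp [List.getLast?_append_of_ne_nil _ hl]
    · rw [pow_succ, ← h4]
      simp [ReducedWord.prod, h1]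

/-- Elements of finite order in an HNN extension are conjugate into the base group. -/
theorem exists_conj_of_pow_eq_one {g : HNNExtension G A B φ} {n : ℕ} (hn : n ≠ 0)
    (hg : g ^ n = 1) : ∃ (h : HNNExtension G A B φ) (b : G), g = h * of b * h⁻¹ := by
  obtain ⟨w, rfl⟩ := exists_reducedWord_prod_eq g
  induction hk : w.toList.length using Nat.strong_induction_on generalizing w with
  | _ k ih =>
    obtain ⟨h, l, hl⟩ := w
    rcases l.eq_nil_or_concat' with rfl | ⟨l, ⟨u, c⟩, rfl⟩
    · exact ⟨1, h, by simp [ReducedWord.prod]⟩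
    -- move the head to the end of the word
    have hl' : (l ++ [(u, c * h)]).IsChain (fun a b => a.2 ∈ toSubgroup A B a.1 → a.1 = b.1) := by
      simp only [List.isChain_append, List.isChain_singleton] at hl ⊢
      simpa using hl
    set P := (((l ++ [(u, c * h)]).map
      fun x => (t : HNNExtension G A B φ) ^ (x.1 : ℤ) * of x.2).prod) with hP
    have hconj : ReducedWord.prod φ ⟨h, l ++ [(u, c)], hl⟩ = of h * P * (of h)⁻¹ := by
      simp [ReducedWord.prod, hP, mul_assoc]
    rw [hconj, conj_pow, conj_eq_one_iff] at hg
    suffices ∃ (k : HNNExtension G A B φ) (b : G), P = k * of b * k⁻¹ by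
      obtain ⟨k, b, e⟩ := this
      exact ⟨of h * k, b, by rw [hconj, e]; group⟩
    by_cases hj : ∀ a ∈ (l ++ [(u, c * h)]).getLast?, ∀ b ∈ (l ++ [(u, c * h)]).head?,
        a.2 ∈ toSubgroup A B a.1 → a.1 = b.1
    · obtain ⟨m, rfl⟩ := Nat.exists_eq_succ_of_ne_zero hn
      obtain ⟨w, -, h2, -, h4⟩ := exists_reducedWord_pow (φ := φ) (by simp) hl' hj m
      refine absurd (ReducedWord.toList_eq_nil_of_mem_of_range φ w ⟨1, ?_⟩) h2
      rw [h4, map_one]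
      exact hg.symm
    · push Not at hj
      obtain ⟨a, ha, b, hb, hmem, hne⟩ := hj
      obtain rfl : (u, c * h) = a := by simpa using ha
      cases l with
      | nil => simp at hb; subst hb; exact absurd rfl hne
      | cons p l =>
        obtain ⟨v, d⟩ := p
        obtain rfl : (v, d) = b := by simpa using hb
        obtain rfl : v = -u := by
          rcases Int.units_eq_one_or u with rfl | rfl <;>
          rcases Int.units_eq_one_or v with rfl | rfl <;> simp_all
        obtain ⟨e, -, he⟩ := exists_t_zpow_mul_of (φ := φ) u hmem (S := ⊤) (by simp)
        have hl'' : l.IsChain (fun a b => a.2 ∈ toSubgroup A B a.1 → a.1 = b.1) := by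
          rw [List.cons_append] at hl'
          exact (List.isChain_append.1 (List.isChain_cons.1 hl').2).1
        have hPc : P = t ^ ((-u : ℤˣ) : ℤ) *
            ReducedWord.prod φ (⟨d, l, hl''⟩ : ReducedWord G A B) * of e *
            (t ^ ((-u : ℤˣ) : ℤ))⁻¹ := by
          rw [hP, ← he]
          simp [ReducedWord.prod, mul_assoc]
        have hPd : P = t ^ ((-u : ℤˣ) : ℤ) * (of e)⁻¹ *
            ReducedWord.prod φ (⟨e * d, l, hl''⟩ : ReducedWord G A B) *
            (t ^ ((-u : ℤˣ) : ℤ) * (of e)⁻¹)⁻¹ := by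
          rw [hPc]
          simp [ReducedWord.prod, mul_assoc]
        rw [hPd, conj_pow, conj_eq_one_iff] at hg
        obtain ⟨k', b', e'⟩ := ih l.length (by simp at hk; omega) ⟨e * d, l, hl''⟩ hg rfl
        exact ⟨t ^ ((-u : ℤˣ) : ℤ) * (of e)⁻¹ * k', b', by rw [hPd, e']; group⟩

end HNNExtension

/-- A pair of embeddings of a group `E` into `G`, whose images are to be identified by
conjugation in an HNN extension. -/
structure AssocPair (G : Type) [Group G] where
  /-- The common domain of the two embeddings. -/
  E : Type
  [grp : Group E]
  /-- The embedding onto the first associated subgroup. -/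
  α : E →* G
  /-- The embedding onto the second associated subgroup. -/
  β : E →* G
  α_injective : Function.Injective α
  β_injective : Function.Injective β

attribute [instance] AssocPair.grp

/-- The isomorphism between the two associated subgroups. -/
noncomputable def AssocPair.equiv {G : Type} [Group G] (p : AssocPair G) :
    p.α.range ≃* p.β.range :=
  (MonoidHom.ofInjective p.α_injective).symm.trans (MonoidHom.ofInjective p.β_injective)

theorem AssocPair.equiv_apply {G : Type} [Group G] (p : AssocPair G) (e : p.E) :
    (p.equiv ⟨p.α e, e, rfl⟩ : G) = p.β e := by
  have : (⟨p.α e, e, rfl⟩ : p.α.range) = MonoidHom.ofInjective p.α_injective e := rfl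
  rw [this, AssocPair.equiv, MulEquiv.trans_apply, MulEquiv.symm_apply_apply]
  rfl

/-- Transport of a pair of embeddings along an injective homomorphism. -/
abbrev AssocPair.map {G M : Type} [Group G] [Group M] (p : AssocPair G) (f : G →* M)
    (hf : Function.Injective f) : AssocPair M where
  E := p.E
  α := f.comp p.α
  β := f.comp p.β
  α_injective := hf.comp p.α_injective
  β_injective := hf.comp p.β_injective

/-- `M` is the iterated HNN extension of `G` with stable letters `s i` conjugating `p i`. -/
structure IsMultiHNN {I G M : Type} [Group G] [Group M] (p : I → AssocPair G) (ι : G →* M)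
    (s : I → M) : Prop where
  injective : Function.Injective ι
  rel : ∀ i (e : (p i).E), s i * ι ((p i).α e) = ι ((p i).β e) * s i
  exists_lift : ∀ (N : Type) [Group N] (f : G →* N) (n : I → N),
    (∀ i (e : (p i).E), n i * f ((p i).α e) = f ((p i).β e) * n i) →
    ∃ F : M →* N, (∀ g, F (ι g) = f g) ∧ ∀ i, F (s i) = n i
  closure_eq_top : Subgroup.closure (Set.range ι ∪ Set.range s) = ⊤
  exists_conj : ∀ (g : M) (n : ℕ), n ≠ 0 → g ^ n = 1 → ∃ h b, g = h * ι b * h⁻¹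
  mem_of_mem_closure : ∀ S : Subgroup G,
    (∀ i (e : (p i).E), (p i).α e ∈ S ↔ (p i).β e ∈ S) →
    ∀ g, ι g ∈ Subgroup.closure (ι '' S ∪ Set.range s) → g ∈ S

theorem HNNExtension.closure_range_of_union_t {G : Type*} [Group G] {A B : Subgroup G}
    {φ : A ≃* B} :
    Subgroup.closure (Set.range (of : G →* HNNExtension G A B φ) ∪ {t}) = ⊤ := by
  refine eq_top_iff.2 fun x _ => ?_
  induction x using HNNExtension.induction_on with
  | of g => exact Subgroup.subset_closure (Or.inl ⟨g, rfl⟩)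
  | t => exact Subgroup.subset_closure (Or.inr rfl)
  | mul x y hx hy => exact mul_mem (hx trivial) (hy trivial)
  | inv x hx => exact inv_mem (hx trivial)

theorem IsMultiHNN.option {I G M : Type} [Group G] [Group M] {p : Option I → AssocPair G}
    {ι : G →* M} {s : I → M} (h : IsMultiHNN (fun i => p (some i)) ι s) :
    IsMultiHNN p
      ((HNNExtension.of (φ := ((p none).map ι h.injective).equiv)).comp ι)
      (fun i => i.elim HNNExtension.t (fun i => HNNExtension.of (s i))) where
  injective := HNNExtension.of_injective _ |>.comp h.injective
  rel := by
    rintro (_ | i) e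
    · have := HNNExtension.t_mul_of (φ := ((p none).map ι h.injective).equiv)
        ⟨((p none).map ι h.injective).α e, e, rfl⟩
      rw [AssocPair.equiv_apply] at this
      exact this
    · simp only [Option.elim, MonoidHom.comp_apply, ← map_mul]
      rw [h.rel]
  exists_lift := by
    intro N _ f n hn
    obtain ⟨F, hF, hs⟩ := h.exists_lift N f (fun i => n (some i)) (fun i e => hn _ e)
    refine ⟨HNNExtension.lift F (n none) ?_, fun g => ?_, ?_⟩
    · rintro ⟨_, e, rfl⟩
      rw [AssocPair.equiv_apply]
      change n none * F (ι ((p none).α e)) = F (ι ((p none).β e)) * n none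
      rw [hF, hF, hn]
    · simp [hF]
    · rintro (_ | i) <;> simp [hs]
  closure_eq_top := by
    rw [eq_top_iff, ← HNNExtension.closure_range_of_union_t, Subgroup.closure_le]
    rintro _ (⟨m, rfl⟩ | rfl)
    · have hm : m ∈ Subgroup.closure (Set.range ι ∪ Set.range s) := by
        rw [h.closure_eq_top]; trivial
      have := Subgroup.mem_map_of_mem
        (HNNExtension.of (φ := ((p none).map ι h.injective).equiv)) hm
      rw [MonoidHom.map_closure] at this
      refine Subgroup.closure_mono ?_ this
      rintro _ ⟨_, ⟨g, rfl⟩ | ⟨i, rfl⟩, rfl⟩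
      · exact Or.inl ⟨g, rfl⟩
      · exact Or.inr ⟨some i, rfl⟩
    · exact Subgroup.subset_closure (Or.inr ⟨none, rfl⟩)
  exists_conj := by
    intro g n hn hg
    obtain ⟨a, m, rfl⟩ := HNNExtension.exists_conj_of_pow_eq_one hn hg
    have hm : m ^ n = 1 := by
      apply HNNExtension.of_injective (φ := ((p none).map ι h.injective).equiv)
      rw [conj_pow] at hg
      simpa using hg
    obtain ⟨c, b, rfl⟩ := h.exists_conj m n hn hm
    exact ⟨a * HNNExtension.of c, b, by simp [mul_assoc]⟩
  mem_of_mem_closure := by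
    intro S hS g hg
    refine h.mem_of_mem_closure S (fun i e => hS _ e) g ?_
    have key : ∀ g, ι g ∈ Subgroup.closure (ι '' S ∪ Set.range s) ↔ g ∈ S := fun g =>
      ⟨h.mem_of_mem_closure S (fun i e => hS _ e) g,
        fun hg => Subgroup.subset_closure (Or.inl ⟨g, hg, rfl⟩)⟩
    refine HNNExtension.mem_of_of_mem_closure
      (φ := ((p none).map ι h.injective).equiv) ?_ ?_
    · rintro ⟨_, e, rfl⟩
      rw [AssocPair.equiv_apply]
      exact (key _).trans ((hS none e).trans (key _).symm)
    · refine (Subgroup.closure_le _).2 ?_ hg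
      rintro _ (⟨g, hg, rfl⟩ | ⟨_ | i, rfl⟩)
      · exact Subgroup.subset_closure (Or.inl ⟨_, (key g).2 hg, rfl⟩)
      · exact Subgroup.subset_closure (Or.inr rfl)
      · exact Subgroup.subset_closure
          (Or.inl ⟨_, Subgroup.subset_closure (Or.inr ⟨i, rfl⟩), rfl⟩)

theorem exists_isMultiHNN (I : Type) [Finite I] :
    ∀ {G : Type} [Group G] (p : I → AssocPair G),
      ∃ (M : Type) (_ : Group M) (ι : G →* M) (s : I → M), IsMultiHNN p ι s := by
  induction I using Finite.induction_empty_option with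
  | of_equiv e ih =>
    intro G _ p
    obtain ⟨M, _, ι, s, h⟩ := ih (fun i => p (e i))
    refine ⟨M, _, ι, s ∘ e.symm, h.injective, fun i a => ?_, fun N _ f n hn => ?_, ?_,
      h.exists_conj, fun S hS g hg => ?_⟩
    · obtain ⟨i, rfl⟩ := e.surjective i
      simpa using h.rel i a
    · obtain ⟨F, hF, hs⟩ := h.exists_lift N f (fun i => n (e i)) (fun i => hn (e i))
      exact ⟨F, hF, fun i => by simp [hs]⟩
    · rw [EquivLike.range_comp]
      exact h.closure_eq_top
    · rw [EquivLike.range_comp] at hg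
      exact h.mem_of_mem_closure S (fun i => hS (e i)) g hg
  | h_empty =>
    intro G _ p
    refine ⟨G, _, MonoidHom.id G, PEmpty.elim, Function.injective_id, fun i => i.elim,
      fun N _ f n hn => ⟨f, fun _ => rfl, fun i => i.elim⟩, ?_,
      fun g n _ _ => ⟨1, g, by simp⟩, fun S hS g hg => ?_⟩
    · refine eq_top_iff.2 fun x _ => Subgroup.subset_closure (Or.inl ⟨x, rfl⟩)
    · simpa [Set.range_eq_empty] using hg
  | h_option ih =>
    intro G _ p
    obtain ⟨M, _, ι, s, h⟩ := ih (fun i => p (some i))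
    exact ⟨_, _, _, _, h.option⟩

namespace Group.IsFinitelyPresented

/-- If `f` is surjective, kills the finite set `S`, and the quotient map by the normal closure of
`S` factors through `f`, then `f` presents its target. -/
theorem of_factor {H G : Type} [Group H] [Group G] [IsFinitelyPresented H] (f : H →* G)
    (hf : Function.Surjective f) (S : Set H) (hS : S.Finite) (hfS : ∀ x ∈ S, f x = 1)
    (hF : ∀ (N : Type) [Group N] (g : H →* N), (∀ x ∈ S, g x = 1) → ∃ F : G →* N, F.comp f = g) :
    IsFinitelyPresented G := by
  refine of_surjective f hf ⟨S, hS, le_antisymm ?_ fun x hx => ?_⟩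
  · exact Subgroup.normalClosure_le_normal hfS
  · obtain ⟨F, h⟩ := hF _ (QuotientGroup.mk' (Subgroup.normalClosure S)) fun x hx =>
      (QuotientGroup.eq_one_iff x).2 (Subgroup.subset_normalClosure hx)
    refine (QuotientGroup.eq_one_iff x).1 ?_
    have := DFunLike.congr_fun h x
    rw [MonoidHom.comp_apply, MonoidHom.mem_ker.1 hx, map_one] at this
    exact this.symm

open scoped commutatorElement in
theorem pi_int (ι : Type) [Fintype ι] [DecidableEq ι] :
    IsFinitelyPresented (ι → Multiplicative ℤ) := by
  let f : FreeGroup ι →* (ι → Multiplicative ℤ) :=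
    FreeGroup.lift fun i => Pi.mulSingle i (Multiplicative.ofAdd 1)
  have key : ∀ (N : Type) [Group N] (g : FreeGroup ι →* N),
      (∀ i j, i ≠ j → Commute (g (.of i)) (g (.of j))) →
      ∃ F : (ι → Multiplicative ℤ) →* N, F.comp f = g := by
    intro N _ g hg
    refine ⟨MonoidHom.noncommPiCoprod (fun i => zpowersHom N (g (.of i))) ?_, ?_⟩
    · intro i j hij x y
      exact ((hg i j hij).zpow_zpow _ _)
    · ext i
      simp only [f, MonoidHom.comp_apply, FreeGroup.lift_apply_of]
      exact (MonoidHom.noncommPiCoprod_mulSingle _ _ _).trans (by simp)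
  refine of_factor f ?_ (Set.range fun ij : ι × ι => ⁅FreeGroup.of ij.1, FreeGroup.of ij.2⁆)
    (Set.finite_range _) ?_ ?_
  · intro v
    have : v = ∏ i, Pi.mulSingle i (v i) := (Finset.univ_prod_mulSingle v).symm
    rw [this, ← MonoidHom.mem_range]
    refine Subgroup.prod_mem _ fun i _ => ⟨FreeGroup.of i ^ (v i).toAdd, ?_⟩
    rw [map_zpow, FreeGroup.lift_apply_of, ← Pi.mulSingle_zpow, ← ofAdd_zsmul]
    simp
  · rintro _ ⟨ij, rfl⟩
    rw [map_commutatorElement, commutatorElement_eq_one_iff_commute]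
    exact mul_comm _ _
  · intro N _ g hg
    refine key N g fun i j _ => ?_
    have := hg _ ⟨(i, j), rfl⟩
    rwa [map_commutatorElement, commutatorElement_eq_one_iff_commute] at this

theorem fg {G : Type} [Group G] [h : IsFinitelyPresented G] : Group.FG G := by
  obtain ⟨n, f, hf, -⟩ := h.out
  exact Group.fg_of_surjective hf

end Group.IsFinitelyPresented

namespace IsMultiHNN

theorem isFinitelyPresented {I G M : Type} [Finite I] [Group G] [Group M] {p : I → AssocPair G}
    {ι : G →* M} {s : I → M} (h : IsMultiHNN p ι s) [Group.IsFinitelyPresented G]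
    (hE : ∀ i, Group.FG (p i).E) : Group.IsFinitelyPresented M := by
  choose T hT using fun i => (Group.fg_iff.1 (hE i))
  let c : Monoid.Coprod G (FreeGroup I) →* M := Monoid.Coprod.lift ι (FreeGroup.lift s)
  let σ : I → Monoid.Coprod G (FreeGroup I) := fun i => Monoid.Coprod.inr (FreeGroup.of i)
  let R : Set (Monoid.Coprod G (FreeGroup I)) := ⋃ i, (fun e => σ i * .inl ((p i).α e) * (σ i)⁻¹ *
    (Monoid.Coprod.inl ((p i).β e))⁻¹) '' T i
  refine Group.IsFinitelyPresented.of_factor c ?_ R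
    (Set.finite_iUnion fun i => (hT i).2.image _) ?_ ?_
  · rw [← MonoidHom.range_eq_top, eq_top_iff, ← h.closure_eq_top, Subgroup.closure_le]
    rintro _ (⟨g, rfl⟩ | ⟨i, rfl⟩)
    · exact ⟨.inl g, by simp [c]⟩
    · exact ⟨σ i, by simp [c, σ]⟩
  · intro x hx
    obtain ⟨i, e, -, rfl⟩ := Set.mem_iUnion.1 hx
    simp [c, σ, h.rel]
  · intro N _ g hg
    have hrel : ∀ i (e : (p i).E), g (σ i) * (g.comp Monoid.Coprod.inl) ((p i).α e) =
        (g.comp Monoid.Coprod.inl) ((p i).β e) * g (σ i) := by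
      intro i e
      have : (MulAut.conj (g (σ i))).toMonoidHom.comp ((g.comp Monoid.Coprod.inl).comp (p i).α) =
          (g.comp Monoid.Coprod.inl).comp (p i).β := by
        refine MonoidHom.eq_of_eqOn_dense (hT i).1 fun e he => ?_
        have := hg _ (Set.mem_iUnion.2 ⟨i, e, he, rfl⟩)
        rw [map_mul, map_inv, mul_inv_eq_one] at this
        simpa using this
      have := DFunLike.congr_fun this e
      simp only [MonoidHom.comp_apply, MulEquiv.coe_toMonoidHom, MulAut.conj_apply] at this ⊢
      rw [← this, inv_mul_cancel_right]
    obtain ⟨F, hF, hs⟩ := h.exists_lift N (g.comp Monoid.Coprod.inl) (fun i => g (σ i)) hrel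
    refine ⟨F, Monoid.Coprod.hom_ext ?_ ?_⟩
    · ext x
      simp [c, hF]
    · ext i
      simp [c, hs, σ]

theorem torsionFree {I G M : Type} [Group G] [Group M] {p : I → AssocPair G}
    {ι : G →* M} {s : I → M} (h : IsMultiHNN p ι s)
    (hG : ∀ (g : G) (n : ℕ), n ≠ 0 → g ^ n = 1 → g = 1) (g : M) (n : ℕ) (hn : n ≠ 0)
    (hg : g ^ n = 1) : g = 1 := by
  obtain ⟨a, b, rfl⟩ := h.exists_conj g n hn hg
  rw [conj_pow] at hg
  have hb : b ^ n = 1 := by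
    apply h.injective
    simpa using hg
  rw [hG b n hn hb]
  simp

/-- In the extension of `G` by a letter commuting with `A`, only the elements of `A` commute
with that letter. -/
theorem commute_iff {G M : Type} [Group G] [Group M] {A : Subgroup G} {ι : G →* M} {q : Unit → M}
    (h : IsMultiHNN (fun _ : Unit => (⟨A, A.subtype, A.subtype, A.subtype_injective,
      A.subtype_injective⟩ : AssocPair G)) ι q) (g : G) :
    Commute (q ()) (ι g) ↔ g ∈ A := by
  classical
  refine ⟨fun hc => ?_, fun hg => h.rel () (⟨g, hg⟩ : A)⟩
  let X := (G ⧸ A) × Bool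
  let f : G →* Equiv.Perm X :=
    { toFun := fun g => (MulAction.toPerm g : Equiv.Perm (G ⧸ A)).prodCongr (Equiv.refl _)
      map_one' := by ext <;> simp
      map_mul' := fun a b => by ext <;> simp [mul_smul] }
  let x : X := (((1 : G) : G ⧸ A), true)
  let y : X := (((1 : G) : G ⧸ A), false)
  have hxy : x ≠ y := fun h => Bool.noConfusion (congrArg Prod.snd h)
  have hfA : ∀ a ∈ A, ∀ b, f a (((1 : G) : G ⧸ A), b) = (((1 : G) : G ⧸ A), b) := by
    intro a ha b
    refine Prod.ext ?_ rfl
    change ((a • (1 : G) : G) : G ⧸ A) = _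
    rw [QuotientGroup.eq]
    simpa using ha
  obtain ⟨F, hF, hq⟩ := h.exists_lift (Equiv.Perm X) f (fun _ => Equiv.swap x y) (by
    rintro - ⟨a, ha⟩
    rw [Subgroup.subtype_apply, Equiv.mul_swap_eq_swap_mul, hfA a ha, hfA a ha])
  have := hc.map F
  rw [hF, hq, commute_iff_eq, Equiv.mul_swap_eq_swap_mul, mul_left_inj] at this
  have h2 : Equiv.swap (f g x) (f g y) x ≠ x := by
    rw [← this]
    simpa using hxy.symm
  have h3 : f g x = x := by
    by_contra h3
    apply h2
    rw [Equiv.swap_apply_of_ne_of_ne (Ne.symm h3)]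
    exact fun h4 => Bool.noConfusion (congrArg Prod.snd h4)
  have h4 := congrArg Prod.fst h3
  change ((g • (1 : G) : G) : G ⧸ A) = ((1 : G) : G ⧸ A) at h4
  rw [QuotientGroup.eq] at h4
  simpa using h4

end IsMultiHNN

namespace FreeGroup

variable {X Y : Type}

open Classical in
/-- The retraction of a free group onto the subgroup generated by a subset of the basis. -/
noncomputable def retract (K : Set X) : FreeGroup X →* FreeGroup X :=
  lift fun x => if x ∈ K then of x else 1

theorem mem_closure_iff_retract {K : Set X} {w : FreeGroup X} :
    w ∈ Subgroup.closure (of '' K) ↔ retract K w = w := by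
  constructor
  · intro hw
    refine Subgroup.closure_induction (p := fun w _ => retract K w = w) ?_ (_root_.map_one _) ?_ ?_ hw
    · rintro _ ⟨x, hx, rfl⟩
      simp [retract, hx]
    · intro x y _ _ hx hy
      rw [_root_.map_mul, hx, hy]
    · intro x _ hx
      rw [_root_.map_inv, hx]
  · intro hw
    rw [← hw]
    have : (retract K).range ≤ Subgroup.closure (of '' K) := by
      rw [retract, range_lift_eq_closure, Subgroup.closure_le]
      rintro _ ⟨x, rfl⟩
      dsimp only
      split_ifs with h
      · exact Subgroup.subset_closure ⟨x, h, rfl⟩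
      · exact one_mem _
    exact this ⟨w, rfl⟩

theorem map_mem_closure_iff {f : X → Y} (hf : Function.Injective f) {K : Set Y}
    {w : FreeGroup X} :
    map f w ∈ Subgroup.closure (of '' K) ↔ w ∈ Subgroup.closure (of '' (f ⁻¹' K)) := by
  have : (retract K).comp (map f) = (map f).comp (retract (f ⁻¹' K)) := by
    ext x
    by_cases h : f x ∈ K <;> simp [retract, h]
  rw [mem_closure_iff_retract, mem_closure_iff_retract, ← MonoidHom.comp_apply, this,
    MonoidHom.comp_apply, (map_injective hf).eq_iff]

theorem of_mem_closure_iff {K : Set X} {x : X} :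
    of x ∈ Subgroup.closure (of '' K) ↔ x ∈ K := by
  rw [mem_closure_iff_retract]
  by_cases h : x ∈ K <;> simp [retract, h]

end FreeGroup

variable (PC ι : Type)

/-- Translation of the second component of the basis of the free group on `PC × (ι → ℤ)`. -/
def configTranslate : Multiplicative (ι → ℤ) →* MulAut (FreeGroup (PC × (ι → ℤ))) where
  toFun v := FreeGroup.freeGroupCongr ((Equiv.refl PC).prodCongr (Equiv.addLeft v.toAdd))
  map_one' := by
    ext1 w
    refine DFunLike.congr_fun (FreeGroup.ext_hom (FreeGroup.freeGroupCongr _).toMonoidHom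
      (MonoidHom.id _) ?_) w
    intro x
    simp
  map_mul' v w := by
    ext1 z
    refine DFunLike.congr_fun (FreeGroup.ext_hom (FreeGroup.freeGroupCongr _).toMonoidHom
      ((FreeGroup.freeGroupCongr _).toMonoidHom.comp (FreeGroup.freeGroupCongr _).toMonoidHom)
      ?_) z
    intro x
    simp [add_assoc, Prod.map]

@[simp]
theorem configTranslate_of (v : Multiplicative (ι → ℤ)) (x : PC × (ι → ℤ)) :
    configTranslate PC ι v (.of x) = .of (x.1, v.toAdd + x.2) := by
  simp [configTranslate, Prod.map]

/-- The semidirect product of a free group on a set of configurations with the free abelian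
group of translations. -/
abbrev ConfigGroup : Type := FreeGroup (PC × (ι → ℤ)) ⋊[configTranslate PC ι] Multiplicative (ι → ℤ)

variable {PC ι}

namespace ConfigGroup

/-- The generator of `ConfigGroup` attached to a configuration. -/
def tok (x : PC × (ι → ℤ)) : ConfigGroup PC ι := SemidirectProduct.inl (.of x)

theorem inr_mul_tok (v w : ι → ℤ) (q : PC) :
    (SemidirectProduct.inr (.ofAdd v) : ConfigGroup PC ι) * tok (q, w) =
      tok (q, v + w) * SemidirectProduct.inr (.ofAdd v) := by
  have := SemidirectProduct.inl_aut (φ := configTranslate PC ι) (.ofAdd v) (.of (q, w))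
  rw [configTranslate_of] at this
  rw [tok, tok]
  simp only [toAdd_ofAdd] at this
  rw [this]
  simp

theorem torsionFree (g : ConfigGroup PC ι) (n : ℕ) (hn : n ≠ 0) (hg : g ^ n = 1) : g = 1 := by
  have h1 : g.right = 1 := by
    have h : g.right ^ n = 1 := by
      have := congrArg SemidirectProduct.rightHom hg
      rwa [map_pow, map_one] at this
    have h : n • g.right.toAdd = 0 := h
    have : g.right.toAdd = 0 := (smul_eq_zero.1 h).resolve_left hn
    exact this
  have h2 : g = SemidirectProduct.inl g.left := by
    conv_lhs => rw [← SemidirectProduct.inl_left_mul_inr_right g, h1]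
    simp
  rw [h2, ← map_pow, ← map_one SemidirectProduct.inl, SemidirectProduct.inl_inj] at hg
  rw [h2, (pow_eq_one_iff_left hn).1 hg, map_one]

/-- The subgroup generated by the configurations in `K`. -/
def closureTok (K : Set (PC × (ι → ℤ))) : Subgroup (ConfigGroup PC ι) :=
  (Subgroup.closure (FreeGroup.of '' K)).map SemidirectProduct.inl

theorem mem_closureTok {K : Set (PC × (ι → ℤ))} {g : ConfigGroup PC ι} :
    g ∈ closureTok K ↔ g.right = 1 ∧ g.left ∈ Subgroup.closure (FreeGroup.of '' K) := by
  constructor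
  · rintro ⟨w, hw, rfl⟩
    exact ⟨rfl, hw⟩
  · rintro ⟨h1, h2⟩
    exact ⟨_, h2, SemidirectProduct.ext rfl h1.symm⟩

theorem tok_mem_closureTok {K : Set (PC × (ι → ℤ))} {x : PC × (ι → ℤ)} :
    tok x ∈ closureTok K ↔ x ∈ K := by
  rw [mem_closureTok, tok, SemidirectProduct.right_inl, SemidirectProduct.left_inl,
    FreeGroup.of_mem_closure_iff, and_iff_right rfl]

/-- The affine embedding `t_u ↦ t_(q, a + M * u)`. -/
def affine (q : PC) (a M : ι → ℤ) : ConfigGroup Unit ι →* ConfigGroup PC ι :=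
  SemidirectProduct.map (FreeGroup.map fun x => (q, a + M * x.2))
    (AddMonoidHom.mulLeft M).toMultiplicative (by
      intro v
      ext x
      simp [mul_add, add_left_comm])

theorem affine_tok (q : PC) (a M : ι → ℤ) (x : Unit × (ι → ℤ)) :
    affine q a M (tok x) = tok (q, a + M * x.2) := by
  simp [affine, tok]

theorem mul_left_injective_of_ne_zero {M : ι → ℤ} (hM : ∀ i, M i ≠ 0) :
    Function.Injective (fun u => M * u) := fun _ _ h =>
  funext fun i => mul_left_cancel₀ (hM i) (congrFun h i)

theorem affine_fun_injective (q : PC) (a : ι → ℤ) {M : ι → ℤ} (hM : ∀ i, M i ≠ 0) :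
    Function.Injective fun x : Unit × (ι → ℤ) => (q, a + M * x.2) := fun _ _ h =>
  Prod.ext rfl (mul_left_injective_of_ne_zero hM (add_left_cancel (congrArg Prod.snd h)))

theorem affine_injective (q : PC) (a : ι → ℤ) {M : ι → ℤ} (hM : ∀ i, M i ≠ 0) :
    Function.Injective (affine q a M) := fun _ _ h => SemidirectProduct.ext
  (FreeGroup.map_injective (affine_fun_injective q a hM) (congrArg SemidirectProduct.left h))
  (mul_left_injective_of_ne_zero hM (congrArg SemidirectProduct.right h))

theorem affine_mem_closureTok {q : PC} {a M : ι → ℤ} (hM : ∀ i, M i ≠ 0)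
    {K : Set (PC × (ι → ℤ))} {g : ConfigGroup Unit ι} :
    affine q a M g ∈ closureTok K ↔ g ∈ closureTok {x | (q, a + M * x.2) ∈ K} := by
  rw [mem_closureTok, mem_closureTok]
  refine and_congr ?_ (FreeGroup.map_mem_closure_iff (affine_fun_injective q a hM))
  constructor
  · intro h
    exact mul_left_injective_of_ne_zero hM (h.trans (mul_zero M).symm)
  · intro h
    change AddMonoidHom.toMultiplicative (AddMonoidHom.mulLeft M) g.right = 1
    rw [h, map_one]

theorem exists_lift {N : Type} [Group N] (f : Multiplicative (ι → ℤ) →* N) (n : PC → N) :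
    ∃ F : ConfigGroup PC ι →* N, (∀ v, F (.inr v) = f v) ∧
      ∀ q v, F (tok (q, v)) = f (.ofAdd v) * n q * (f (.ofAdd v))⁻¹ := by
  have h : ∀ g, (FreeGroup.lift fun x : PC × (ι → ℤ) => f (.ofAdd x.2) * n x.1 *
      (f (.ofAdd x.2))⁻¹).comp (configTranslate PC ι g).toMonoidHom =
      (MulAut.conj (f g)).toMonoidHom.comp (FreeGroup.lift fun x : PC × (ι → ℤ) =>
        f (.ofAdd x.2) * n x.1 * (f (.ofAdd x.2))⁻¹) := by
    intro v
    ext x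
    simp [mul_assoc]
  exact ⟨SemidirectProduct.lift _ f h, fun v => SemidirectProduct.lift_inr _ _ h v, fun q v => by
    rw [tok, SemidirectProduct.lift_inl, FreeGroup.lift_apply_of]⟩

theorem isFinitelyPresented [Fintype ι] [DecidableEq ι] [Finite PC] :
    Group.IsFinitelyPresented (ConfigGroup PC ι) := by
  let e : (ι → Multiplicative ℤ) ≃* Multiplicative (ι → ℤ) :=
    { toFun := fun v => .ofAdd fun i => (v i).toAdd
      invFun := fun v i => .ofAdd (v.toAdd i)
      left_inv := fun _ => rfl
      right_inv := fun _ => rfl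
      map_mul' := fun _ _ => rfl }
  have := Group.IsFinitelyPresented.pi_int ι
  have := Group.IsFinitelyPresented.equiv e
  obtain ⟨F, hF, hF'⟩ := exists_lift (PC := PC)
    (Monoid.Coprod.inl : _ →* Monoid.Coprod (Multiplicative (ι → ℤ)) (FreeGroup PC))
    (fun q => Monoid.Coprod.inr (.of q))
  let G : Monoid.Coprod (Multiplicative (ι → ℤ)) (FreeGroup PC) →* ConfigGroup PC ι :=
    Monoid.Coprod.lift SemidirectProduct.inr (FreeGroup.lift fun q => tok (q, 0))
  refine Group.IsFinitelyPresented.equiv (MonoidHom.toMulEquiv G F ?_ ?_)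
  · ext x
    · simp [G, hF]
    · simp [G, hF']
  · refine SemidirectProduct.hom_ext ?_ ?_
    · refine FreeGroup.ext_hom _ _ fun x => ?_
      have := hF' x.1 x.2
      rw [tok] at this
      simp only [MonoidHom.comp_apply, this, map_mul, map_inv]
      simp [G, inr_mul_tok]
      rfl
    · refine MonoidHom.ext fun x => ?_
      simp [G, hF]

end ConfigGroup

/-- A rule rewriting the configuration `(src, a + M * u)` to `(tgt, c + N * u)` for every
integer vector `u`. -/
structure AffineRule (PC ι : Type) where
  /-- Control state before the step. -/
  src : PC
  /-- Control state after the step. -/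
  tgt : PC
  /-- Offset before the step. -/
  a : ι → ℤ
  /-- Scale before the step. -/
  M : ι → ℤ
  /-- Offset after the step. -/
  c : ι → ℤ
  /-- Scale after the step. -/
  N : ι → ℤ
  M_ne_zero : ∀ i, M i ≠ 0
  N_ne_zero : ∀ i, N i ≠ 0

namespace AffineRule

variable {PC ι R : Type}

/-- One step of the rewriting system given by a family of affine rules. -/
def Step (r : R → AffineRule PC ι) (x y : PC × (ι → ℤ)) : Prop :=
  ∃ i u, x = ((r i).src, (r i).a + (r i).M * u) ∧ y = ((r i).tgt, (r i).c + (r i).N * u)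

/-- The pair of embeddings of `ConfigGroup Unit ι` realising a rule. -/
def pair (r : AffineRule PC ι) : AssocPair (ConfigGroup PC ι) where
  E := ConfigGroup Unit ι
  α := ConfigGroup.affine r.src r.a r.M
  β := ConfigGroup.affine r.tgt r.c r.N
  α_injective := ConfigGroup.affine_injective _ _ r.M_ne_zero
  β_injective := ConfigGroup.affine_injective _ _ r.N_ne_zero

theorem reach_iff_of_step {r : R → AffineRule PC ι}
    (hdet : ∀ x y z, Step r x y → Step r x z → y = z) {x₀ : PC × (ι → ℤ)}
    (hterm : ∀ y, ¬ Step r x₀ y) {x y : PC × (ι → ℤ)} (h : Step r x y) :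
    Relation.ReflTransGen (Step r) x x₀ ↔ Relation.ReflTransGen (Step r) y x₀ := by
  refine ⟨fun hx => ?_, fun hy => hy.head h⟩
  rcases hx.cases_head with rfl | ⟨z, hz, hz'⟩
  · exact (hterm _ h).elim
  · rwa [hdet _ _ _ h hz]

theorem exists_group [Fintype ι] [DecidableEq ι] [Finite PC] [Finite R]
    (r : R → AffineRule PC ι) (hdet : ∀ x y z, Step r x y → Step r x z → y = z)
    (x₀ : PC × (ι → ℤ)) (hterm : ∀ y, ¬ Step r x₀ y) :
    ∃ (H : Type) (_ : Group H), Group.IsFinitelyPresented H ∧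
      (∀ (g : H) (n : ℕ), n ≠ 0 → g ^ n = 1 → g = 1) ∧
      ∃ (τ : ConfigGroup PC ι →* H) (q : H), ∀ x,
        Commute q (τ (ConfigGroup.tok x)) ↔ Relation.ReflTransGen (Step r) x x₀ := by
  obtain ⟨H₁, _, ι₁, s, h₁⟩ := exists_isMultiHNN R (fun i => (r i).pair)
  let A : Subgroup H₁ := Subgroup.closure (insert (ι₁ (ConfigGroup.tok x₀)) (Set.range s))
  obtain ⟨H₂, _, ι₂, q, h₂⟩ := exists_isMultiHNN Unit (fun _ : Unit => (⟨A, A.subtype, A.subtype,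
    A.subtype_injective, A.subtype_injective⟩ : AssocPair H₁))
  have hE : Group.IsFinitelyPresented (ConfigGroup PC ι) := ConfigGroup.isFinitelyPresented
  have hE' : Group.IsFinitelyPresented (ConfigGroup Unit ι) := ConfigGroup.isFinitelyPresented
  have hH₁ : Group.IsFinitelyPresented H₁ := h₁.isFinitelyPresented fun i => hE'.fg
  have hA : Group.FG A := by
    rw [Group.fg_iff_subgroup_fg, Subgroup.fg_iff]
    exact ⟨_, rfl, (Set.finite_range s).insert _⟩
  refine ⟨H₂, _, h₂.isFinitelyPresented fun _ => hA,
    h₂.torsionFree (h₁.torsionFree ConfigGroup.torsionFree), ι₂.comp ι₁, q (), fun x => ?_⟩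
  rw [MonoidHom.comp_apply, h₂.commute_iff]
  let K : Set (PC × (ι → ℤ)) := {x | Relation.ReflTransGen (Step r) x x₀}
  constructor
  · intro hx
    refine (ConfigGroup.tok_mem_closureTok (K := K)).1 (h₁.mem_of_mem_closure (ConfigGroup.closureTok K) ?_ _
      (Subgroup.closure_mono ?_ hx))
    · intro i e
      refine (ConfigGroup.affine_mem_closureTok (r i).M_ne_zero).trans
        (Iff.trans ?_ (ConfigGroup.affine_mem_closureTok (r i).N_ne_zero).symm)
      have : {x : Unit × (ι → ℤ) | ((r i).src, (r i).a + (r i).M * x.2) ∈ K} =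
          {x | ((r i).tgt, (r i).c + (r i).N * x.2) ∈ K} :=
        Set.ext fun u => reach_iff_of_step hdet hterm ⟨i, u.2, rfl, rfl⟩
      rw [this]
    · rw [Set.insert_subset_iff]
      refine ⟨Or.inl ⟨_, ConfigGroup.tok_mem_closureTok.2 ?_, rfl⟩, Set.subset_union_right⟩
      exact Relation.ReflTransGen.refl
  · intro hx
    induction hx using Relation.ReflTransGen.head_induction_on with
    | refl => exact Subgroup.subset_closure (Set.mem_insert _ _)
    | head h _ ih =>
      obtain ⟨i, u, rfl, rfl⟩ := h
      have hs : s i ∈ A := Subgroup.subset_closure (Set.mem_insert_of_mem _ ⟨i, rfl⟩)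
      have := h₁.rel i (ConfigGroup.tok ((), u) : ConfigGroup Unit ι)
      change s i * ι₁ (ConfigGroup.affine _ _ _ _) = ι₁ (ConfigGroup.affine _ _ _ _) * s i at this
      rw [ConfigGroup.affine_tok, ConfigGroup.affine_tok] at this
      rw [eq_inv_mul_of_mul_eq this]
      exact mul_mem (inv_mem hs) (mul_mem ih hs)

/-- Determinism and terminality of `x₀` make the reversed step relation accessible at all
configurations reaching `x₀`. -/
theorem acc_of_reach {PC ι R : Type} {r : R → AffineRule PC ι}
    (hdet : ∀ x y z, Step r x y → Step r x z → y = z) {x₀ : PC × (ι → ℤ)}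
    (hterm : ∀ y, ¬ Step r x₀ y) {x : PC × (ι → ℤ)} (hx : Relation.ReflTransGen (Step r) x x₀) :
    Acc (Relation.TransGen (Function.swap (Step r))) x := by
  refine Acc.transGen ?_
  induction hx using Relation.ReflTransGen.head_induction_on with
  | refl => exact ⟨_, fun y hy => (hterm y hy).elim⟩
  | head h _ ih => exact ⟨_, fun z hz => hdet _ _ _ h hz ▸ ih⟩

end AffineRule

namespace Turing.TM2

variable {K Γ Λ σ : Type}

section Encoding

variable [Fintype Γ]

/-- The digit of an optional stack symbol, with `0` marking the bottom of the stack. -/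
noncomputable def digit : Option Γ → ℕ
  | none => 0
  | some a => Fintype.equivFin Γ a + 1

theorem digit_lt (a : Option Γ) : digit a < Fintype.card Γ + 1 := by
  rcases a with _ | a
  · exact Nat.succ_pos _
  · exact Nat.succ_lt_succ (Fintype.equivFin Γ a).2

theorem digit_injective : Function.Injective (digit : Option Γ → ℕ) := by
  rintro (_ | a) (_ | b) h <;> simp [digit, Fin.val_inj] at h ⊢
  exact h

/-- The value of a stack read as a numeral. -/
noncomputable def stackCode : List Γ → ℕ
  | [] => 0
  | a :: l => digit (some a) + (Fintype.card Γ + 1) * stackCode l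

theorem stackCode_eq (l : List Γ) :
    stackCode l = digit l.head? + (Fintype.card Γ + 1) * stackCode l.tail := by
  cases l <;> simp [stackCode, digit]

theorem digit_eq_of_add_mul_eq {a b : Option Γ} {u v : ℤ}
    (h : (digit a : ℤ) + ((Fintype.card Γ : ℤ) + 1) * u =
      digit b + ((Fintype.card Γ : ℤ) + 1) * v) : a = b := by
  have h2 := congrArg (fun n => n % ((Fintype.card Γ : ℤ) + 1)) h
  simp only [Int.add_mul_emod_self_left] at h2
  have ha := digit_lt a
  have hb := digit_lt b
  rw [Int.emod_eq_of_lt (by omega) (by omega), Int.emod_eq_of_lt (by omega) (by omega)] at h2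
  exact digit_injective (by exact_mod_cast h2)

end Encoding

section Simulation

variable (M : Λ → Stmt (fun _ : K => Γ) Λ σ) (S : Finset Λ)

/-- The statements reachable from the labels in `S`. -/
abbrev ReachStmt : Type := {q : Stmt (fun _ : K => Γ) Λ σ // some q ∈ stmts M S}

theorem finite_reachStmt : Finite (ReachStmt M S) :=
  Set.Finite.to_subtype (((stmts M S).finite_toSet.preimage (Option.some_injective _).injOn))

open Classical in
/-- A statement as a control state; unreachable statements are sent to `none`. -/
noncomputable def control (q : Stmt (fun _ : K => Γ) Λ σ) : Option (ReachStmt M S) :=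
  if h : some q ∈ stmts M S then some ⟨q, h⟩ else none

variable [DecidableEq K] [Fintype Γ]

/-- Multiplication by the base in the coordinate `k`. -/
def scale (Γ : Type) [Fintype Γ] (k : K) : K → ℤ :=
  Function.update 1 k ((Fintype.card Γ : ℤ) + 1)

theorem scale_ne_zero (k i : K) : scale Γ k i ≠ 0 := by
  rw [scale, Function.update_apply]
  split_ifs
  · omega
  · exact one_ne_zero

/-- The affine rule executing the statement `q` with local variable `v`, when the stack inspected
by `q` has top symbol `d`. -/
noncomputable def rule (q : ReachStmt M S) (v : σ) (d : Option Γ) :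
    AffineRule (Option (ReachStmt M S) × σ) K :=
  match q.1 with
  | .push k f q' => ⟨(some q, v), (control M S q', v), 0, 1, Pi.single k (digit (some (f v)) : ℤ),
      scale Γ k, fun _ => one_ne_zero, scale_ne_zero k⟩
  | .peek k f q' => ⟨(some q, v), (control M S q', f v d), Pi.single k (digit d : ℤ), scale Γ k,
      Pi.single k (digit d : ℤ), scale Γ k, scale_ne_zero k, scale_ne_zero k⟩
  | .pop k f q' => ⟨(some q, v), (control M S q', f v d), Pi.single k (digit d : ℤ), scale Γ k,
      0, 1, scale_ne_zero k, fun _ => one_ne_zero⟩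
  | .load a q' => ⟨(some q, v), (control M S q', a v), 0, 1, 0, 1, fun _ => one_ne_zero,
      fun _ => one_ne_zero⟩
  | .branch f q₁ q₂ => ⟨(some q, v), (control M S (cond (f v) q₁ q₂), v), 0, 1, 0, 1,
      fun _ => one_ne_zero, fun _ => one_ne_zero⟩
  | .goto l => ⟨(some q, v), (control M S (M (l v)), v), 0, 1, 0, 1, fun _ => one_ne_zero,
      fun _ => one_ne_zero⟩
  | .halt => ⟨(some q, v), (none, v), 0, 1, 0, 1, fun _ => one_ne_zero, fun _ => one_ne_zero⟩

/-- The family of all rules of the machine `M`. -/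
noncomputable def rules (i : ReachStmt M S × σ × Option Γ) :
    AffineRule (Option (ReachStmt M S) × σ) K :=
  rule M S i.1 i.2.1 i.2.2

theorem rule_src (q : ReachStmt M S) (v : σ) (d : Option Γ) :
    (rule M S q v d).src = (some q, v) := by
  unfold rule
  split <;> rfl

theorem rule_eq_of_eq (q : ReachStmt M S) (v : σ) {d d' : Option Γ} {u u' : K → ℤ}
    (h : (rule M S q v d).a + (rule M S q v d).M * u =
      (rule M S q v d').a + (rule M S q v d').M * u') : rule M S q v d = rule M S q v d' := by
  obtain ⟨q, hq⟩ := q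
  cases q with
  | peek k f q | pop k f q =>
    have := congrFun h k
    simp only [rule, Pi.add_apply, Pi.mul_apply, Pi.single_eq_same, scale,
      Function.update_self] at this
    rw [digit_eq_of_add_mul_eq this]
  | _ => rfl

theorem rules_deterministic (x y z : (Option (ReachStmt M S) × σ) × (K → ℤ))
    (hy : AffineRule.Step (rules M S) x y) (hz : AffineRule.Step (rules M S) x z) : y = z := by
  obtain ⟨⟨q, v, d⟩, u, rfl, rfl⟩ := hy
  obtain ⟨⟨q', v', d'⟩, u', h, rfl⟩ := hz
  simp only [rules, rule_src, Prod.mk.injEq, Option.some.injEq] at h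
  obtain ⟨⟨rfl, rfl⟩, h⟩ := h
  have hr := rule_eq_of_eq M S q v h
  simp only [rules]
  rw [hr] at h ⊢
  rw [ConfigGroup.mul_left_injective_of_ne_zero (rule M S q v d').M_ne_zero (add_left_cancel h)]

theorem not_step_none (v : σ) (w : K → ℤ) (y) :
    ¬ AffineRule.Step (rules M S) ((none, v), w) y := by
  rintro ⟨⟨q, v, d⟩, u, h, -⟩
  have := congrArg (fun x => x.1.1) h
  simp [rules, rule_src] at this

/-- The vector coding a family of stacks. -/
noncomputable def stacksCode (T : K → List Γ) : K → ℤ := fun k => stackCode (T k)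

theorem stacksCode_push (T : K → List Γ) (k : K) (a : Γ) :
    stacksCode (Function.update T k (a :: T k)) =
      Pi.single k (digit (some a) : ℤ) + scale Γ k * stacksCode T := by
  funext j
  by_cases h : j = k
  · subst h
    simp [stacksCode, scale, stackCode]
  · simp [stacksCode, scale, h]

theorem stacksCode_pop (T : K → List Γ) (k : K) :
    stacksCode T =
      Pi.single k (digit (T k).head? : ℤ) + scale Γ k *
        stacksCode (Function.update T k (T k).tail) := by
  funext j
  by_cases h : j = k
  · subst h
    simp only [stacksCode, scale, Pi.add_apply, Pi.mul_apply, Pi.single_eq_same,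
      Function.update_self]
    exact_mod_cast stackCode_eq (T j)
  · simp [stacksCode, scale, h]

/-- The coding of machine configurations. -/
noncomputable def cfgCode (c : Cfg (fun _ : K => Γ) Λ σ) :
    (Option (ReachStmt M S) × σ) × (K → ℤ) :=
  ((c.l.bind fun l => control M S (M l), c.var), stacksCode c.stk)

theorem step_of_rule {q : Stmt (fun _ : K => Γ) Λ σ} (hq : some q ∈ stmts M S) (v : σ)
    (d : Option Γ) (u : K → ℤ) :
    AffineRule.Step (rules M S)
      ((control M S q, v), (rule M S ⟨q, hq⟩ v d).a + (rule M S ⟨q, hq⟩ v d).M * u)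
      ((rule M S ⟨q, hq⟩ v d).tgt, (rule M S ⟨q, hq⟩ v d).c + (rule M S ⟨q, hq⟩ v d).N * u) :=
  ⟨(⟨q, hq⟩, v, d), u, by simp [rules, rule_src, control, hq], rfl⟩

variable {M S} in
theorem transGen_stepAux (q : Stmt (fun _ : K => Γ) Λ σ)
    (hq : some q ∈ stmts M S) (v : σ) (T : K → List Γ) :
    Relation.TransGen (AffineRule.Step (rules M S)) ((control M S q, v), stacksCode T)
      (cfgCode M S (stepAux q v T)) := by
  induction q generalizing v T with
  | push k f q ih =>
    have hq' : some q ∈ stmts M S := stmts_trans (by simp [stmts₁, stmts₁_self]) hq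
    refine .head ?_ (ih hq' _ _)
    have := step_of_rule M S hq v none (stacksCode T)
    simp only [rule, zero_add, one_mul, ← stacksCode_push] at this
    exact this
  | peek k f q ih =>
    have hq' : some q ∈ stmts M S := stmts_trans (by simp [stmts₁, stmts₁_self]) hq
    refine .head ?_ (ih hq' _ _)
    have := step_of_rule M S hq v (T k).head? (stacksCode (Function.update T k (T k).tail))
    simp only [rule, ← stacksCode_pop] at this
    exact this
  | pop k f q ih =>
    have hq' : some q ∈ stmts M S := stmts_trans (by simp [stmts₁, stmts₁_self]) hq
    refine .head ?_ (ih hq' _ _)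
    have := step_of_rule M S hq v (T k).head? (stacksCode (Function.update T k (T k).tail))
    simp only [rule, ← stacksCode_pop, zero_add, one_mul] at this
    exact this
  | load a q ih =>
    have hq' : some q ∈ stmts M S := stmts_trans (by simp [stmts₁, stmts₁_self]) hq
    refine .head ?_ (ih hq' _ _)
    have := step_of_rule M S hq v none (stacksCode T)
    simp only [rule, zero_add, one_mul] at this
    exact this
  | branch f q₁ q₂ ih₁ ih₂ =>
    have h := step_of_rule M S hq v none (stacksCode T)
    simp only [rule, zero_add, one_mul] at h
    refine .head h ?_
    simp only [stepAux]
    cases f v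
    · exact ih₂ (stmts_trans (by simp [stmts₁, stmts₁_self]) hq) _ _
    · exact ih₁ (stmts_trans (by simp [stmts₁, stmts₁_self]) hq) _ _
  | goto l =>
    have h := step_of_rule M S hq v none (stacksCode T)
    simp only [rule, zero_add, one_mul] at h
    exact .single h
  | halt =>
    have h := step_of_rule M S hq v none (stacksCode T)
    simp only [rule, zero_add, one_mul] at h
    exact .single h

variable {M S} in
theorem transGen_of_step {c c' : Cfg (fun _ : K => Γ) Λ σ}
    (hc : c.l ∈ Finset.insertNone S) (h : c' ∈ step M c) :
    Relation.TransGen (AffineRule.Step (rules M S)) (cfgCode M S c) (cfgCode M S c') := by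
  obtain ⟨_ | l, v, T⟩ := c
  · simp at h
  · obtain rfl : stepAux (M l) v T = c' := by simpa using h
    refine transGen_stepAux (M l) ?_ v T
    simp only [stmts, Finset.some_mem_insertNone, Finset.mem_biUnion]
    exact ⟨l, Finset.some_mem_insertNone.1 hc, stmts₁_self⟩

variable {M S} in
theorem reach_of_reaches [Inhabited Λ] (hS : Supports M S) {c c' : Cfg (fun _ : K => Γ) Λ σ}
    (hc : c.l ∈ Finset.insertNone S) (h : Reaches M c c') :
    Relation.ReflTransGen (AffineRule.Step (rules M S)) (cfgCode M S c) (cfgCode M S c') := by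
  induction h using Relation.ReflTransGen.head_induction_on with
  | refl => exact .refl
  | head h _ ih =>
    exact (transGen_of_step hc h).to_reflTransGen.trans (ih (step_supports M hS h hc))

variable {M S} in
theorem eval_dom_of_reach [Inhabited Λ] (hS : Supports M S) {c c₀ : Cfg (fun _ : K => Γ) Λ σ}
    (hc : c.l ∈ Finset.insertNone S) (hc₀ : c₀.l = none)
    (h : Relation.ReflTransGen (AffineRule.Step (rules M S)) (cfgCode M S c) (cfgCode M S c₀)) :
    (StateTransition.eval (step M) c).Dom := by
  have hacc := AffineRule.acc_of_reach (rules_deterministic M S)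
    (fun y => by
      rw [cfgCode, hc₀]
      exact not_step_none M S _ _ y) h
  clear h
  generalize hx : cfgCode M S c = x at hacc
  induction hacc generalizing c with
  | intro x _ ih =>
    subst hx
    rcases hs : step M c with _ | c'
    · exact Part.dom_iff_mem.2 ⟨c, StateTransition.mem_eval.2 ⟨.refl, hs⟩⟩
    · have h1 := transGen_of_step hc hs
      rw [StateTransition.reaches_eval (.single hs)]
      exact ih _ (Relation.transGen_swap.2 h1) (step_supports M hS hs hc) rfl

end Simulation

end Turing.TM2

namespace Turing.PartrecToTM2

open Turing.TM2

theorem trNum_bit1 (n : Num) : trNum n.bit1 = Γ'.bit1 :: trNum n := by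
  cases n <;> rfl

theorem trNum_bit0 {n : Num} (hn : n ≠ 0) : trNum n.bit0 = Γ'.bit0 :: trNum n := by
  cases n
  · exact (hn rfl).elim
  · rfl

theorem trNat_eq_cons {n : ℕ} (hn : n ≠ 0) :
    trNat n = (if n % 2 = 0 then Γ'.bit0 else Γ'.bit1) :: trNat (n / 2) := by
  have hcast : (n : Num) = if n % 2 = 0 then ((n / 2 : ℕ) : Num).bit0
      else ((n / 2 : ℕ) : Num).bit1 := by
    rw [← Num.to_nat_inj]
    split_ifs with h
    · rw [Num.to_of_nat, Num.cast_bit0, Num.to_of_nat]; omega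
    · rw [Num.to_of_nat, Num.cast_bit1, Num.to_of_nat]
      omega
  rw [trNat, hcast]
  split_ifs with h
  · exact trNum_bit0 fun h0 => by
      have := congrArg (fun k : Num => (k : ℕ)) h0
      simp only [Num.to_of_nat, Num.cast_zero] at this
      omega
  · exact trNum_bit1 _

/-- The value of the input stack holding a single number. -/
noncomputable def inputCode (n : ℕ) : ℕ := stackCode (trList [n])

theorem inputCode_zero : inputCode 0 = digit (some Γ'.cons) := by
  simp [inputCode, trList, stackCode, trNat, trNum]

theorem inputCode_of_ne_zero {n : ℕ} (hn : n ≠ 0) :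
    inputCode n = (if n % 2 = 0 then digit (some Γ'.bit0) else digit (some Γ'.bit1)) +
      (Fintype.card Γ' + 1) * inputCode (n / 2) := by
  simp only [inputCode, trList, trNat_eq_cons hn, List.cons_append, stackCode]
  split_ifs <;> rfl

theorem primrec_inputCode : Primrec inputCode := by
  set c := digit (some Γ'.cons)
  set d₀ := digit (some Γ'.bit0)
  set d₁ := digit (some Γ'.bit1)
  set b := Fintype.card Γ' + 1
  have hlen : Primrec fun l : List ℕ => l.length := Primrec.list_length
  have hg : Primrec fun l : List ℕ => some (if l.length = 0 then c else
      (if l.length % 2 = 0 then d₀ else d₁) + b * l.getD (l.length / 2) 0) := by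
    refine Primrec.option_some.comp (Primrec.ite (Primrec.eq.comp hlen (.const 0)) (.const c) ?_)
    refine Primrec.nat_add.comp (Primrec.ite (Primrec.eq.comp
      (Primrec.nat_mod.comp hlen (.const 2)) (.const 0)) (.const d₀) (.const d₁)) ?_
    exact Primrec.nat_mul.comp (.const b)
      ((Primrec.list_getD 0).comp .id (Primrec.nat_div.comp hlen (.const 2)))
  have h2 : Primrec₂ fun (_ : Unit) (n : ℕ) => inputCode n := by
    refine Primrec.nat_strong_rec _ (hg.comp Primrec.snd).to₂ fun _ n => ?_
    rcases eq_or_ne n 0 with rfl | hn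
    · simp [inputCode_zero, c]
    · have hlt : n / 2 < n := Nat.div_lt_self (Nat.pos_of_ne_zero hn) one_lt_two
      rw [inputCode_of_ne_zero hn]
      simp [hn, hlt, List.getD_eq_getElem?_getD]
      rfl
  exact h2.comp (.const ()) .id

instance : Fintype K' := ⟨{.main, .rev, .aux, .stack}, fun k => by cases k <;> simp⟩

/-- The halting problem for `ToPartrec.Code` on single inputs: some code halts on `[n]`, with value
`[0]`, exactly when the `n`-th partial recursive function is defined at `0`. -/
theorem exists_code_dom : ∃ c : ToPartrec.Code, ∀ n : ℕ,
    ToPartrec.Code.eval c [n] =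
      ((Denumerable.ofNat Nat.Partrec.Code n).eval 0).map fun _ => [0] := by
  have hf : Partrec fun n : ℕ => ((Denumerable.ofNat Nat.Partrec.Code n).eval 0).map fun _ => 0 :=
    (Nat.Partrec.Code.eval_part.comp (Computable.ofNat _) (.const 0)).map
      (Computable.const 0).to₂
  obtain ⟨c, hc⟩ := ToPartrec.Code.exists_code
    (Nat.Partrec'.part_iff₁.2 hf)
  refine ⟨c, fun n => ?_⟩
  have := hc (n ::ᵥ List.Vector.nil)
  simp only [List.Vector.nil] at this
  rw [show [n] = n :: [] from rfl]
  refine this.trans ?_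
  simp only [Part.map_eq_map, Part.map_map]
  rfl

end Turing.PartrecToTM2

open Turing Turing.TM2 Turing.PartrecToTM2 in
/-- There is a finite deterministic system of affine rules whose reachability problem to a fixed
terminal configuration is undecidable. -/
theorem AffineRule.exists_undecidable : ∃ (PC ι R : Type) (_ : Finite PC) (_ : Fintype ι)
    (_ : DecidableEq ι) (_ : Finite R) (r : R → AffineRule PC ι) (x₀ : PC × (ι → ℤ)),
    (∀ x y z, AffineRule.Step r x y → AffineRule.Step r x z → y = z) ∧
    (∀ y, ¬ AffineRule.Step r x₀ y) ∧ ∃ (q : PC) (j : ι),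
      ¬ ComputablePred fun n : ℕ =>
        Relation.ReflTransGen (AffineRule.Step r) (q, Pi.single j (n : ℤ)) x₀ := by
  obtain ⟨c, hc⟩ := exists_code_dom
  let S := codeSupp c .halt
  let : Inhabited Λ' := ⟨trNormal c .halt⟩
  have hS : Supports tr S := tr_supports c .halt
  have hreach (n : ℕ) : Relation.ReflTransGen (AffineRule.Step (rules tr S))
      (cfgCode tr S (PartrecToTM2.init c [n])) (cfgCode tr S (PartrecToTM2.halt [0])) ↔
      ((Denumerable.ofNat Nat.Partrec.Code n).eval 0).Dom := by
    have heval := tr_eval c [n]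
    rw [hc] at heval
    have hinit : (PartrecToTM2.init c [n]).l ∈ Finset.insertNone S := Finset.some_mem_insertNone.2 hS.1
    constructor
    · intro h
      have := eval_dom_of_reach hS hinit rfl h
      rw [heval] at this
      exact this
    · intro h
      refine reach_of_reaches hS hinit (StateTransition.mem_eval.1 (?_ : _ ∈ _)).1
      rw [heval]
      exact ⟨h, rfl⟩
  have : Finite (ReachStmt tr S) := finite_reachStmt _ _
  refine ⟨_, K', _, inferInstance, inferInstance, inferInstance, inferInstance, rules tr S,
    cfgCode tr S (PartrecToTM2.halt [0]), rules_deterministic tr S, not_step_none tr S _ _,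
    (cfgCode tr S (PartrecToTM2.init c [0])).1, K'.main, fun hcomp => ?_⟩
  refine ComputablePred.halting_problem 0 ?_
  have hcode (n : ℕ) : cfgCode tr S (PartrecToTM2.init c [n]) =
      ((cfgCode tr S (PartrecToTM2.init c [0])).1, Pi.single K'.main ((inputCode n : ℕ) : ℤ)) := by
    refine Prod.ext rfl (funext fun k => ?_)
    cases k <;> simp [cfgCode, PartrecToTM2.init, stacksCode, inputCode, stackCode, K'.elim]
  have hred : (fun c : Nat.Partrec.Code => (c.eval 0).Dom) ≤₀ fun n : ℕ =>
      Relation.ReflTransGen (AffineRule.Step (rules tr S))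
        ((cfgCode tr S (PartrecToTM2.init c [0])).1, Pi.single K'.main (n : ℤ))
        (cfgCode tr S (PartrecToTM2.halt [0])) := by
    refine ⟨fun c => inputCode (Encodable.encode c),
      primrec_inputCode.to_comp.comp Computable.encode, fun d => ?_⟩
    have h := hreach (Encodable.encode d)
    rw [hcode, Denumerable.ofNat_encode] at h
    exact h.symm
  exact ComputablePred.computable_of_manyOneReducible hred hcomp

/-- The homomorphism out of the cyclic group of order two determined by an element squaring to
one. -/
def zmodTwoHom {A : Type} [Group A] (a : A) (ha : a ^ 2 = 1) : Multiplicative (ZMod 2) →* A :=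
  MonoidHom.mk' (fun c => a ^ c.toAdd.val) fun c d => by
    rw [← pow_add, toAdd_mul, ZMod.val_add, ← pow_eq_pow_mod _ ha]

theorem zmodTwoHom_apply {A : Type} [Group A] (a : A) (ha : a ^ 2 = 1)
    (c : Multiplicative (ZMod 2)) : zmodTwoHom a ha c = a ^ c.toAdd.val := rfl

theorem zmodTwoHom_ofAdd_one {A : Type} [Group A] (a : A) (ha : a ^ 2 = 1) :
    zmodTwoHom a ha (.ofAdd 1) = a := by
  rw [zmodTwoHom_apply, toAdd_ofAdd, ZMod.val_one, pow_one]

theorem Multiplicative.zmodTwo_eq_ofAdd_one {c : Multiplicative (ZMod 2)} (hc : c ≠ 1) :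
    c = .ofAdd 1 := by
  revert c
  decide

/-- The relations imposed on a homomorphic image `f` of `H`, on central elements `s` and `r`, and
on the letters `p` conjugating the image of `h` to `r ^ 2` and to `s * r ^ 2`. -/
structure SwitchRel {H N : Type} [Group H] [Group N] (h : H) (f : H →* N) (s r : N)
    (p : Bool → N) : Prop where
  commute_s : ∀ g, Commute (f g) s
  commute_r : ∀ g, Commute (f g) r
  commute : Commute s r
  sq : s ^ 2 = 1
  conj_false : p false * f h = r ^ 2 * p false
  conj_true : p true * f h = s * r ^ 2 * p true

/-- `A` is the universal group satisfying `SwitchRel`. -/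
structure IsSwitch {H A : Type} [Group H] [Group A] (h : H) (ι : H →* A) (s r : A)
    (p : Bool → A) : Prop extends SwitchRel h ι s r p where
  exists_lift : ∀ (N : Type) [Group N] (f : H →* N) (a b : N) (n : Bool → N),
    SwitchRel h f a b n →
    ∃ F : A →* N, (∀ g, F (ι g) = f g) ∧ F s = a ∧ F r = b ∧ ∀ i, F (p i) = n i
  hom_ext : ∀ F : A →* A, (∀ g, F (ι g) = ι g) → F s = s → F r = r → (∀ i, F (p i) = p i) →
    F = MonoidHom.id A

namespace IsSwitch

variable {H A : Type} [Group H] [Group A] {h : H} {ι : H →* A} {s r : A} {p : Bool → A}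

/-- The torsion of a switch group whose base embeds `H × C` for a commutative group `C`, generated
by copies `σ` and `ρ` of `s` and `r`. -/
theorem torsion (hA : IsSwitch h ι s r p)
    (hH : ∀ (g : H) (n : ℕ), n ≠ 0 → g ^ n = 1 → g = 1)
    {C : Type} [CommGroup C] (σ ρ : C) (hσ : σ ^ 2 = 1) (κ : C →* A) (hκσ : κ σ = s)
    (hκρ : κ ρ = r) (hκ : ∀ g c, Commute (ι g) (κ c)) (E : Bool → AssocPair (H × C))
    (e : ∀ i, (E i).E) (he : ∀ i, ∀ x, x ∈ Subgroup.zpowers (e i))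
    (hα : ∀ i, (E i).α (e i) = (h, 1)) (hβ₀ : (E false).β (e false) = (1, ρ ^ 2))
    (hβ₁ : (E true).β (e true) = (1, σ * ρ ^ 2)) :
    (∀ D : A →* Multiplicative (ZMod 2), (∀ g, D (ι g) = 1) → ∀ x, orderOf x = 2 →
      ∃ c : C, c ^ 2 = 1 ∧ c ≠ 1 ∧ D x = D (κ c)) ∧
    (s = 1 → σ = 1) ∧ (r = 1 → ρ = 1) := by
  obtain ⟨M, _, ιM, t, hM⟩ := exists_isMultiHNN Bool E
  have hrel : SwitchRel h (ιM.comp (MonoidHom.inl H C)) (ιM (1, σ)) (ιM (1, ρ)) t :=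
    { commute_s := fun g => .map (by simp [commute_iff_eq]) ιM
      commute_r := fun g => .map (by simp [commute_iff_eq]) ιM
      commute := .map (by simp [commute_iff_eq, mul_comm]) ιM
      sq := by rw [← map_pow, Prod.pow_mk, hσ, one_pow]; exact map_one _
      conj_false := by
        have := hM.rel false (e false)
        rw [hα, hβ₀] at this
        rw [← map_pow, Prod.pow_mk, one_pow]
        exact this
      conj_true := by
        have := hM.rel true (e true)
        rw [hα, hβ₁] at this
        rw [← map_pow, ← map_mul, Prod.pow_mk, one_pow, Prod.mk_mul_mk, one_mul]
        exact this }
  obtain ⟨F, hFι, hFs, hFr, hFp⟩ := hA.exists_lift M _ _ _ _ hrel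
  let f : H × C →* A := MonoidHom.noncommCoprod ι κ hκ
  have hf (x : H × C) : f x = ι x.1 * κ x.2 := rfl
  obtain ⟨B, hBι, hBt⟩ := hM.exists_lift A f p (by
    intro i x
    have key : p i * f ((E i).α (e i)) = f ((E i).β (e i)) * p i := by
      cases i
      · rw [hα, hβ₀, hf, hf]
        simpa [hκρ] using hA.conj_false
      · rw [hα, hβ₁, hf, hf]
        simpa [hκρ, hκσ] using hA.conj_true
    obtain ⟨k, rfl⟩ := he i x
    have : SemiconjBy (p i) (f ((E i).α (e i))) (f ((E i).β (e i))) := key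
    simpa only [map_zpow] using (this.zpow_right k).eq)
  have hBF : B.comp F = MonoidHom.id A := by
    refine hA.hom_ext _ (fun g => ?_) ?_ ?_ fun i => ?_
    · simp [hFι, hBι, hf]
    · simp [hFs, hBι, hf, hκσ]
    · simp [hFr, hBι, hf, hκρ]
    · simp [hFp, hBt]
  have hBF' (x : A) : B (F x) = x := DFunLike.congr_fun hBF x
  refine ⟨fun D hD x hx => ?_, fun hs => ?_, fun hr => ?_⟩
  · have hx2 : x ^ 2 = 1 := hx ▸ pow_orderOf_eq_one x
    have hFx2 : F x ^ 2 = 1 := by rw [← map_pow, hx2, map_one]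
    obtain ⟨m, ⟨g, c⟩, hmc⟩ := hM.exists_conj (F x) 2 two_ne_zero hFx2
    have hgc : ((g, c) : H × C) ^ 2 = 1 := by
      refine hM.injective ?_
      rw [map_pow, map_one, ← conj_eq_one_iff (a := m), ← conj_pow, ← hmc, hFx2]
    obtain ⟨hg, hc⟩ := Prod.mk.inj hgc
    obtain rfl := hH g 2 two_ne_zero hg
    refine ⟨c, hc, ?_, ?_⟩
    · rintro rfl
      rw [show ((1, 1) : H × C) = 1 from rfl, map_one, mul_one, mul_inv_cancel] at hmc
      rw [← hBF' x, hmc, map_one, orderOf_one] at hx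
      exact absurd hx (by decide)
    · rw [← hBF' x, hmc, map_mul, map_mul, map_inv, map_mul, map_mul, map_inv, hBι, hf,
        mul_comm (D (B m)), mul_inv_cancel_right, map_one, one_mul]
  · rw [hs, map_one] at hFs
    exact (Prod.mk.inj (hM.injective (hFs.symm.trans (map_one ιM).symm))).2
  · rw [hr, map_one] at hFr
    exact (Prod.mk.inj (hM.injective (hFr.symm.trans (map_one ιM).symm))).2

theorem torsion_of_eq_one (hA : IsSwitch h ι s r p)
    (hH : ∀ (g : H) (n : ℕ), n ≠ 0 → g ^ n = 1 → g = 1) (h1 : h = 1)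
    (D : A →* Multiplicative (ZMod 2)) (hD : ∀ g, D (ι g) = 1) :
    orderOf r = 2 ∧ ∀ x, orderOf x = 2 → D x = D r := by
  have hr : r ^ 2 = 1 := by simpa [h1] using hA.conj_false
  have hs : s = 1 := by simpa [h1, hr] using hA.conj_true
  let E : Bool → AssocPair (H × Multiplicative (ZMod 2)) := fun _ =>
    { E := Unit, α := 1, β := 1,
      α_injective := Function.injective_of_subsingleton _
      β_injective := Function.injective_of_subsingleton _ }
  obtain ⟨h₁, -, h₂⟩ := hA.torsion hH (C := Multiplicative (ZMod 2)) 1 (.ofAdd 1) (one_pow 2)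
    (zmodTwoHom r hr) ((map_one _).trans hs.symm) (zmodTwoHom_ofAdd_one r hr)
    (fun g c => (hA.commute_r g).pow_right _) E (fun _ => 1)
    (fun _ _ => ⟨0, rfl⟩) (fun _ => by rw [h1]; rfl) rfl rfl
  refine ⟨orderOf_eq_prime hr fun h => absurd (h₂ h) (by decide), fun x hx => ?_⟩
  obtain ⟨c, -, hc, h⟩ := h₁ D hD x hx
  rw [h, Multiplicative.zmodTwo_eq_ofAdd_one hc, zmodTwoHom_ofAdd_one]

theorem torsion_of_ne_one (hA : IsSwitch h ι s r p)
    (hH : ∀ (g : H) (n : ℕ), n ≠ 0 → g ^ n = 1 → g = 1) (h1 : h ≠ 1)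
    (D : A →* Multiplicative (ZMod 2)) (hD : ∀ g, D (ι g) = 1) :
    orderOf s = 2 ∧ ∀ x, orderOf x = 2 → D x = D s := by
  let C := Multiplicative (ZMod 2) × Multiplicative ℤ
  let σ : C := (.ofAdd 1, 1)
  let ρ : C := (1, .ofAdd 1)
  have hα : Function.Injective (zpowersHom (H × C) (h, 1)) := by
    refine (injective_iff_map_eq_one _).2 fun k hk => ?_
    by_contra hk0
    have hpow : h ^ k.toAdd = 1 := congrArg Prod.fst hk
    refine h1 (hH h k.toAdd.natAbs (Int.natAbs_ne_zero.2 hk0) ?_)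
    rcases Int.natAbs_eq k.toAdd with h' | h' <;> rw [h'] at hpow <;> simpa using hpow
  have hβ (c : Multiplicative (ZMod 2)) :
      Function.Injective (zpowersHom (H × C) (1, (c, .ofAdd 2))) := by
    refine (injective_iff_map_eq_one _).2 fun k hk => ?_
    have h2 : (Multiplicative.ofAdd (2 : ℤ)) ^ k.toAdd = 1 :=
      congrArg (fun x : H × C => x.2.2) hk
    rw [← ofAdd_zsmul, ofAdd_eq_one, smul_eq_mul] at h2
    have : k.toAdd = 0 := by omega
    exact this
  let E : Bool → AssocPair (H × C) := fun i =>
    { E := Multiplicative ℤ, α := zpowersHom _ (h, 1),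
      β := zpowersHom _ (1, (bif i then .ofAdd 1 else 1, .ofAdd 2)),
      α_injective := hα
      β_injective := hβ _ }
  let κ : C →* A := MonoidHom.noncommCoprod (zmodTwoHom s hA.sq) (zpowersHom A r)
    fun c k => (hA.commute.pow_left _).zpow_right _
  have hκσ : κ σ = s :=
    (congrArg₂ (· * ·) (zmodTwoHom_ofAdd_one s hA.sq) (map_one _)).trans (mul_one s)
  have hκρ : κ ρ = r :=
    (congrArg₂ (· * ·) (map_one (zmodTwoHom s hA.sq)) (zpow_one r)).trans (one_mul r)
  obtain ⟨h₁, h₂, -⟩ := hA.torsion hH (C := C) σ ρ (by decide) κ hκσ hκρ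
    (fun g c => ((hA.commute_s g).pow_right _).mul_right ((hA.commute_r g).zpow_right _)) E
    (fun _ => Multiplicative.ofAdd (1 : ℤ))
    (fun _ (k : Multiplicative ℤ) => ⟨k.toAdd, by
      change Multiplicative.ofAdd (1 : ℤ) ^ k.toAdd = k
      rw [← ofAdd_zsmul, smul_eq_mul, mul_one, ofAdd_toAdd]⟩)
    (fun _ => zpow_one _) (zpow_one _) (zpow_one _)
  refine ⟨orderOf_eq_prime hA.sq fun h => absurd (h₂ h) (by decide), fun x hx => ?_⟩
  obtain ⟨⟨c, k⟩, hc2, hc, h⟩ := h₁ D hD x hx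
  have hk : k = 1 := by
    have h2 : k ^ 2 = 1 := congrArg Prod.snd hc2
    rw [← ofAdd_toAdd k, ← ofAdd_nsmul, ofAdd_eq_one, nsmul_eq_mul] at h2
    have : k.toAdd = 0 := by push_cast at h2; omega
    exact this
  subst hk
  obtain rfl := Multiplicative.zmodTwo_eq_ofAdd_one (c := c) fun h0 => hc (by rw [h0]; rfl)
  rw [h]
  exact congrArg D hκσ

end IsSwitch

namespace SwitchPresentation

open scoped commutatorElement

variable {m : ℕ}

/-- The inclusion of the first `m` letters. -/
def emb (m : ℕ) : FreeGroup (Fin m) →* FreeGroup (Fin (m + 4)) := FreeGroup.map (Fin.castAdd 4)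

/-- The four additional letters. -/
def letter (m : ℕ) (j : Fin 4) : FreeGroup (Fin (m + 4)) := .of (Fin.natAdd m j)

/-- The letters conjugating the element `h`. -/
def conjLetter (m : ℕ) (i : Bool) : FreeGroup (Fin (m + 4)) := letter m (bif i then 3 else 2)

/-- The relators not depending on the element `h`. -/
def baseRels (S : Set (FreeGroup (Fin m))) : Set (FreeGroup (Fin (m + 4))) :=
  emb m '' S ∪ Set.range (fun i => ⁅emb m (.of i), letter m 0⁆) ∪
    Set.range (fun i => ⁅emb m (.of i), letter m 1⁆) ∪ {⁅letter m 0, letter m 1⁆, letter m 0 ^ 2}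

/-- The relators conjugating the word `y`. -/
def conjRel (i : Bool) (y : FreeGroup (Fin (m + 4))) : FreeGroup (Fin (m + 4)) :=
  conjLetter m i * y * ((conjLetter m i)⁻¹ *
    ((bif i then letter m 0 * letter m 1 ^ 2 else letter m 1 ^ 2))⁻¹)

theorem finite_baseRels {S : Set (FreeGroup (Fin m))} (hS : S.Finite) : (baseRels S).Finite :=
  (((hS.image _).union (Set.finite_range _)).union (Set.finite_range _)).union (by simp)

theorem commute_of_gen {A : Type} [Group A] (f : FreeGroup (Fin m) →* A) (a : A)
    (h : ∀ i, Commute (f (.of i)) a) (w : FreeGroup (Fin m)) : Commute (f w) a := by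
  induction w using FreeGroup.induction_on with
  | C1 => rw [map_one]; exact Commute.one_left a
  | of i => exact h i
  | inv_of i _ => rw [map_inv]; exact (h i).inv_left
  | mul x y hx hy => rw [map_mul]; exact hx.mul_left hy

theorem isSwitch {H : Type} [Group H] (φ : FreeGroup (Fin m) →* H)
    (hφ : Function.Surjective φ) {S : Set (FreeGroup (Fin m))}
    (hS : Subgroup.normalClosure S = φ.ker) (y : FreeGroup (Fin m))
    {R : Set (FreeGroup (Fin (m + 4)))}
    (hR : R = baseRels S ∪ Set.range fun i => conjRel i (emb m y)) :
    ∃ ι : H →* PresentedGroup R, (∀ w, ι (φ w) = PresentedGroup.mk R (emb m w)) ∧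
      IsSwitch (φ y) ι (PresentedGroup.mk R (letter m 0)) (PresentedGroup.mk R (letter m 1))
        fun i => PresentedGroup.mk R (conjLetter m i) := by
  have hbase {x} (hx : x ∈ baseRels S) : PresentedGroup.mk R x = 1 :=
    PresentedGroup.one_of_mem (hR ▸ Or.inl hx)
  have hconj (i : Bool) : PresentedGroup.mk R (conjRel i (emb m y)) = 1 :=
    PresentedGroup.one_of_mem (hR ▸ Or.inr ⟨i, rfl⟩)
  have hker : φ.ker ≤ ((PresentedGroup.mk R).comp (emb m)).ker := by
    rw [← hS]
    exact Subgroup.normalClosure_le_normal fun x hx =>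
      hbase (Or.inl (Or.inl (Or.inl ⟨x, hx, rfl⟩)))
  let ι : H →* PresentedGroup R := φ.liftOfSurjective hφ ⟨_, hker⟩
  have hι (w) : ι (φ w) = PresentedGroup.mk R (emb m w) :=
    MonoidHom.liftOfRightInverse_comp_apply _ _ _ ⟨_, hker⟩ w
  have hcomm (j : Fin 4) (hj : ∀ i : Fin m, PresentedGroup.mk R
      (emb m (.of i) * letter m j * (emb m (.of i))⁻¹ * (letter m j)⁻¹) = 1) (g : H) :
      Commute (ι g) (PresentedGroup.mk R (letter m j)) := by
    obtain ⟨w, rfl⟩ := hφ g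
    rw [hι]
    refine commute_of_gen ((PresentedGroup.mk R).comp (emb m)) _ (fun i => ?_) w
    have := hj i
    rw [← commutatorElement_def, map_commutatorElement,
      commutatorElement_eq_one_iff_commute] at this
    exact this
  refine ⟨ι, hι, ⟨⟨?_, ?_, ?_, ?_, ?_, ?_⟩, ?_, ?_⟩⟩
  · exact hcomm 0 fun i => hbase (Or.inl (Or.inl (Or.inr ⟨i, rfl⟩)))
  · exact hcomm 1 fun i => hbase (Or.inl (Or.inr ⟨i, rfl⟩))
  · have := hbase (x := ⁅letter m 0, letter m 1⁆) (Or.inr (Or.inl rfl))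
    rwa [map_commutatorElement, commutatorElement_eq_one_iff_commute] at this
  · rw [← map_pow]
    exact hbase (Or.inr (Or.inr rfl))
  · have := hconj false
    rw [conjRel, ← mul_inv_rev, map_mul, map_inv, mul_inv_eq_one, map_mul, ← hι] at this
    simpa using this
  · have := hconj true
    rw [conjRel, ← mul_inv_rev, map_mul, map_inv, mul_inv_eq_one, map_mul, ← hι] at this
    simpa using this
  · intro N _ f a b n h
    let v : Fin (m + 4) → N := Fin.addCases (fun i => f (φ (.of i))) ![a, b, n false, n true]
    have hemb (w : FreeGroup (Fin m)) : FreeGroup.lift v (emb m w) = f (φ w) := by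
      have : (FreeGroup.lift v).comp (emb m) = f.comp φ := by
        ext i
        simp [emb, v]
      exact DFunLike.congr_fun this w
    have hl (j : Fin 4) : FreeGroup.lift v (letter m j) = ![a, b, n false, n true] j := by
      simp [letter, v]
    have h0 : FreeGroup.lift v (letter m 0) = a := hl 0
    have h1 : FreeGroup.lift v (letter m 1) = b := hl 1
    have hc (i : Bool) : FreeGroup.lift v (conjLetter m i) = n i := by
      cases i
      · exact hl 2
      · exact hl 3
    have hv : ∀ x ∈ R, FreeGroup.lift v x = 1 := by
      subst hR
      rintro x ((((⟨w, hw, rfl⟩ | ⟨i, rfl⟩) | ⟨i, rfl⟩) | (rfl | rfl)) | ⟨i, rfl⟩)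
      · have hw' : w ∈ φ.ker := by
          rw [← hS]
          exact Subgroup.subset_normalClosure hw
        rw [hemb, MonoidHom.mem_ker.1 hw', map_one]
      · rw [map_commutatorElement, commutatorElement_eq_one_iff_commute, hemb, h0]
        exact h.commute_s _
      · rw [map_commutatorElement, commutatorElement_eq_one_iff_commute, hemb, h1]
        exact h.commute_r _
      · rw [map_commutatorElement, commutatorElement_eq_one_iff_commute, h0, h1]
        exact h.commute
      · rw [map_pow, h0, h.sq]
      · change FreeGroup.lift v (conjRel i (emb m y)) = 1
        rw [conjRel, ← mul_inv_rev, map_mul, map_inv, mul_inv_eq_one, map_mul, map_mul, hc, hemb]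
        cases i
        · simpa [h1] using h.conj_false
        · simpa [h1, h0] using h.conj_true
    refine ⟨PresentedGroup.toGroup hv, fun g => ?_, h0, h1, hc⟩
    obtain ⟨w, rfl⟩ := hφ g
    rw [hι]
    exact hemb w
  · intro F hF h0 h1 hc
    refine PresentedGroup.ext fun i => ?_
    refine Fin.addCases (fun i => ?_) (fun j => ?_) i
    · have := hF (φ (.of i))
      rw [hι] at this
      exact this
    · fin_cases j
      · exact h0
      · exact h1
      · exact hc false
      · exact hc true

end SwitchPresentation

/-- The presentation of the cyclic group of order two. -/
def FinPres.orderTwo : FinPres := ⟨1, [[(0, true), (0, true)]]⟩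

namespace FinPres

/-- The generator of the cyclic group of order two. -/
def orderTwoGen : orderTwo.Grp := orderTwo.proj (.of (0 : Fin 1))

theorem exists_hom_orderTwo {A : Type} [Group A] {x : A} (hx : x ^ 2 = 1) :
    ∃ φ : orderTwo.Grp →* A, φ orderTwoGen = x := by
  have h : ∀ y ∈ orderTwo.rels, FreeGroup.lift (fun _ => x) y = 1 := by
    rintro _ ⟨r, hr, rfl⟩
    obtain rfl : r = [((0 : Fin 1), true), ((0 : Fin 1), true)] := List.mem_singleton.1 hr
    refine (FreeGroup.lift_mk (α := Fin 1)).trans ?_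
    simpa [pow_two] using hx
  exact ⟨PresentedGroup.toGroup h, PresentedGroup.toGroup.of h⟩

theorem orderOf_orderTwo : orderOf orderTwoGen = 2 := by
  refine orderOf_eq_prime ?_ fun h => ?_
  · rw [orderTwoGen, ← map_pow]
    refine PresentedGroup.one_of_mem ⟨_, List.mem_singleton.2 rfl, ?_⟩
    rw [pow_two]
    rfl
  · obtain ⟨φ, hφ⟩ := exists_hom_orderTwo (A := Multiplicative (ZMod 2)) (x := .ofAdd 1) rfl
    rw [h, map_one] at hφ
    exact absurd hφ (by decide)

theorem exists_embedding_orderTwo {A : Type} [Group A] {x : A} (hx : orderOf x = 2) :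
    ∃ φ : orderTwo.Grp →* A, Function.Injective φ ∧ φ orderTwoGen = x := by
  obtain ⟨φ, hφ⟩ := exists_hom_orderTwo (hx ▸ pow_orderOf_eq_one x)
  refine ⟨φ, (injective_iff_map_eq_one _).2 fun g hg => ?_, hφ⟩
  have hmem : g ∈ Subgroup.zpowers orderTwoGen := by
    rw [Subgroup.zpowers_eq_closure]
    have : Set.range (PresentedGroup.of (rels := orderTwo.rels)) = {orderTwoGen} := by
      refine Set.ext fun y => ⟨?_, fun h => ⟨(0 : Fin 1), h.symm⟩⟩
      rintro ⟨i, rfl⟩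
      rw [Subsingleton.elim (α := Fin 1) i 0]
      rfl
    rw [← this, PresentedGroup.closure_range_of]
    trivial
  obtain ⟨k, rfl⟩ := hmem
  simp only [map_zpow, hφ] at hg
  rw [← orderOf_dvd_iff_zpow_eq_one, hx] at hg
  rwa [← orderOf_dvd_iff_zpow_eq_one, orderOf_orderTwo]

end FinPres

/-- The parity of the number of occurrences of the letter `c` in a word. -/
def Word.parity {k : ℕ} (c : Fin k) (l : Word k) : Bool :=
  l.foldr (fun x b => if x.1 = c then !b else b) false

theorem Word.parity_cons {k : ℕ} (c : Fin k) (x : Fin k × Bool) (l : Word k) :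
    parity c (x :: l) = if x.1 = c then !parity c l else parity c l := rfl

theorem Word.parity_spec {k : ℕ} {c : Fin k} (D : FreeGroup (Fin k) →* Multiplicative (ZMod 2))
    (hc : D (.of c) = .ofAdd 1) (hD : ∀ i, i ≠ c → D (.of i) = 1) (l : Word k) :
    D (.mk l) = 1 ↔ Word.parity c l = false := by
  suffices h : D (.mk l) = if Word.parity c l then .ofAdd 1 else 1 by
    rw [h]
    cases Word.parity c l <;> decide
  induction l with
  | nil => exact map_one D
  | cons x l ih =>
    obtain ⟨i, b⟩ := x
    have hx : D (.mk [(i, b)]) = if i = c then .ofAdd 1 else 1 := by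
      have : D (.of i) = if i = c then .ofAdd 1 else 1 := by
        split_ifs with h
        · rw [h, hc]
        · exact hD i h
      cases b
      · have h2 : FreeGroup.mk [(i, false)] = (FreeGroup.of i)⁻¹ := rfl
        rw [h2, map_inv, this]
        split_ifs <;> rfl
      · exact this
    rw [show (i, b) :: l = [(i, b)] ++ l from rfl, ← FreeGroup.mul_mk, map_mul, hx, ih]
    rw [List.singleton_append, parity_cons]
    by_cases h : i = c
    · simp only [h, if_true]
      cases parity c l <;> rfl
    · simp only [h, if_false, one_mul]

theorem Word.primrec_parity {k : ℕ} (c : Fin k) :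
    Primrec fun l : List (Fin k × Bool) => Word.parity c l := by
  refine Primrec.list_foldr (h := fun _ (p : (Fin k × Bool) × Bool) => if p.1.1 = c then !p.2 else p.2)
    Primrec.id (Primrec.const false) ?_
  exact (Primrec.ite (Primrec.eq.comp (Primrec.fst.comp (Primrec.fst.comp .snd)) (.const c))
    (Primrec.not.comp (Primrec.snd.comp .snd)) (Primrec.snd.comp .snd)).to₂

/-- The `n`-fold repetition of a word. -/
def Word.rep {k : ℕ} (u : Word k) (n : ℕ) : Word k := (List.range n).flatMap fun _ => u

theorem Word.mk_rep {k : ℕ} (u : Word k) (n : ℕ) :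
    FreeGroup.mk (u.rep n) = FreeGroup.mk u ^ n := by
  induction n with
  | zero => rfl
  | succ n ih =>
    rw [pow_succ, ← ih, FreeGroup.mul_mk, rep, List.range_succ, List.flatMap_append]
    simp [rep]

theorem Word.primrec_rep {k : ℕ} (u : Word k) : Primrec u.rep :=
  Primrec.list_flatMap Primrec.list_range (Primrec.const u).to₂

namespace SwitchPresentation

open scoped commutatorElement

/-- The commutator of `q` with the conjugate of `t` by `x ^ n`, as a word. -/
def testWord {k : ℕ} (q x t : FreeGroup (Fin k)) (n : ℕ) : Word k :=
  q.toWord ++ (Word.rep x.toWord n ++ (t.toWord ++ (Word.rep (x⁻¹).toWord n ++ ((q⁻¹).toWord ++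
    (Word.rep x.toWord n ++ ((t⁻¹).toWord ++ Word.rep (x⁻¹).toWord n))))))

theorem mk_testWord {k : ℕ} (q x t : FreeGroup (Fin k)) (n : ℕ) :
    FreeGroup.mk (testWord q x t n) = ⁅q, x ^ n * t * (x ^ n)⁻¹⁆ := by
  simp only [testWord, ← FreeGroup.mul_mk, Word.mk_rep, FreeGroup.mk_toWord, commutatorElement_def]
  group

theorem primrec_testWord {k : ℕ} (q x t : FreeGroup (Fin k)) : Primrec (testWord q x t) := by
  have happ {f g : ℕ → List (Fin k × Bool)} (hf : Primrec f) (hg : Primrec g) :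
      Primrec fun n => f n ++ g n := Primrec.list_append.comp hf hg
  have hx := Word.primrec_rep x.toWord
  have hx' := Word.primrec_rep (x⁻¹).toWord
  exact happ (.const _) (happ hx (happ (.const _) (happ hx' (happ (.const _) (happ hx
    (happ (.const _) hx'))))))

theorem exists_relators {m : ℕ} {S : Set (FreeGroup (Fin m))} (hS : S.Finite)
    (q x t : FreeGroup (Fin m)) : ∃ l : ℕ → List (Word (m + 4)), Primrec l ∧
      ∀ n, FinPres.rels ⟨m + 4, l n⟩ = baseRels S ∪
        Set.range fun i => conjRel i (emb m ⁅q, x ^ n * t * (x ^ n)⁻¹⁆) := by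
  obtain ⟨L, hL⟩ : ∃ L : List (Word (m + 4)),
      baseRels S = {y | ∃ r ∈ L, y = FreeGroup.mk r} := by
    refine ⟨(finite_baseRels hS).toFinset.toList.map FreeGroup.toWord, ?_⟩
    ext y
    simp [FreeGroup.mk_toWord]
  let w := testWord (emb m q) (emb m x) (emb m t)
  have hw : Primrec w := primrec_testWord _ _ _
  let suffixWord (i : Bool) : Word (m + 4) := FreeGroup.toWord ((conjLetter m i)⁻¹ *
    ((bif i then letter m 0 * letter m 1 ^ 2 else letter m 1 ^ 2))⁻¹)
  let r (i : Bool) (n : ℕ) : Word (m + 4) := (conjLetter m i).toWord ++ (w n ++ suffixWord i)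
  have hr (i : Bool) : Primrec (r i) :=
    Primrec.list_append.comp (.const _) (Primrec.list_append.comp hw (.const _))
  have hmk (i : Bool) (n : ℕ) :
      FreeGroup.mk (r i n) = conjRel i (emb m ⁅q, x ^ n * t * (x ^ n)⁻¹⁆) := by
    simp only [r, suffixWord, ← FreeGroup.mul_mk, FreeGroup.mk_toWord, w, mk_testWord, conjRel,
      map_commutatorElement, map_mul, map_inv, map_pow, mul_assoc]
  refine ⟨fun n => r false n :: r true n :: L, Primrec.list_cons.comp (hr _)
    (Primrec.list_cons.comp (hr _) (.const _)), fun n => ?_⟩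
  ext y
  simp only [FinPres.rels, hL, List.mem_cons, exists_eq_or_imp, Set.mem_ofPred_eq, Set.mem_union,
    Set.mem_range, Bool.exists_bool, hmk]
  rw [eq_comm (a := conjRel false _), eq_comm (a := conjRel true _)]
  exact or_assoc.symm.trans or_comm

/-- A computable family of finite presentations whose elements of order two are located by an
undecidable property. -/
theorem exists_family : ∃ (K : ℕ → Prop) (k : ℕ) (c : Fin k) (l : ℕ → List (Word k)),
    ¬ ComputablePred K ∧ Primrec l ∧ ∀ n, ∃ D : FinPres.Grp ⟨k, l n⟩ →* Multiplicative (ZMod 2),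
      D (PresentedGroup.of c) = .ofAdd 1 ∧ (∀ i, i ≠ c → D (PresentedGroup.of i) = 1) ∧
      (∃ x : FinPres.Grp ⟨k, l n⟩, orderOf x = 2) ∧
      ∀ x : FinPres.Grp ⟨k, l n⟩, orderOf x = 2 → (D x = 1 ↔ ¬ K n) := by
  obtain ⟨PC, ι, R, _, _, _, _, rule, x₀, hdet, hterm, q₀, j, hK⟩ := AffineRule.exists_undecidable
  obtain ⟨H, _, hfp, htf, τ, q, hq⟩ := AffineRule.exists_group rule hdet x₀ hterm
  obtain ⟨m, φ, hφ, S, hS, hSφ⟩ := hfp.out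
  obtain ⟨q', rfl⟩ := hφ q
  obtain ⟨x', hx'⟩ := hφ (τ (.inr (.ofAdd (Pi.single j 1))))
  obtain ⟨t', ht'⟩ := hφ (τ (ConfigGroup.tok (q₀, 0)))
  have hconj (n : ℕ) : φ (x' ^ n * t' * (x' ^ n)⁻¹) =
      τ (ConfigGroup.tok (q₀, Pi.single j (n : ℤ))) := by
    simp only [map_mul, map_inv, map_pow, hx', ht']
    rw [← map_pow, ← map_pow, ← map_mul, ← ofAdd_nsmul, ConfigGroup.inr_mul_tok, map_mul,
      mul_inv_cancel_right, add_zero, ← Pi.single_smul, nsmul_eq_mul, mul_one]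
  let y (n : ℕ) : FreeGroup (Fin m) := ⁅q', x' ^ n * t' * (x' ^ n)⁻¹⁆
  have hy (n : ℕ) : φ (y n) = 1 ↔
      Relation.ReflTransGen (AffineRule.Step rule) (q₀, Pi.single j (n : ℤ)) x₀ := by
    rw [map_commutatorElement, commutatorElement_eq_one_iff_commute, hconj, hq]
  obtain ⟨l, hl, hrels⟩ := exists_relators hS q' x' t'
  refine ⟨_, m + 4, Fin.natAdd m 1, l, hK, hl, fun n => ?_⟩
  obtain ⟨i, hi, hA⟩ := isSwitch φ hφ hSφ (y n) (hrels n)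
  obtain ⟨D, hDι, hDs, hDr, hDp⟩ := hA.exists_lift (Multiplicative (ZMod 2)) 1 1 (.ofAdd 1) 1
    ⟨fun _ => .one_right _, fun _ => .one_left _, .one_left _, one_pow 2, rfl, rfl⟩
  refine ⟨D, hDr, fun a => ?_, ?_⟩
  · refine Fin.addCases (fun a _ => ?_) (fun b hb => ?_) a
    · have := hDι (φ (.of a))
      rw [hi] at this
      exact this
    · fin_cases b
      · exact hDs
      · exact (hb rfl).elim
      · exact hDp false
      · exact hDp true
  · by_cases h : φ (y n) = 1
    · obtain ⟨h₁, h₂⟩ := hA.torsion_of_eq_one htf h D hDι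
      refine ⟨⟨_, h₁⟩, fun x hx => ?_⟩
      rw [h₂ x hx, hDr]
      exact iff_of_false (by decide) (not_not.2 ((hy n).1 h))
    · obtain ⟨h₁, h₂⟩ := hA.torsion_of_ne_one htf h D hDι
      refine ⟨⟨_, h₁⟩, fun x hx => ?_⟩
      rw [h₂ x hx, hDs]
      exact iff_of_true rfl (fun h' => h ((hy n).2 h'))

end SwitchPresentation

/-- Theorem D (Chiodo): there is no algorithm that, on input of two finite presentations
`P` and `Q` such that the group presented by `P` embeds in the group presented by `Q`,
halts and outputs a map `θ` from the generators of `P` to words on the generators of `Q`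
which extends to an embedding of the presented groups. -/
theorem no_algorithm_constructing_embedding :
    ¬ ∃ g : ℕ →. ℕ, Nat.Partrec g ∧
      ∀ P Q : FinPres,
        (∃ φ : P.Grp →* Q.Grp, Function.Injective φ) →
        ∃ θ : Fin P.1 → Word Q.1,
          Encodable.encode (List.ofFn θ) ∈ g (Encodable.encode (P, Q)) ∧
          ∃ φ : P.Grp →* Q.Grp, Function.Injective φ ∧
            ∀ i : Fin P.1, φ (P.proj (FreeGroup.of i)) = Q.proj (FreeGroup.mk (θ i)) := by
  rintro ⟨g, hg, hθ⟩
  obtain ⟨K, k, c, l, hK, hl, hD⟩ := SwitchPresentation.exists_family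
  let input (n : ℕ) : ℕ := Encodable.encode ((FinPres.orderTwo, ⟨k, l n⟩) : FinPres × FinPres)
  have hinput : Computable input :=
    (Primrec₂.natPair.comp (.const (Encodable.encode FinPres.orderTwo))
      (Primrec₂.natPair.comp (.const k) (Primrec.encode.comp hl))).to_comp
  let parity (e : ℕ) : Bool :=
    ((Encodable.decode e : Option (List (List (Fin k × Bool)))).map fun w =>
      Word.parity c w.flatten).getD false
  have hparity : Computable parity := by
    refine Primrec.to_comp ?_
    refine Primrec.option_getD.comp (Primrec.option_map Primrec.decode ?_) (.const false)
    exact ((Word.primrec_parity c).comp (Primrec.list_flatten.comp Primrec.snd)).to₂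
  have key (n : ℕ) : ∃ e ∈ g (input n), K n ↔ parity e = true := by
    obtain ⟨D, hDc, hDi, ⟨x, hx⟩, hDK⟩ := hD n
    obtain ⟨φ, hφ, -⟩ := FinPres.exists_embedding_orderTwo hx
    obtain ⟨θ, hθg, ψ, hψ, hψθ⟩ := hθ FinPres.orderTwo ⟨k, l n⟩ ⟨φ, hφ⟩
    refine ⟨_, hθg, ?_⟩
    have hpar : parity (Encodable.encode (List.ofFn θ)) = Word.parity c (θ (0 : Fin 1)) := by
      have hofFn : List.ofFn θ = [θ (0 : Fin 1)] := List.ofFn_succ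
      rw [hofFn]
      simp [parity]
    have hord : orderOf (FinPres.proj ⟨k, l n⟩ (.mk (θ (0 : Fin 1)))) = 2 := by
      rw [← hψθ (0 : Fin 1)]
      exact (orderOf_injective ψ hψ _).trans FinPres.orderOf_orderTwo
    have h1 := hDK _ hord
    have h2 := Word.parity_spec (c := c) (D.comp (FinPres.proj ⟨k, l n⟩)) hDc hDi (θ (0 : Fin 1))
    rw [hpar, ← not_iff_not, ← h1, Bool.not_eq_true]
    exact h2
  choose e he heK using key
  have hcomp : Computable e := by
    have : Partrec fun n => g (input n) := (Partrec.nat_iff.2 hg).comp hinput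
    exact this.of_eq fun n => Part.eq_some_iff.2 (he n)
  refine hK (ComputablePred.computable_iff.2 ⟨fun n => parity (e n), hparity.comp hcomp, ?_⟩)
  exact funext fun n => propext (heK n)
end

section
/- There is no algorithm (partial recursive function on codes) that, on input of a code of a finite presentation P = (m, R) whose presented group has a nontrivial torsion element, halts and outputs some n ∈ TorOrd(G), where G is the presented group of P; that is, outputs some n ≥ 2 such that G contains an element of order exactly n. -/
open scoped commutatorElement

/-- The generators of the gadget group: the central element `c`, the element `k`, and two
commuting copies `x i`, `y i` of the given generators. -/
abbrev GadgetGen (ι : Type) : Type := Bool ⊕ Bool × ι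

namespace Gadget

variable {ι : Type}

/-- The central generator. -/
abbrev c : GadgetGen ι := .inl false

/-- The generator conjugation by which detects membership in the relations. -/
abbrev k : GadgetGen ι := .inl true

/-- The first copy of the given generators. -/
abbrev x (i : ι) : GadgetGen ι := .inr (false, i)

/-- The second copy of the given generators. -/
abbrev y (i : ι) : GadgetGen ι := .inr (true, i)

/-- The relator expressing `k * Y w * k⁻¹ = Y w * c ^ e`, with `Y w` the second copy of `w`. -/
def twistRel (p : FreeGroup ι × ℕ) : FreeGroup (GadgetGen ι) :=
  .of k * .map y p.1 * (.of k)⁻¹ * (.map y p.1 * .of c ^ p.2)⁻¹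

/-- The relators of the gadget that do not depend on the given relations. -/
def baseRels (ι : Type) : Set (FreeGroup (GadgetGen ι)) :=
  Set.range (fun g : GadgetGen ι => ⁅FreeGroup.of (c : GadgetGen ι), FreeGroup.of g⁆) ∪
    {FreeGroup.of c ^ 6} ∪
    Set.range (fun p : ι × ι => ⁅FreeGroup.of (x p.1), FreeGroup.of (y p.2)⁆) ∪
    Set.range (fun i : ι => ⁅FreeGroup.of (k : GadgetGen ι), FreeGroup.of (x i) * FreeGroup.of (y i)⁆)

/-- The relators of the gadget attached to a set `R` of pairs `(w, e)`. -/
def rels (R : Set (FreeGroup ι × ℕ)) : Set (FreeGroup (GadgetGen ι)) :=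
  baseRels ι ∪ twistRel '' R

/-- The gadget group attached to a set `R` of pairs `(w, e)`: a central element `c` with
`c ^ 6 = 1` is forced to behave as `w = c ^ e` for all `(w, e) ∈ R` would force it to. -/
abbrev Grp (R : Set (FreeGroup ι × ℕ)) : Type := PresentedGroup (rels R)

variable {R : Set (FreeGroup ι × ℕ)} {M : Type*} [Group M]

lemma lift_eq_one_of_mem_rels {f : GadgetGen ι → M} (hc : ∀ g, Commute (f c) (f g))
    (h6 : f c ^ 6 = 1) (hxy : ∀ i j, Commute (f (x i)) (f (y j)))
    (hk : ∀ i, Commute (f k) (f (x i) * f (y i)))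
    (hR : ∀ p ∈ R, f k * FreeGroup.lift (fun i => f (y i)) p.1 * (f k)⁻¹ =
      FreeGroup.lift (fun i => f (y i)) p.1 * f c ^ p.2) :
    ∀ r ∈ rels R, FreeGroup.lift f r = 1 := by
  rintro r ((((⟨g, rfl⟩ | rfl) | ⟨p, rfl⟩) | ⟨i, rfl⟩) | ⟨p, hp, rfl⟩)
  · simpa [map_commutatorElement, commutatorElement_eq_one_iff_commute] using hc g
  · simpa using h6
  · simpa [map_commutatorElement, commutatorElement_eq_one_iff_commute] using hxy p.1 p.2
  · simpa [map_commutatorElement, commutatorElement_eq_one_iff_commute] using hk i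
  · have h : FreeGroup.lift f (FreeGroup.map y p.1) =
        FreeGroup.lift (fun i => f (y i)) p.1 := by
      rw [← MonoidHom.comp_apply]
      congr 1
      ext i
      simp
    simp only [twistRel, map_mul, map_inv, map_pow, h, FreeGroup.lift_apply_of]
    rw [hR p hp, mul_inv_cancel]

lemma commute_c (g : GadgetGen ι) :
    Commute (PresentedGroup.of c : Grp R) (PresentedGroup.of g) := by
  rw [← commutatorElement_eq_one_iff_commute]
  exact PresentedGroup.one_of_mem (rels := rels R) (.inl (.inl (.inl (.inl ⟨g, rfl⟩))))

lemma commute_c_all (g : Grp R) : Commute (PresentedGroup.of c : Grp R) g := by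
  have : g ∈ Subgroup.centralizer {(PresentedGroup.of c : Grp R)} := by
    refine (Subgroup.closure_le _).2 ?_ (by
      rw [PresentedGroup.closure_range_of]; trivial :
      g ∈ Subgroup.closure (Set.range (PresentedGroup.of : GadgetGen ι → Grp R)))
    rintro _ ⟨g, rfl⟩
    rw [SetLike.mem_coe, Subgroup.mem_centralizer_singleton_iff]
    exact (commute_c g).symm
  exact (Subgroup.mem_centralizer_singleton_iff.1 this).symm

lemma c_pow_six : (PresentedGroup.of c : Grp R) ^ 6 = 1 :=
  PresentedGroup.one_of_mem (rels := rels R) (.inl (.inl (.inl (.inr rfl))))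

lemma commute_x_y (i j : ι) :
    Commute (PresentedGroup.of (x i) : Grp R) (PresentedGroup.of (y j)) := by
  rw [← commutatorElement_eq_one_iff_commute]
  exact PresentedGroup.one_of_mem (rels := rels R) (.inl (.inl (.inr ⟨(i, j), rfl⟩)))

lemma commute_k_x_mul_y (i : ι) : Commute (PresentedGroup.of k : Grp R)
    (PresentedGroup.of (x i) * PresentedGroup.of (y i)) := by
  rw [← commutatorElement_eq_one_iff_commute]
  exact PresentedGroup.one_of_mem (rels := rels R) (.inl (.inr ⟨i, rfl⟩))

/-- The first copy of the free group in the gadget group. -/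
def xHom (R : Set (FreeGroup ι × ℕ)) : FreeGroup ι →* Grp R :=
  FreeGroup.lift fun i => PresentedGroup.of (x i)

/-- The second copy of the free group in the gadget group. -/
def yHom (R : Set (FreeGroup ι × ℕ)) : FreeGroup ι →* Grp R :=
  FreeGroup.lift fun i => PresentedGroup.of (y i)

lemma commute_xHom_yHom (v w : FreeGroup ι) : Commute (xHom R v) (yHom R w) := by
  induction v using FreeGroup.induction_on with
  | C1 => simp
  | of i =>
    induction w using FreeGroup.induction_on with
    | C1 => simp
    | of j => simpa [xHom, yHom] using commute_x_y i j
    | inv_of j h => simpa using h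
    | mul a b ha hb => simpa using ha.mul_right hb
  | inv_of j h => simpa using h
  | mul a b ha hb => simpa using ha.mul_left hb

lemma commute_k_xHom_mul_yHom (v : FreeGroup ι) :
    Commute (PresentedGroup.of k : Grp R) (xHom R v * yHom R v) := by
  induction v using FreeGroup.induction_on with
  | C1 => simp
  | of i => simpa [xHom, yHom] using commute_k_x_mul_y i
  | inv_of j h =>
    have := h.inv_right
    rwa [mul_inv_rev, ← map_inv, ← map_inv, ← (commute_xHom_yHom _ _).eq] at this
  | mul a b ha hb =>
    rw [map_mul, map_mul, mul_assoc, ← mul_assoc (xHom R b), (commute_xHom_yHom b a).eq, mul_assoc,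
      ← mul_assoc]
    exact ha.mul_right hb

lemma k_mul_yHom {p : FreeGroup ι × ℕ} (hp : p ∈ R) :
    (PresentedGroup.of k : Grp R) * yHom R p.1 * (PresentedGroup.of k)⁻¹ =
      yHom R p.1 * PresentedGroup.of c ^ p.2 := by
  have := PresentedGroup.one_of_mem (rels := rels R) (.inr ⟨p, hp, rfl⟩)
  have h : PresentedGroup.mk (rels R) (FreeGroup.map y p.1) = yHom R p.1 := by
    rw [← MonoidHom.comp_apply]
    congr 1
    ext i
    simp [yHom, PresentedGroup.of]
  simp only [twistRel, map_mul, map_inv, map_pow, h] at this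
  exact mul_inv_eq_one.1 this

end Gadget

namespace Gadget
variable {ι : Type} {R : Set (FreeGroup ι × ℕ)} 

/-- The action of a group on the free group on a set it acts on. -/
def freeGroupAct (Γ X : Type*) [Group Γ] [MulAction Γ X] : Γ →* MulAut (FreeGroup X) where
  toFun γ := FreeGroup.freeGroupCongr (MulAction.toPerm γ)
  map_one' := by
    refine MulEquiv.toMonoidHom_injective (FreeGroup.ext_hom _ _ fun x => ?_)
    simp [FreeGroup.freeGroupCongr, MulAction.toPerm_one]
  map_mul' a b := by
    refine MulEquiv.toMonoidHom_injective (FreeGroup.ext_hom _ _ fun x => ?_)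
    simp [FreeGroup.freeGroupCongr, mul_smul]

lemma freeGroupAct_of {Γ X : Type*} [Group Γ] [MulAction Γ X] (γ : Γ) (q : X) :
    freeGroupAct Γ X γ (FreeGroup.of q) = FreeGroup.of (γ • q) := by
  simp [freeGroupAct, FreeGroup.freeGroupCongr]

lemma eq_one_of_pow_eq_one_semidirectProduct {N Γ : Type*} [Group N] [Group Γ]
    [IsMulTorsionFree N] [IsMulTorsionFree Γ] {φ : Γ →* MulAut N} {h : N ⋊[φ] Γ} {n : ℕ}
    (hn : n ≠ 0) (hh : h ^ n = 1) : h = 1 := by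
  have h1 : h.right = 1 := by
    have := congrArg SemidirectProduct.rightHom hh
    rw [map_pow, map_one] at this
    exact (pow_eq_one_iff_left hn).1 this
  have h2 : h = SemidirectProduct.inl h.left := by ext <;> simp [h1]
  rw [h2, ← map_pow, ← map_one (SemidirectProduct.inl (φ := φ)),
    SemidirectProduct.inl_injective.eq_iff, pow_eq_one_iff_left hn] at hh
  rw [h2, hh, map_one]

/-- The subgroup of the product of two free groups generated by the diagonal and the relations. -/
def mihailova (R : Set (FreeGroup ι × ℕ)) : Subgroup (FreeGroup ι × FreeGroup ι) :=
  Subgroup.closure (Set.range (fun i => (FreeGroup.of i, FreeGroup.of i)) ∪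
    (fun p => (1, p.1)) '' R)

instance normal_zpowers_c : (Subgroup.zpowers (PresentedGroup.of c : Grp R)).Normal where
  conj_mem := by
    rintro _ ⟨n, rfl⟩ g
    refine ⟨n, ?_⟩
    rw [((commute_c_all g).zpow_left n).symm.eq, mul_inv_cancel_right]

/-- A torsion-free group approximating the gadget group modulo its central element. -/
abbrev Approx (R : Set (FreeGroup ι × ℕ)) : Type :=
  FreeGroup ((FreeGroup ι × FreeGroup ι) ⧸ mihailova R) ⋊[freeGroupAct (FreeGroup ι × FreeGroup ι)
    ((FreeGroup ι × FreeGroup ι) ⧸ mihailova R)] (FreeGroup ι × FreeGroup ι)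

/-- The images of the generators of the gadget group in the approximating group. -/
def approxGen (R : Set (FreeGroup ι × ℕ)) : GadgetGen ι → Approx R
  | .inl false => 1
  | .inl true => SemidirectProduct.inl (FreeGroup.of ((1 : FreeGroup ι × FreeGroup ι) : _ ⧸ _))
  | .inr (false, i) => SemidirectProduct.inr (FreeGroup.of i, 1)
  | .inr (true, i) => SemidirectProduct.inr (1, FreeGroup.of i)

lemma approx_commute {γ : FreeGroup ι × FreeGroup ι} (h : γ ∈ mihailova R) :
    Commute (approxGen R k) (SemidirectProduct.inr γ) := by
  have := SemidirectProduct.inl_aut (φ := freeGroupAct (FreeGroup ι × FreeGroup ι)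
    ((FreeGroup ι × FreeGroup ι) ⧸ mihailova R)) γ
    (FreeGroup.of ((1 : FreeGroup ι × FreeGroup ι) : _ ⧸ _))
  rw [freeGroupAct_of, MulAction.Quotient.smul_coe, smul_eq_mul, mul_one,
    (QuotientGroup.eq.2 (by simpa using h) :
      ((γ : (FreeGroup ι × FreeGroup ι) ⧸ mihailova R)) = ((1 : FreeGroup ι × FreeGroup ι) : _)),
    map_inv] at this
  exact eq_mul_inv_iff_mul_eq.1 this

lemma lift_approxGen : ∀ r ∈ rels R, FreeGroup.lift (approxGen R) r = 1 := by
  refine lift_eq_one_of_mem_rels (fun g => Commute.one_left _) (one_pow _) (fun i j => ?_)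
    (fun i => ?_) (fun p hp => ?_)
  · simp [approxGen, Commute, SemiconjBy, ← map_mul]
  · simp only [approxGen, ← map_mul]
    exact approx_commute (Subgroup.subset_closure (.inl ⟨i, by simp⟩))
  · have : FreeGroup.lift (fun i => approxGen R (y i)) p.1 = SemidirectProduct.inr (1, p.1) := by
      have : FreeGroup.lift (fun i => approxGen R (y i)) =
        SemidirectProduct.inr.comp (MonoidHom.inr (FreeGroup ι) (FreeGroup ι)) := by
        ext i <;> simp [approxGen]
      rw [this]
      rfl
    rw [this, (approx_commute (Subgroup.subset_closure (.inr ⟨p, hp, rfl⟩))).eq]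
    simp [approxGen]

/-- The action of the product of the two copies of the free group, modulo `c`. -/
def prodHom (R : Set (FreeGroup ι × ℕ)) :
    FreeGroup ι × FreeGroup ι →* Grp R ⧸ Subgroup.zpowers (PresentedGroup.of c : Grp R) :=
  (QuotientGroup.mk' _).comp (MonoidHom.noncommCoprod (xHom R) (yHom R) commute_xHom_yHom)

lemma prodHom_commute {γ : FreeGroup ι × FreeGroup ι} (h : γ ∈ mihailova R) :
    Commute (prodHom R γ) (((PresentedGroup.of k : Grp R)) : _ ⧸ _) := by
  suffices mihailova R ≤ (Subgroup.centralizer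
      {(((PresentedGroup.of k : Grp R)) : _ ⧸ Subgroup.zpowers (PresentedGroup.of c : Grp R))}).comap
      (prodHom R) from Subgroup.mem_centralizer_singleton_iff.1 (this h)
  refine (Subgroup.closure_le _).2 ?_
  rintro _ (⟨i, rfl⟩ | ⟨p, hp, rfl⟩)
  · refine Subgroup.mem_centralizer_singleton_iff.2 ?_
    have := (commute_k_x_mul_y (R := R) i).symm.map (QuotientGroup.mk'
      (Subgroup.zpowers (PresentedGroup.of c : Grp R)))
    simpa [prodHom, xHom, yHom] using this.eq
  · refine Subgroup.mem_centralizer_singleton_iff.2 ?_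
    have := congrArg (QuotientGroup.mk' (Subgroup.zpowers (PresentedGroup.of c : Grp R)))
      (k_mul_yHom hp)
    have hc : QuotientGroup.mk' (Subgroup.zpowers (PresentedGroup.of c : Grp R))
      (PresentedGroup.of c : Grp R) = 1 := (QuotientGroup.eq_one_iff _).2 (Subgroup.mem_zpowers _)
    rw [map_mul, map_mul, map_mul, map_pow, hc, one_pow, mul_one, map_inv,
      mul_inv_eq_iff_eq_mul] at this
    simpa [prodHom] using this.symm

/-- The comparison map from the approximating group to the quotient by the central element. -/
noncomputable def approxHom (R : Set (FreeGroup ι × ℕ)) :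
    Approx R →* Grp R ⧸ Subgroup.zpowers (PresentedGroup.of c : Grp R) :=
  SemidirectProduct.lift
    (FreeGroup.lift fun q => prodHom R q.out * (PresentedGroup.of k : Grp R) * (prodHom R q.out)⁻¹)
    (prodHom R) (fun γ => by
      ext q
      obtain ⟨l, hl⟩ : ∃ l ∈ mihailova R, (γ • q).out * l = γ * q.out := by
        refine ⟨(γ • q).out⁻¹ * (γ * q.out), ?_, by simp⟩
        rw [← QuotientGroup.eq, QuotientGroup.out_eq']
        conv_lhs => rw [← QuotientGroup.out_eq' q]
        rfl
      have h1 : prodHom R γ * prodHom R q.out = prodHom R (γ • q).out * prodHom R l := by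
        rw [← map_mul, ← map_mul, hl.2]
      simp only [MonoidHom.comp_apply, MulEquiv.coe_toMonoidHom, freeGroupAct_of,
        FreeGroup.lift_apply_of, MulAut.conj_apply]
      have h2 := (prodHom_commute hl.1).eq
      rw [← mul_assoc, ← mul_assoc, h1, mul_assoc (prodHom R _) (prodHom R l), h2]
      rw [mul_assoc _ _ (prodHom R γ)⁻¹, ← mul_inv_rev, h1]
      group)

lemma approxHom_comp :
    (approxHom R).comp (PresentedGroup.toGroup lift_approxGen) = QuotientGroup.mk' _ := by
  refine PresentedGroup.ext ?_
  rintro ((_ | _) | ⟨_ | _, i⟩)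
  · simp only [MonoidHom.comp_apply, PresentedGroup.toGroup.of, approxGen, map_one]
    exact ((QuotientGroup.eq_one_iff _).2 (Subgroup.mem_zpowers _)).symm
  · have h : Quotient.out ((1 : FreeGroup ι × FreeGroup ι) :
        (FreeGroup ι × FreeGroup ι) ⧸ mihailova R) ∈ mihailova R := by
      have := QuotientGroup.eq.1 (QuotientGroup.out_eq'
        ((1 : FreeGroup ι × FreeGroup ι) : (FreeGroup ι × FreeGroup ι) ⧸ mihailova R))
      simpa using this
    simp [approxGen, approxHom, (prodHom_commute h).eq]
  · simp [approxGen, approxHom, prodHom, xHom]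
  · simp [approxGen, approxHom, prodHom, yHom]

/-- Every torsion element of the gadget group is a power of the central generator. -/
theorem mem_zpowers_of_pow_eq_one {g : Grp R} {n : ℕ} (hn : n ≠ 0) (h : g ^ n = 1) :
    g ∈ Subgroup.zpowers (PresentedGroup.of c : Grp R) := by
  have h1 : PresentedGroup.toGroup lift_approxGen g = 1 :=
    eq_one_of_pow_eq_one_semidirectProduct hn (by rw [← map_pow, h, map_one])
  have h2 := DFunLike.congr_fun (approxHom_comp (R := R)) g
  rw [MonoidHom.comp_apply, h1, map_one] at h2
  exact (QuotientGroup.eq_one_iff _).1 h2.symm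

end Gadget

namespace Gadget
variable {ι : Type} {R : Set (FreeGroup ι × ℕ)} {M : Type} [Group M]

/-- The component of an element along the powers of `z`, relative to chosen representatives. -/
noncomputable def cosetPart (z a : M) : M := (a : M ⧸ Subgroup.zpowers z).out⁻¹ * a

lemma cosetPart_mul {z : M} (hz : ∀ a, Commute z a) (e : ℕ) (a : M) :
    cosetPart z (z ^ e * a) = cosetPart z a * z ^ e := by
  have : ((z ^ e * a : M) : M ⧸ Subgroup.zpowers z) = a := by
    rw [((hz a).pow_left e).eq]
    exact QuotientGroup.mk_mul_of_mem _ ((Subgroup.zpowers z).pow_mem (Subgroup.mem_zpowers z) e)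
  rw [cosetPart, cosetPart, this, ((hz a).pow_left e).eq, mul_assoc]

/-- The permutation of `M × M × M` modelling the generator `k`. -/
noncomputable def twistPerm (z : M) : Equiv.Perm (M × M × M) where
  toFun p := (p.1, p.2.1, p.2.2 * cosetPart z (p.1⁻¹ * p.2.1))
  invFun p := (p.1, p.2.1, p.2.2 * (cosetPart z (p.1⁻¹ * p.2.1))⁻¹)
  left_inv p := by simp
  right_inv p := by simp

/-- The permutations of `M × M × M` modelling the generators of the gadget group. -/
noncomputable def modelGen (m : ι → M) (z : M) : GadgetGen ι → Equiv.Perm (M × M × M)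
  | .inl false => MulAction.toPerm ((1, 1, z) : M × M × M)
  | .inl true => twistPerm z
  | .inr (false, i) => MulAction.toPerm ((m i, 1, 1) : M × M × M)
  | .inr (true, i) => MulAction.toPerm ((1, m i, 1) : M × M × M)

/-- If `M` satisfies the relations `w = z ^ e` with a central element `z` of order dividing `6`,
and `z` is nontrivial, then the central generator of the gadget group is nontrivial. -/
theorem of_c_ne_one (m : ι → M) {z : M} (hz : ∀ a, Commute z a) (h6 : z ^ 6 = 1)
    (hR : ∀ p ∈ R, FreeGroup.lift m p.1 = z ^ p.2) (hz1 : z ≠ 1) :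
    (PresentedGroup.of c : Grp R) ≠ 1 := by
  have hrel : ∀ r ∈ rels R, FreeGroup.lift (modelGen m z) r = 1 := by
    refine lift_eq_one_of_mem_rels ?_ ?_ (fun i j => ?_) (fun i => ?_) (fun p hp => ?_)
    · rintro ((_ | _) | ⟨_ | _, i⟩) <;> refine Equiv.ext fun p => ?_
      · rfl
      · simp [modelGen, twistPerm, mul_assoc]
      · simp [modelGen, Prod.ext_iff]
      · simp [modelGen, Prod.ext_iff]
    · refine Equiv.ext fun p => ?_
      change (MulAction.toPermHom _ _ ((1, 1, z) : M × M × M) ^ 6) p = p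
      rw [← map_pow]
      simp [h6]
    · refine Equiv.ext fun p => ?_
      simp [modelGen, Prod.ext_iff]
    · refine Equiv.ext fun p => ?_
      simp [modelGen, twistPerm, mul_assoc]
    · have h : FreeGroup.lift (fun i => modelGen m z (y i)) p.1 =
          MulAction.toPermHom _ _ ((1, z ^ p.2, 1) : M × M × M) := by
        have : FreeGroup.lift (fun i => modelGen m z (y i)) =
            ((MulAction.toPermHom _ (M × M × M)).comp
              ((MonoidHom.inr M (M × M)).comp (MonoidHom.inl M M))).comp (FreeGroup.lift m) := by
          ext i : 1
          simp [modelGen]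
        rw [this, MonoidHom.comp_apply, hR p hp]
        rfl
      have h' : modelGen m z c = MulAction.toPermHom _ _ ((1, 1, z) : M × M × M) := rfl
      rw [h, h', ← map_pow, ← map_mul, mul_inv_eq_iff_eq_mul]
      refine Equiv.ext fun q => ?_
      have h2 : q.1⁻¹ * (z ^ p.2 * q.2.1) = z ^ p.2 * (q.1⁻¹ * q.2.1) := by
        rw [← mul_assoc, ← ((hz q.1⁻¹).pow_left p.2).eq, mul_assoc]
      simp [modelGen, twistPerm, h2, cosetPart_mul hz,
        ((hz (q.2.2 * cosetPart z (q.1⁻¹ * q.2.1))).pow_left p.2).eq, mul_assoc]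
  intro h
  have h1 := congrArg (PresentedGroup.toGroup hrel) h
  rw [PresentedGroup.toGroup.of, map_one] at h1
  have h2 := congrArg (fun e => (e (1, 1, 1)).2.2) h1
  simp [modelGen] at h2
  exact hz1 h2

/-- The exponents of `c` that conjugation by `k` produces in the gadget group. -/
def twistSubgroup (R : Set (FreeGroup ι × ℕ)) : Subgroup (FreeGroup ι × Multiplicative ℤ) where
  carrier := {p | (PresentedGroup.of k : Grp R) * yHom R p.1 * (PresentedGroup.of k)⁻¹ =
    yHom R p.1 * PresentedGroup.of c ^ p.2.toAdd}
  one_mem' := by simp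
  mul_mem' {a b} ha hb := by
    simp only [Set.mem_ofPred_eq] at ha hb ⊢
    rw [Prod.fst_mul, Prod.snd_mul, toAdd_mul, map_mul, zpow_add, ← conj_mul, ha, hb, mul_assoc,
      mul_assoc, ← mul_assoc (_ ^ _), ((commute_c_all _).zpow_left _).eq, mul_assoc]
  inv_mem' {a} ha := by
    simp only [Set.mem_ofPred_eq] at ha ⊢
    rw [Prod.fst_inv, Prod.snd_inv, toAdd_inv, map_inv, ← conj_inv, ha, mul_inv_rev, zpow_neg,
      ((commute_c_all _).zpow_left _).inv_left.eq]

instance : (twistSubgroup R).Normal where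
  conj_mem n hn g := by
    have hn' : (PresentedGroup.of k : Grp R) * yHom R n.1 * (PresentedGroup.of k)⁻¹ =
      yHom R n.1 * PresentedGroup.of c ^ n.2.toAdd := hn
    change (PresentedGroup.of k : Grp R) * yHom R (g.1 * n.1 * g.1⁻¹) * (PresentedGroup.of k)⁻¹ =
      yHom R (g.1 * n.1 * g.1⁻¹) * PresentedGroup.of c ^ (g.2 * n.2 * g.2⁻¹).toAdd
    have h1 : yHom R (g.1 * n.1 * g.1⁻¹) = (xHom R g.1 * yHom R g.1) * yHom R n.1 *
        (xHom R g.1 * yHom R g.1)⁻¹ := by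
      calc yHom R (g.1 * n.1 * g.1⁻¹)
          = xHom R g.1 * yHom R (g.1 * n.1 * g.1⁻¹) * (xHom R g.1)⁻¹ := by
            rw [(commute_xHom_yHom _ _).eq, mul_inv_cancel_right]
        _ = _ := by simp [mul_assoc]
    have h2 := (commute_k_xHom_mul_yHom (R := R) g.1).eq
    have h3 := (commute_k_xHom_mul_yHom (R := R) g.1).inv_inv.eq
    have h4 : (g.2 * n.2 * g.2⁻¹).toAdd = n.2.toAdd := by rw [mul_inv_cancel_comm]
    rw [h1, h4]
    generalize xHom R g.1 * yHom R g.1 = a at h2 h3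
    calc PresentedGroup.of k * (a * yHom R n.1 * a⁻¹) * (PresentedGroup.of k)⁻¹
        = a * (PresentedGroup.of k * yHom R n.1 * (PresentedGroup.of k)⁻¹) * a⁻¹ := by
          simp only [mul_assoc, ← h3]
          simp only [← mul_assoc, h2]
      _ = _ := by
          rw [hn']
          simp only [mul_assoc, ((commute_c_all a⁻¹).zpow_left _).eq]

/-- If the relations `w = z ^ e`, with `z` central of order dividing `6`, force `z ^ q = 1` in all
groups, then the central generator of the gadget group satisfies `c ^ q = 1`. -/
theorem of_c_pow_eq_one (q : ℕ)
    (h : ∀ (M : Type) [Group M] (m : ι → M) (z : M), (∀ a, Commute z a) →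
      (∀ p ∈ R, FreeGroup.lift m p.1 = z ^ p.2) → z ^ q = 1) :
    (PresentedGroup.of c : Grp R) ^ q = 1 := by
  have hmk : ∀ w : FreeGroup ι, FreeGroup.lift
      (fun i => (((FreeGroup.of i, 1) : FreeGroup ι × Multiplicative ℤ) : _ ⧸ twistSubgroup R)) w =
      QuotientGroup.mk' (twistSubgroup R) (w, 1) := by
    intro w
    have : FreeGroup.lift (fun i => (((FreeGroup.of i, 1) : FreeGroup ι × Multiplicative ℤ) :
        _ ⧸ twistSubgroup R)) =
        (QuotientGroup.mk' (twistSubgroup R)).comp (MonoidHom.inl _ _) := by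
      ext i
      simp
    rw [this]
    rfl
  have := h (_ ⧸ twistSubgroup R) (fun i => ((FreeGroup.of i, 1) : FreeGroup ι × Multiplicative ℤ))
    (QuotientGroup.mk' _ (1, Multiplicative.ofAdd (-1))) ?_ ?_
  · rw [← map_pow, QuotientGroup.mk'_apply, QuotientGroup.eq_one_iff] at this
    have h1 : (PresentedGroup.of k : Grp R) * yHom R (1 ^ q) * (PresentedGroup.of k)⁻¹ =
      yHom R (1 ^ q) * PresentedGroup.of c ^ (Multiplicative.ofAdd (-1 : ℤ) ^ q).toAdd := this
    simpa [eq_comm] using h1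
  · intro a
    obtain ⟨a, rfl⟩ := QuotientGroup.mk'_surjective _ a
    refine Commute.map ?_ (QuotientGroup.mk' _)
    exact Prod.ext (by simp) (mul_comm _ _)
  · intro p hp
    rw [hmk, ← map_pow, QuotientGroup.mk'_apply, QuotientGroup.mk'_apply, eq_comm,
      QuotientGroup.eq]
    change (PresentedGroup.of k : Grp R) * yHom R ((1 ^ p.2)⁻¹ * p.1) * (PresentedGroup.of k)⁻¹ =
      yHom R ((1 ^ p.2)⁻¹ * p.1) *
        PresentedGroup.of c ^ ((Multiplicative.ofAdd (-1 : ℤ) ^ p.2)⁻¹ * 1).toAdd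
    simpa using k_mul_yHom hp
end Gadget

/-- A machine with finitely many stacks: in each state it inspects one stack, replaces the top
symbol of that stack (if there is one) by a word, and changes its state. -/
structure StackMachine (K Γ Q : Type) where
  /-- The stack inspected in a state. -/
  stk : Q → K
  /-- The word replacing the top symbol, and the new state. -/
  act : Q → Option Γ → List Γ × Q

namespace StackMachine

variable {K Γ Q : Type} [DecidableEq K]

/-- One step of a stack machine. -/
def step (M : StackMachine K Γ Q) (c : Q × (K → List Γ)) : Q × (K → List Γ) :=
  ((M.act c.1 (c.2 (M.stk c.1)).head?).2, Function.update c.2 (M.stk c.1)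
    ((M.act c.1 (c.2 (M.stk c.1)).head?).1 ++ (c.2 (M.stk c.1)).tail))

variable [Fintype Γ]

/-- The digit representing a stack symbol; the digit `0` stands for the empty stack. -/
noncomputable def digit : Option Γ → ℕ
  | none => 0
  | some a => Fintype.equivFin Γ a + 1

variable (Γ) in
/-- The base of the numeral system used to represent stacks. -/
def base : ℕ := Fintype.card Γ + 1

lemma digit_lt_base (o : Option Γ) : digit o < base Γ := by
  cases o <;> simp [digit, base]

lemma digit_injective : Function.Injective (digit (Γ := Γ)) := by
  rintro (_ | a) (_ | b) h <;> simp_all [digit, Fin.val_inj]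

lemma base_pos : 0 < base Γ := Nat.succ_pos _

/-- The number represented by a stack. -/
noncomputable def num : List Γ → ℕ
  | [] => 0
  | a :: l => digit (some a) + base Γ * num l

lemma num_append (w l : List Γ) : num (w ++ l) = num w + base Γ ^ w.length * num l := by
  induction w with
  | nil => simp [num]
  | cons a w ih => simp [num, ih]; ring

lemma num_eq_head_tail (l : List Γ) : num l = digit l.head? + base Γ * num l.tail := by
  cases l <;> simp [num, digit]

/-- The properties of elements `X`, `T`, `r`, `κ` of a group that make it simulate a machine. -/
structure IsModel {G : Type*} [Group G] (M : StackMachine K Γ Q) (X : K → G) (T : Q → G)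
    (r : Q × Option Γ → G) (κ : G) : Prop where
  commute_X : ∀ k l, Commute (X k) (X l)
  commute_r_X : ∀ v l, l ≠ M.stk v.1 → Commute (r v) (X l)
  r_mul_X : ∀ v, r v * X (M.stk v.1) ^ base Γ * (r v)⁻¹ =
    X (M.stk v.1) ^ base Γ ^ (M.act v.1 v.2).1.length
  r_mul_T : ∀ v, r v * (X (M.stk v.1) ^ digit v.2 * T v.1 * (X (M.stk v.1) ^ digit v.2)⁻¹) *
    (r v)⁻¹ = X (M.stk v.1) ^ num (M.act v.1 v.2).1 * T (M.act v.1 v.2).2 *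
      (X (M.stk v.1) ^ num (M.act v.1 v.2).1)⁻¹
  commute_r_κ : ∀ v, Commute (r v) κ

namespace IsModel

variable [Fintype K] {G : Type*} [Group G] {M : StackMachine K Γ Q} {X : K → G} {T : Q → G}
  {r : Q × Option Γ → G} {κ : G}

/-- The product of the powers `X k ^ u k`, for `k` in a finite set. -/
def monomial (hM : M.IsModel X T r κ) (s : Finset K) (u : K → ℕ) : G :=
  s.noncommProd (fun k => X k ^ u k) fun k _ l _ _ => (hM.commute_X k l).pow_pow _ _

lemma monomial_univ (hM : M.IsModel X T r κ) (u : K → ℕ) (k : K) :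
    hM.monomial Finset.univ u = hM.monomial (Finset.univ.erase k) u * X k ^ u k := by
  have := Finset.noncommProd_insert_of_notMem' (Finset.univ.erase k) k (fun k => X k ^ u k)
    (fun k _ l _ _ => (hM.commute_X k l).pow_pow _ _) (by simp)
  rw [monomial, monomial, ← this]
  exact Finset.noncommProd_congr (by simp) (fun _ _ => rfl) _

lemma monomial_congr (hM : M.IsModel X T r κ) {s : Finset K} {u v : K → ℕ}
    (h : ∀ k ∈ s, u k = v k) : hM.monomial s u = hM.monomial s v :=
  Finset.noncommProd_congr rfl (fun k hk => by rw [h k hk]) _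

lemma monomial_single (hM : M.IsModel X T r κ) (u : K → ℕ) (k : K) (h : ∀ l ≠ k, u l = 0) :
    hM.monomial Finset.univ u = X k ^ u k := by
  rw [hM.monomial_univ u k, mul_eq_right,
    hM.monomial_congr (v := fun _ => 0) (fun l hl => h l (Finset.ne_of_mem_erase hl))]
  exact (Finset.noncommProd_eq_pow_card _ _ _ 1 (by simp)).trans (one_pow _)

/-- The conjugate of the state generator representing a configuration. -/
noncomputable def config (hM : M.IsModel X T r κ) (c : Q × (K → List Γ)) : G :=
  hM.monomial Finset.univ (fun k => num (c.2 k)) * T c.1 *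
    (hM.monomial Finset.univ (fun k => num (c.2 k)))⁻¹

lemma config_step (hM : M.IsModel X T r κ) (c : Q × (K → List Γ)) :
    hM.config (M.step c) = r (c.1, (c.2 (M.stk c.1)).head?) * hM.config c *
      (r (c.1, (c.2 (M.stk c.1)).head?))⁻¹ := by
  obtain ⟨p, S⟩ := c
  set o := (S (M.stk p)).head? with ho
  set k := M.stk p with hk
  set E := hM.monomial (Finset.univ.erase k) (fun l => num (S l)) with hE
  have h1 : hM.monomial (Finset.univ.erase k) (fun l => num ((M.step (p, S)).2 l)) = E :=
    hM.monomial_congr fun l hl => by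
      simp [step, ← hk, Function.update_of_ne (Finset.ne_of_mem_erase hl)]
  have h2 : Commute (r (p, o)) E := Finset.noncommProd_commute _ _ _ _ fun l hl =>
    (hM.commute_r_X (p, o) l (Finset.ne_of_mem_erase hl)).pow_right _
  have h3 := hM.r_mul_X (p, o)
  have h4 := hM.r_mul_T (p, o)
  have h5 : r (p, o) * (X k ^ base Γ) ^ num (S k).tail * (r (p, o))⁻¹ =
      (X k ^ base Γ ^ (M.act p o).1.length) ^ num (S k).tail := by
    rw [← conj_pow, h3]
  have h6 : (M.step (p, S)).1 = (M.act p o).2 := rfl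
  have h7 : (M.step (p, S)).2 k = (M.act p o).1 ++ (S k).tail := by
    simp [step, ← hk, ← ho]
  simp only [config]
  rw [hM.monomial_univ _ k, hM.monomial_univ (fun l => num (S l)) k, h1, ← hE, h6, h7,
    num_append, add_comm (num (M.act p o).1), num_eq_head_tail (S k), ← ho,
    add_comm (digit o), pow_add, pow_mul, pow_add, pow_mul, ← h5]
  have h8 : ∀ A B t : G, (E * (A * B)) * t * (E * (A * B))⁻¹ = E * (A * (B * t * B⁻¹) * A⁻¹) * E⁻¹ :=
    fun A B t => by group
  rw [h8, h8, ← h4]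
  have h9 : (r (p, o))⁻¹ * E * r (p, o) = E := by rw [mul_assoc, ← h2.eq, inv_mul_cancel_left]
  generalize r (p, o) = ρ at h2
  simp only [← hk]
  have h10 : ∀ A B : G, E * (ρ * A * ρ⁻¹ * (ρ * B * ρ⁻¹) * (ρ * A * ρ⁻¹)⁻¹) * E⁻¹ =
    (E * ρ) * (A * B * A⁻¹) * (E * ρ)⁻¹ := fun A B => by group
  rw [h10, ← h2.eq]
  group

lemma commute_config_iterate (hM : M.IsModel X T r κ) {c : Q × (K → List Γ)}
    (h : Commute κ (hM.config c)) (n : ℕ) : Commute κ (hM.config (M.step^[n] c)) := by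
  induction n with
  | zero => exact h
  | succ n ih =>
    rw [Function.iterate_succ_apply', config_step]
    exact ((hM.commute_r_κ _).symm.mul_right ih).mul_right (hM.commute_r_κ _).symm.inv_right

end IsModel

end StackMachine

namespace StackMachine

/-- The generators of the group simulating a stack machine. -/
abbrev Gen (K Γ Q : Type) : Type := (K ⊕ Q) ⊕ ((Q × Option Γ) ⊕ Unit)

namespace Gen

variable {K Γ Q : Type}

/-- The generator moving along a stack coordinate. -/
abbrev x (k : K) : FreeGroup (Gen K Γ Q) := .of (.inl (.inl k))

/-- The generator attached to a state. -/
abbrev t (p : Q) : FreeGroup (Gen K Γ Q) := .of (.inl (.inr p))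

/-- The generator attached to a rule. -/
abbrev r (v : Q × Option Γ) : FreeGroup (Gen K Γ Q) := .of (.inr (.inl v))

/-- The generator detecting visited configurations. -/
abbrev κ : FreeGroup (Gen K Γ Q) := .of (.inr (.inr ()))

/-- The configuration with a single nonempty stack, represented by the number `a`. -/
abbrev config (k : K) (a : ℕ) (p : Q) : FreeGroup (Gen K Γ Q) :=
  x k ^ a * t p * (x k ^ a)⁻¹

end Gen

open Gen

variable {K Γ Q : Type} [DecidableEq K] [Fintype Γ]

/-- The relations expressing that a group simulates a stack machine. -/
noncomputable def modelRels (M : StackMachine K Γ Q) : Set (FreeGroup (Gen K Γ Q)) :=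
  Set.range (fun v : K × K => ⁅(x v.1 : FreeGroup (Gen K Γ Q)), x v.2⁆) ∪
    (fun v : (Q × Option Γ) × K => ⁅(r v.1 : FreeGroup (Gen K Γ Q)), x v.2⁆) '' {v | v.2 ≠ M.stk v.1.1} ∪
    Set.range (fun v => r v * x (M.stk v.1) ^ base Γ * (r v)⁻¹ *
      (x (M.stk v.1) ^ base Γ ^ (M.act v.1 v.2).1.length)⁻¹) ∪
    Set.range (fun v => r v * config (M.stk v.1) (digit v.2) v.1 * (r v)⁻¹ *
      (config (M.stk v.1) (num (M.act v.1 v.2).1) (M.act v.1 v.2).2)⁻¹) ∪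
    Set.range (fun v => ⁅(r v : FreeGroup (Gen K Γ Q)), κ⁆)

/-- The relations expressing that a group simulates a stack machine, and that `κ` commutes with the
configurations at `(h, a)` and `(h, b)` up to the square and the cube of the central element. -/
noncomputable def fixedRels (M : StackMachine K Γ Q) (k : K) (h : Q) (a b : ℕ) :
    Set (FreeGroup (Gen K Γ Q) × ℕ) :=
  (fun w => (w, 0)) '' M.modelRels ∪ {(⁅(κ : FreeGroup (Gen K Γ Q)), config k a h⁆, 2),
    (⁅(κ : FreeGroup (Gen K Γ Q)), config k b h⁆, 3)}

/-- The relation expressing that `κ` commutes with an initial configuration. -/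
def inputRel (k : K) (n : ℕ) (p : Q) : FreeGroup (Gen K Γ Q) × ℕ := (⁅(κ : FreeGroup (Gen K Γ Q)), config k n p⁆, 0)

/-- All relations used to simulate a machine with a given input. -/
noncomputable def allRels (M : StackMachine K Γ Q) (k : K) (h : Q) (a b n : ℕ) (p : Q) :
    Set (FreeGroup (Gen K Γ Q) × ℕ) :=
  insert (inputRel k n p) (M.fixedRels k h a b)

lemma finite_fixedRels [Finite K] [Finite Q] (M : StackMachine K Γ Q) (k : K) (h : Q) (a b : ℕ) :
    (M.fixedRels k h a b).Finite := by
  refine Set.Finite.union (Set.Finite.image _ ?_) (Set.toFinite _)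
  refine Set.Finite.union (Set.Finite.union (Set.Finite.union (Set.Finite.union ?_ ?_) ?_) ?_) ?_
  · exact Set.finite_range _
  · exact Set.Finite.image _ (Set.toFinite _)
  all_goals exact Set.finite_range _

variable {G : Type*} [Group G] {M : StackMachine K Γ Q}

lemma isModel_iff {f : Gen K Γ Q → G} :
    M.IsModel (fun k => f (.inl (.inl k))) (fun p => f (.inl (.inr p)))
      (fun v => f (.inr (.inl v))) (f (.inr (.inr ()))) ↔
      ∀ w ∈ M.modelRels, FreeGroup.lift f w = 1 := by
  constructor
  · rintro hM w ((((⟨v, rfl⟩ | ⟨v, hv, rfl⟩) | ⟨v, rfl⟩) | ⟨v, rfl⟩) | ⟨v, rfl⟩)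
    · simpa [map_commutatorElement, commutatorElement_eq_one_iff_commute] using
        hM.commute_X v.1 v.2
    · simpa [map_commutatorElement, commutatorElement_eq_one_iff_commute] using
        hM.commute_r_X v.1 v.2 hv
    · simpa [mul_inv_eq_one] using hM.r_mul_X v
    · have := hM.r_mul_T v
      rw [← mul_inv_eq_one] at this
      simpa only [map_mul, map_inv, map_pow, FreeGroup.lift_apply_of] using this
    · simpa [map_commutatorElement, commutatorElement_eq_one_iff_commute] using hM.commute_r_κ v
  · intro hw
    refine ⟨fun k l => ?_, fun v l hl => ?_, fun v => ?_, fun v => ?_, fun v => ?_⟩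
    · simpa [map_commutatorElement, commutatorElement_eq_one_iff_commute] using
        hw _ (.inl (.inl (.inl (.inl ⟨(k, l), rfl⟩))))
    · simpa [map_commutatorElement, commutatorElement_eq_one_iff_commute] using
        hw _ (.inl (.inl (.inl (.inr ⟨(v, l), hl, rfl⟩))))
    · simpa [mul_inv_eq_one] using hw _ (.inl (.inl (.inr ⟨v, rfl⟩)))
    · have := hw _ (.inl (.inr ⟨v, rfl⟩))
      rw [← mul_inv_eq_one]
      simpa only [map_mul, map_inv, map_pow, FreeGroup.lift_apply_of] using this
    · simpa [map_commutatorElement, commutatorElement_eq_one_iff_commute] using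
        hw _ (.inr ⟨v, rfl⟩)

/-- If the machine reaches the configuration `(h, l)` from the given initial configuration, then the
relations force the corresponding power of the central element to be trivial. -/
theorem pow_eq_one_of_iterate [Fintype K] {k : K} {h p : Q} {a b n q : ℕ} {c d : Q × (K → List Γ)}
    {f : Gen K Γ Q → G} {z : G}
    (hR : ∀ v ∈ M.allRels k h a b n p, FreeGroup.lift f v.1 = z ^ v.2)
    (hc : c.1 = p) (hck : num (c.2 k) = n) (hcl : ∀ l ≠ k, c.2 l = [])
    {N : ℕ} (hd : M.step^[N] c = d) (hdh : d.1 = h) (hdl : ∀ l ≠ k, d.2 l = [])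
    (hdk : num (d.2 k) = a ∧ q = 2 ∨ num (d.2 k) = b ∧ q = 3) : z ^ q = 1 := by
  have hM : M.IsModel (fun k => f (.inl (.inl k))) (fun p => f (.inl (.inr p)))
      (fun v => f (.inr (.inl v))) (f (.inr (.inr ()))) :=
    isModel_iff.2 fun w hw => (hR (w, 0) (.inr (.inl ⟨w, hw, rfl⟩))).trans (pow_zero z)
  have hconf : ∀ e : Q × (K → List Γ), (∀ l ≠ k, e.2 l = []) →
      hM.config e = FreeGroup.lift f (config k (num (e.2 k)) e.1) := by
    intro e he
    rw [IsModel.config, hM.monomial_single _ k (fun l hl => by rw [he l hl, num])]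
    simp
  have hcomm := hM.commute_config_iterate (c := c) (by
    rw [hconf c hcl, ← commutatorElement_eq_one_iff_commute, hc, hck]
    simpa [inputRel, map_commutatorElement] using hR _ (.inl rfl)) N
  rw [hd, hconf d hdl, ← commutatorElement_eq_one_iff_commute, hdh] at hcomm
  obtain ⟨hk, rfl⟩ | ⟨hk, rfl⟩ := hdk
  · have := hR _ (.inr (.inr (.inl rfl)))
    rw [← this, ← hcomm, hk]
    simp [map_commutatorElement]
  · have := hR _ (.inr (.inr (.inr rfl)))
    rw [← this, ← hcomm, hk]
    simp [map_commutatorElement]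

end StackMachine

namespace Heisenberg

variable {Ω C : Type} [AddCommGroup C]

/-- The permutation adding the value at `ω` to the last coordinate. -/
def evalPerm (ω : Ω) : Equiv.Perm ((Ω → C) × C) where
  toFun v := (v.1, v.2 + v.1 ω)
  invFun v := (v.1, v.2 - v.1 ω)
  left_inv v := by simp
  right_inv v := by simp

/-- The permutation subtracting a given function. -/
def shiftPerm (χ : Ω → C) : Equiv.Perm ((Ω → C) × C) where
  toFun v := (v.1 - χ, v.2)
  invFun v := (v.1 + χ, v.2)
  left_inv v := by simp
  right_inv v := by simp

/-- The permutation adding a constant to the last coordinate. -/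
def centralPerm (a : C) : Equiv.Perm ((Ω → C) × C) where
  toFun v := (v.1, v.2 + a)
  invFun v := (v.1, v.2 - a)
  left_inv v := by simp
  right_inv v := by simp

/-- The action of the permutations of `Ω` on functions on `Ω`. -/
def relabel : Equiv.Perm Ω →* Equiv.Perm ((Ω → C) × C) where
  toFun γ :=
    { toFun v := (fun ω => v.1 (γ⁻¹ ω), v.2)
      invFun v := (fun ω => v.1 (γ ω), v.2)
      left_inv v := by simp
      right_inv v := by simp }
  map_one' := rfl
  map_mul' γ δ := by
    ext v <;> simp

@[simp]
lemma relabel_apply (γ : Equiv.Perm Ω) (v : (Ω → C) × C) :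
    relabel γ v = (fun ω => v.1 (γ⁻¹ ω), v.2) := rfl

lemma commute_centralPerm_evalPerm (a : C) (ω : Ω) :
    Commute (centralPerm a) (evalPerm (C := C) ω) :=
  Equiv.ext fun v => by simp [centralPerm, evalPerm, add_right_comm]

lemma commute_centralPerm_shiftPerm (a : C) (χ : Ω → C) :
    Commute (centralPerm a) (shiftPerm χ) :=
  Equiv.ext fun v => by simp [centralPerm, shiftPerm]

lemma commute_centralPerm_relabel (a : C) (γ : Equiv.Perm Ω) :
    Commute (centralPerm a) (relabel (C := C) γ) :=
  Equiv.ext fun v => by simp [centralPerm]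

lemma centralPerm_pow (a : C) (n : ℕ) :
    (centralPerm a : Equiv.Perm ((Ω → C) × C)) ^ n = centralPerm (n • a) := by
  induction n with
  | zero => ext v <;> simp [centralPerm]
  | succ n ih =>
    rw [pow_succ, ih]
    ext v
    · rfl
    · simp [centralPerm, succ_nsmul, add_assoc, add_comm a]

lemma centralPerm_eq_one_iff (a : C) :
    (centralPerm a : Equiv.Perm ((Ω → C) × C)) = 1 ↔ a = 0 := by
  constructor
  · intro h
    have := congrArg (fun e => (e ((0, 0) : (Ω → C) × C)).2) h
    simpa [centralPerm] using this
  · rintro rfl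
    ext v <;> simp [centralPerm]

lemma commutator_shiftPerm_evalPerm (χ : Ω → C) (ω : Ω) :
    ⁅shiftPerm χ, evalPerm ω⁆ = centralPerm (χ ω) := by
  rw [commutatorElement_def, mul_inv_eq_iff_eq_mul, mul_inv_eq_iff_eq_mul]
  ext v
  · rfl
  · simp [centralPerm, evalPerm, shiftPerm, add_assoc]

lemma relabel_mul_evalPerm (γ : Equiv.Perm Ω) (ω : Ω) :
    relabel γ * evalPerm (C := C) ω * (relabel γ)⁻¹ = evalPerm (γ ω) := by
  rw [mul_inv_eq_iff_eq_mul]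
  ext v <;> simp [evalPerm]

lemma commute_relabel_shiftPerm {γ : Equiv.Perm Ω} {χ : Ω → C} (h : ∀ ω, χ (γ ω) = χ ω) :
    Commute (relabel γ) (shiftPerm χ) :=
  Equiv.ext fun v => by
    have : (fun ω => χ (γ⁻¹ ω)) = χ := funext fun ω => by rw [← h, ← Equiv.Perm.mul_apply,
      mul_inv_cancel, Equiv.Perm.one_apply]
    ext ω
    · simpa [shiftPerm] using congrFun this ω
    · rfl

end Heisenberg

namespace Sheet

variable {Y C : Type}

/-- The permutation of pairs of a point and a function induced by a permutation of points. -/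
def movePoint : Equiv.Perm Y →* Equiv.Perm (Y × (Y → C)) where
  toFun a := a.prodCongr (Equiv.refl _)
  map_one' := rfl
  map_mul' _ _ := rfl

@[simp]
lemma movePoint_apply (a : Equiv.Perm Y) (v : Y × (Y → C)) : movePoint a v = (a v.1, v.2) := rfl

/-- The permutation exchanging two functions over the points of a set. -/
noncomputable def exchange (f g : Y → C) (D : Set Y) : Equiv.Perm (Y × (Y → C)) :=
  open Classical in
  { toFun v := (v.1, if v.1 ∈ D then Equiv.swap f g v.2 else v.2)
    invFun v := (v.1, if v.1 ∈ D then Equiv.swap f g v.2 else v.2)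
    left_inv v := by by_cases h : v.1 ∈ D <;> simp [h]
    right_inv v := by by_cases h : v.1 ∈ D <;> simp [h] }

/-- A permutation inducing `β` on points, preserving the value of the function at the point, and
sending `(y, f)` to `(β y, f)` whenever `β y` lies in `D`. -/
noncomputable def moveAlong (f : Y → C) (β : Equiv.Perm Y) (D : Set Y) :
    Equiv.Perm (Y × (Y → C)) :=
  exchange f (f ∘ β.symm) D * β.prodCongr (β.arrowCongr (Equiv.refl C))

open Classical in
lemma swap_apply_of_eq {f g : Y → C} {y : Y} (h : f y = g y) (e : Y → C) :
    Equiv.swap f g e y = e y := by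
  rcases eq_or_ne e f with rfl | h1
  · rw [Equiv.swap_apply_left, h]
  · rcases eq_or_ne e g with rfl | h2
    · rw [Equiv.swap_apply_right, h]
    · rw [Equiv.swap_apply_of_ne_of_ne h1 h2]

lemma eval_moveAlong {f : Y → C} {β : Equiv.Perm Y} {D : Set Y}
    (h : ∀ y, β y ∈ D → f (β y) = f y) (v : Y × (Y → C)) :
    (moveAlong f β D v).2 (moveAlong f β D v).1 = v.2 v.1 := by
  obtain ⟨y, g⟩ := v
  by_cases hy : β y ∈ D
  · simp only [moveAlong, exchange, Equiv.Perm.mul_apply, Equiv.prodCongr_apply, Prod.map_apply,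
      Equiv.coe_fn_mk, hy, if_true]
    exact (swap_apply_of_eq (by simpa using h y hy) _).trans (by simp)
  · simp [moveAlong, exchange, hy]

lemma moveAlong_apply {f : Y → C} {β : Equiv.Perm Y} {D : Set Y} {y : Y} (hy : β y ∈ D) :
    moveAlong f β D (y, f) = (β y, f) := by
  have : β.arrowCongr (Equiv.refl C) f = f ∘ β.symm := rfl
  simp [moveAlong, exchange, hy, this]

lemma moveAlong_mul_movePoint {f : Y → C} {β a b : Equiv.Perm Y} {D : Set Y}
    (h : β * a = b * β) (hb : ∀ y, b y ∈ D ↔ y ∈ D)  :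
    moveAlong f β D * movePoint a = movePoint b * moveAlong f β D := by
  refine Equiv.ext fun v => ?_
  have h1 : β (a v.1) = b (β v.1) := DFunLike.congr_fun h v.1
  by_cases h2 : β v.1 ∈ D
  · have h3 : b (β v.1) ∈ D := (hb _).2 h2
    simp [moveAlong, exchange, h1, h2, h3]
  · have h3 : b (β v.1) ∉ D := fun h => h2 ((hb _).1 h)
    simp [moveAlong, exchange, h1, h2, h3]

end Sheet

namespace Gadget

/-- If a group contains a central element `z ≠ 1` with `z ^ 6 = 1` satisfying the relations
`w = z ^ e`, then the central generator of the gadget group is nontrivial. It suffices that `z`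
commutes with the images of the generators. -/
theorem of_c_ne_one_of_commute {ι : Type} {R : Set (FreeGroup ι × ℕ)} {M : Type} [Group M]
    (m : ι → M) {z : M} (hz : ∀ i, Commute z (m i)) (h6 : z ^ 6 = 1)
    (hR : ∀ p ∈ R, FreeGroup.lift m p.1 = z ^ p.2) (hz1 : z ≠ 1) :
    (PresentedGroup.of c : Grp R) ≠ 1 := by
  let H := Subgroup.centralizer {z}
  have hm : ∀ i, m i ∈ H := fun i => Subgroup.mem_centralizer_singleton_iff.2 (hz i).eq.symm
  let m' : ι → H := fun i => ⟨m i, hm i⟩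
  have hl : ∀ w, (FreeGroup.lift m' w : M) = FreeGroup.lift m w := fun w => by
    have : H.subtype.comp (FreeGroup.lift m') = FreeGroup.lift m := by
      ext i
      simp [m']
    exact DFunLike.congr_fun this w
  refine of_c_ne_one (M := H) m' (z := ⟨z, Subgroup.mem_centralizer_singleton_iff.2 rfl⟩)
    (fun a => ?_) ?_ (fun p hp => ?_) ?_
  · exact Subtype.ext (Subgroup.mem_centralizer_singleton_iff.1 a.2).symm
  · exact Subtype.ext h6
  · exact Subtype.ext ((hl _).trans (hR p hp))
  · exact fun h => hz1 (congrArg Subtype.val h)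

end Gadget

namespace StackMachine

variable {K Γ Q : Type} [DecidableEq K] [Fintype Γ]

/-- The affine bijection acting on the number representing a stack whose top symbol `o` is replaced
by the word `w`. -/
noncomputable def affine (o : Option Γ) (w : List Γ) : Equiv.Perm ℚ where
  toFun u := (u - digit o) / base Γ * base Γ ^ w.length + num w
  invFun u := (u - num w) / base Γ ^ w.length * base Γ + digit o
  left_inv u := by
    have : (base Γ : ℚ) ≠ 0 := by exact_mod_cast base_pos.ne'
    field_simp
    ring
  right_inv u := by
    have : (base Γ : ℚ) ≠ 0 := by exact_mod_cast base_pos.ne'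
    field_simp
    ring

/-- Apply a permutation of `ℚ` to one coordinate. -/
def onCoord (k : K) (e : Equiv.Perm ℚ) : Equiv.Perm (K → ℚ) where
  toFun u := Function.update u k (e (u k))
  invFun u := Function.update u k (e.symm (u k))
  left_inv u := by simp
  right_inv u := by simp

/-- The translation by one in the coordinate of a stack. -/
def shift (Q : Type) (k : K) : Equiv.Perm (Q × (K → ℚ)) :=
  (Equiv.refl Q).prodCongr (Equiv.addRight (Pi.single k 1))

lemma shift_pow_apply (k : K) (n : ℕ) (y : Q × (K → ℚ)) :
    (shift Q k ^ n) y = (y.1, y.2 + Pi.single k (n : ℚ)) := by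
  induction n with
  | zero => simp
  | succ n ih =>
    rw [pow_succ', Equiv.Perm.mul_apply, ih]
    simp [shift, add_assoc, ← Pi.single_add]

lemma shift_apply (k : K) (y : Q × (K → ℚ)) : shift Q k y = (y.1, y.2 + Pi.single k 1) := rfl

variable (M : StackMachine K Γ Q)

open Classical in
/-- The bijection of generalised configurations given by a rule. -/
noncomputable def move (v : Q × Option Γ) : Equiv.Perm (Q × (K → ℚ)) :=
  (Equiv.swap v.1 (M.act v.1 v.2).2).prodCongr
    (onCoord (M.stk v.1) (affine v.2 (M.act v.1 v.2).1))

/-- The generalised configurations to which a rule leads. -/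
def target (v : Q × Option Γ) : Set (Q × (K → ℚ)) :=
  {y | y.1 = (M.act v.1 v.2).2 ∧ ∃ j : ℤ, y.2 (M.stk v.1) =
    num (M.act v.1 v.2).1 + (base Γ : ℚ) ^ (M.act v.1 v.2).1.length * j}

/-- The step relation on generalised configurations. -/
def Step (y y' : Q × (K → ℚ)) : Prop :=
  ∃ o : Option Γ, (∃ j : ℤ, y.2 (M.stk y.1) = base Γ * j + digit o) ∧ y' = M.move (y.1, o) y

/-- The generalised configuration of a configuration. -/
noncomputable def enc (c : Q × (K → List Γ)) : Q × (K → ℚ) := (c.1, fun k => num (c.2 k))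

variable {M}

lemma Step.eq {y y₁ y₂ : Q × (K → ℚ)} (h₁ : M.Step y y₁) (h₂ : M.Step y y₂) : y₁ = y₂ := by
  obtain ⟨o₁, ⟨j₁, e₁⟩, rfl⟩ := h₁
  obtain ⟨o₂, ⟨j₂, e₂⟩, rfl⟩ := h₂
  have h : (base Γ : ℤ) * j₁ + digit o₁ = base Γ * j₂ + digit o₂ := by
    exact_mod_cast e₁.symm.trans e₂
  have h' := congrArg (· % (base Γ : ℤ)) h
  simp only [Int.mul_add_emod_self_left] at h'
  norm_cast at h'
  rw [Nat.mod_eq_of_lt (digit_lt_base _), Nat.mod_eq_of_lt (digit_lt_base _)] at h'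
  rw [digit_injective h']

lemma step_enc (c : Q × (K → List Γ)) : M.Step (enc c) (enc (M.step c)) := by
  refine ⟨(c.2 (M.stk c.1)).head?, ⟨num (c.2 (M.stk c.1)).tail, ?_⟩, ?_⟩
  · simp only [enc]
    rw [num_eq_head_tail]
    push_cast
    ring
  · have hb : (base Γ : ℚ) ≠ 0 := by exact_mod_cast base_pos.ne'
    refine Prod.ext ?_ (funext fun l => ?_)
    · simp [move, enc, step]
    · by_cases hl : l = M.stk c.1
      · subst hl
        simp only [enc, step, Function.update_self, move, Equiv.prodCongr_apply, Prod.map_apply,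
          onCoord, affine, Equiv.coe_fn_mk, num_append]
        conv_rhs => rw [num_eq_head_tail (c.2 (M.stk c.1))]
        push_cast
        field_simp
        ring
      · simp [move, enc, step, onCoord, Function.update_of_ne hl]

lemma exists_iterate_of_reflTransGen {c : Q × (K → List Γ)} {y : Q × (K → ℚ)}
    (h : Relation.ReflTransGen M.Step (enc c) y) : ∃ N, y = enc (M.step^[N] c) := by
  induction h with
  | refl => exact ⟨0, rfl⟩
  | tail _ h ih =>
    obtain ⟨N, rfl⟩ := ih
    exact ⟨N + 1, by rw [Function.iterate_succ_apply']; exact h.eq (step_enc _)⟩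

/-- A function on generalised configurations that is invariant under the machine and separates a
fixed configuration from all configurations not leading to it. -/
lemma exists_invariant {C : Type} [Zero C] (e : C) {t : Q × (K → List Γ)} (ht : M.step t = t) :
    ∃ f : Q × (K → ℚ) → C, (∀ y y', M.Step y y' → f y' = f y) ∧ f (enc t) = e ∧
      ∀ c, (∀ N, enc (M.step^[N] c) ≠ enc t) → f (enc c) = 0 := by
  classical
  refine ⟨fun y => if Relation.ReflTransGen M.Step y (enc t) then e else 0, fun y y' h => ?_,
    if_pos .refl, fun c hc => if_neg fun h => ?_⟩
  · have : Relation.ReflTransGen M.Step y' (enc t) ↔ Relation.ReflTransGen M.Step y (enc t) := by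
      refine ⟨fun h' => .head h h', fun h' => ?_⟩
      obtain rfl | ⟨z, hz, h'⟩ := h'.cases_head
      · have h1 := step_enc (M := M) t
        rw [ht] at h1
        rw [h.eq h1]
      · rwa [h.eq hz]
    simp only [this]
  · obtain ⟨N, hN⟩ := exists_iterate_of_reflTransGen h
    exact hc N hN.symm

end StackMachine

namespace StackMachine

variable {K Γ Q : Type} [DecidableEq K] [Fintype Γ] {M : StackMachine K Γ Q}

lemma move_mul_shift_of_ne {v : Q × Option Γ} {l : K} (hl : l ≠ M.stk v.1) :
    M.move v * shift Q l = shift Q l * M.move v := by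
  refine Equiv.ext fun y => Prod.ext rfl (funext fun i => ?_)
  rcases eq_or_ne i (M.stk v.1) with rfl | hi
  · simp [move, shift_apply, onCoord, hl.symm]
  · simp [move, shift_apply, onCoord, Function.update_of_ne hi]

lemma move_mul_shift_pow (v : Q × Option Γ) :
    M.move v * shift Q (M.stk v.1) ^ base Γ =
      shift Q (M.stk v.1) ^ base Γ ^ (M.act v.1 v.2).1.length * M.move v := by
  have hb : (base Γ : ℚ) ≠ 0 := by exact_mod_cast base_pos.ne'
  refine Equiv.ext fun y => Prod.ext ?_ (funext fun i => ?_)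
  · simp [move, shift_pow_apply]
  rcases eq_or_ne i (M.stk v.1) with rfl | hi
  · simp only [move, Equiv.Perm.mul_apply, shift_pow_apply, Equiv.prodCongr_apply, Prod.map_snd,
      onCoord, affine, Equiv.coe_fn_mk, Function.update_self, Pi.add_apply, Pi.single_eq_same]
    push_cast
    field_simp
    ring
  · simp [move, shift_pow_apply, onCoord, hi]

lemma shift_mem_target_of_ne {v : Q × Option Γ} {l : K} (hl : l ≠ M.stk v.1)
    (y : Q × (K → ℚ)) : shift Q l y ∈ M.target v ↔ y ∈ M.target v := by
  simp [target, shift_apply, hl.symm]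

lemma shift_pow_mem_target (v : Q × Option Γ) (y : Q × (K → ℚ)) :
    (shift Q (M.stk v.1) ^ base Γ ^ (M.act v.1 v.2).1.length) y ∈ M.target v ↔
      y ∈ M.target v := by
  simp only [target, shift_pow_apply, Set.mem_ofPred_eq, Pi.add_apply, Pi.single_eq_same]
  refine and_congr_right fun _ => ⟨fun ⟨j, hj⟩ => ⟨j - 1, ?_⟩, fun ⟨j, hj⟩ => ⟨j + 1, ?_⟩⟩
  · push_cast at hj ⊢
    linarith
  · push_cast at hj ⊢
    linarith

lemma step_of_move_mem_target {v : Q × Option Γ} {y : Q × (K → ℚ)}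
    (h : M.move v y ∈ M.target v) : M.Step y (M.move v y) := by
  obtain ⟨p, o⟩ := v
  obtain ⟨h1, j, h2⟩ := h
  have hp : y.1 = p := by
    classical
    exact (Equiv.swap_apply_eq_iff.1 h1).trans (Equiv.swap_apply_right _ _)
  obtain ⟨q, u⟩ := y
  obtain rfl : q = p := hp
  refine ⟨o, ⟨j, ?_⟩, rfl⟩
  have hb : (base Γ : ℚ) ≠ 0 := by exact_mod_cast base_pos.ne'
  simp only [move, Equiv.prodCongr_apply, Prod.map_apply, onCoord, affine, Equiv.coe_fn_mk,
    Function.update_self] at h2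
  rw [add_comm, add_right_inj, mul_comm] at h2
  have h3 := mul_left_cancel₀ (pow_ne_zero _ hb) h2
  rw [div_eq_iff hb] at h3
  linarith

lemma move_single (v : Q × Option Γ) :
    M.move v (v.1, Pi.single (M.stk v.1) (digit v.2 : ℚ)) =
      ((M.act v.1 v.2).2, Pi.single (M.stk v.1) (num (M.act v.1 v.2).1 : ℚ)) := by
  refine Prod.ext (by simp [move]) (funext fun i => ?_)
  rcases eq_or_ne i (M.stk v.1) with rfl | hi
  · simp [move, onCoord, affine]
  · simp [move, onCoord, hi]

section Representation

variable {q : ℕ} (M) (f : Q × (K → ℚ) → ZMod q)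

/-- The points of the space on which the Heisenberg-like group acts. -/
abbrev Point (K Q : Type) (q : ℕ) : Type := (Q × (K → ℚ)) × (Q × (K → ℚ) → ZMod q)

/-- The permutations interpreting the generators. -/
noncomputable def interp : Gen K Γ Q → Equiv.Perm ((Point K Q q → ZMod q) × ZMod q)
  | .inl (.inl k) => Heisenberg.relabel (Sheet.movePoint (shift Q k))
  | .inl (.inr p) => Heisenberg.evalPerm ((p, 0), f)
  | .inr (.inl v) => Heisenberg.relabel (Sheet.moveAlong f (M.move v) (M.target v))
  | .inr (.inr ()) => Heisenberg.shiftPerm fun y => y.2 y.1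

variable {M f}

lemma commute_centralPerm_interp (g : Gen K Γ Q) :
    Commute (Heisenberg.centralPerm 1) (interp M f g) := by
  obtain (k | p) | (v | _) := g
  · exact Heisenberg.commute_centralPerm_relabel _ _
  · exact Heisenberg.commute_centralPerm_evalPerm _ _
  · exact Heisenberg.commute_centralPerm_relabel _ _
  · exact Heisenberg.commute_centralPerm_shiftPerm _ _

lemma interp_x_pow (k : K) (n : ℕ) : interp M f (.inl (.inl k)) ^ n =
    Heisenberg.relabel (Sheet.movePoint (shift Q k ^ n)) := by
  rw [interp, map_pow, map_pow]

lemma interp_config (k : K) (n : ℕ) (p : Q) :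
    interp M f (.inl (.inl k)) ^ n * interp M f (.inl (.inr p)) *
      (interp M f (.inl (.inl k)) ^ n)⁻¹ =
      Heisenberg.evalPerm ((p, Pi.single k (n : ℚ)), f) := by
  rw [interp_x_pow, interp, Heisenberg.relabel_mul_evalPerm, Sheet.movePoint_apply,
    shift_pow_apply, zero_add]

lemma isModel_interp (hf : ∀ y y', M.Step y y' → f y' = f y) :
    M.IsModel (fun k => interp M f (.inl (.inl k))) (fun p => interp M f (.inl (.inr p)))
      (fun v => interp M f (.inr (.inl v))) (interp M f (.inr (.inr ()))) where
  commute_X k l := by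
    refine Commute.map (Commute.map ?_ Sheet.movePoint) Heisenberg.relabel
    exact Equiv.ext fun y => by simp [shift_apply, add_right_comm]
  commute_r_X v l hl := Commute.map (Sheet.moveAlong_mul_movePoint (move_mul_shift_of_ne hl)
    (shift_mem_target_of_ne hl)) Heisenberg.relabel
  r_mul_X v := by
    simp only [interp_x_pow]
    rw [mul_inv_eq_iff_eq_mul, interp, ← map_mul, ← map_mul,
      Sheet.moveAlong_mul_movePoint (move_mul_shift_pow v) (shift_pow_mem_target v)]
  r_mul_T v := by
    have h : M.move v (v.1, Pi.single (M.stk v.1) (digit v.2 : ℚ)) ∈ M.target v := by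
      rw [move_single]
      exact ⟨rfl, 0, by simp⟩
    rw [interp_config, interp_config]
    simp only [interp]
    rw [Heisenberg.relabel_mul_evalPerm, Sheet.moveAlong_apply h, move_single]
  commute_r_κ v := Heisenberg.commute_relabel_shiftPerm
    (Sheet.eval_moveAlong fun y hy => hf _ _ (step_of_move_mem_target hy))

end Representation

/-- If a function with values in `ℤ/q` is invariant under the machine and takes the prescribed
values at the initial and final configurations, then the central generator of the gadget group
of the machine is nontrivial. -/
theorem of_c_ne_one_of_invariant {q : ℕ} (hq : q = 2 ∨ q = 3) {k : K} {h p : Q} {a b n : ℕ}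
    {f : Q × (K → ℚ) → ZMod q} (hf : ∀ y y', M.Step y y' → f y' = f y)
    (h0 : f (p, Pi.single k (n : ℚ)) = 0) (h2 : f (h, Pi.single k (a : ℚ)) = 2)
    (h3 : f (h, Pi.single k (b : ℚ)) = 3) :
    (PresentedGroup.of Gadget.c : Gadget.Grp (M.allRels k h a b n p)) ≠ 1 := by
  have hcomm : ∀ n p, FreeGroup.lift (interp M f) ⁅Gen.κ, Gen.config k n p⁆ =
      Heisenberg.centralPerm (f (p, Pi.single k (n : ℚ))) := fun n p => by
    rw [map_commutatorElement]
    simp only [map_mul, map_inv, map_pow, FreeGroup.lift_apply_of]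
    rw [interp_config]
    exact Heisenberg.commutator_shiftPerm_evalPerm _ _
  have h10 : (1 : ZMod q) ≠ 0 ∧ (6 : ZMod q) = 0 := by
    rcases hq with rfl | rfl <;> decide
  refine Gadget.of_c_ne_one_of_commute (interp M f) commute_centralPerm_interp ?_ ?_
    (mt (Heisenberg.centralPerm_eq_one_iff _).1 h10.1)
  · rw [Heisenberg.centralPerm_pow, Heisenberg.centralPerm_eq_one_iff]
    simpa using h10.2
  · rintro w (rfl | ⟨w, hw, rfl⟩ | rfl | rfl)
    · rw [inputRel, hcomm, Heisenberg.centralPerm_pow, h0, zero_smul]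
    · exact (isModel_iff.1 (isModel_interp hf) w hw).trans (pow_zero _).symm
    · rw [hcomm, Heisenberg.centralPerm_pow, h2]
      simp
    · rw [hcomm, Heisenberg.centralPerm_pow, h3]
      simp

lemma enc_eq_single {c : Q × (K → List Γ)} {k : K} (hl : ∀ l ≠ k, c.2 l = []) :
    enc c = (c.1, Pi.single k (num (c.2 k) : ℚ)) := by
  refine Prod.ext rfl (funext fun l => ?_)
  rcases eq_or_ne l k with rfl | hlk
  · simp [enc]
  · simp [enc, hlk, hl l hlk, num]

/-- If the machine does not reach one of the two fixed final configurations, then the central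
generator of the gadget group of the machine is nontrivial. -/
theorem of_c_ne_one_of_not_reach {k : K} {c s t : Q × (K → List Γ)}
    (hc : ∀ l ≠ k, c.2 l = []) (hs : ∀ l ≠ k, s.2 l = []) (ht : ∀ l ≠ k, t.2 l = [])
    (hs' : M.step s = s) (ht' : M.step t = t) (hst : s.1 = t.1)
    (hne : num (s.2 k) ≠ num (t.2 k))
    (h : (∀ N, enc (M.step^[N] c) ≠ enc s) ∨ (∀ N, enc (M.step^[N] c) ≠ enc t)) :
    (PresentedGroup.of Gadget.c : Gadget.Grp
      (M.allRels k s.1 (num (s.2 k)) (num (t.2 k)) (num (c.2 k)) c.1)) ≠ 1 := by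
  have hne' : enc s ≠ enc t := fun h => hne (by
    have : (num (s.2 k) : ℚ) = num (t.2 k) := congrFun (congrArg Prod.snd h) k
    exact_mod_cast this)
  obtain h | h := h
  · obtain ⟨f, hf, h1, h0⟩ := exists_invariant (2 : ZMod 3) hs'
    refine of_c_ne_one_of_invariant (.inr rfl) hf ?_ ?_ ?_
    · rw [← enc_eq_single hc, h0 c h]
    · rw [← enc_eq_single hs, h1]
    · rw [hst, ← enc_eq_single ht, h0 t (fun N => by
        rw [Function.iterate_fixed ht']; exact hne'.symm)]
      rfl
  · obtain ⟨f, hf, h1, h0⟩ := exists_invariant (3 : ZMod 2) ht'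
    refine of_c_ne_one_of_invariant (.inl rfl) hf ?_ ?_ ?_
    · rw [← enc_eq_single hc, h0 c h]
    · rw [← enc_eq_single hs, h0 s (fun N => by
        rw [Function.iterate_fixed hs']; exact hne')]
      rfl
    · rw [hst, ← enc_eq_single ht, h1]

end StackMachine

namespace StackMachine

section States

open Turing TM2

variable {K Γ Λ σ : Type} (M : Λ → Stmt (fun _ : K => Γ) Λ σ)

/-- The states of the stack machine relevant for a finite set of labels. -/
def states (S : Finset Λ) : Set (Stmt (fun _ : K => Γ) Λ σ × σ) :=
  {p | p.1 = .halt ∨ some p.1 ∈ stmts M S}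

lemma finite_states [Finite σ] (S : Finset Λ) : (states M S).Finite := by
  classical
  have h : {q : Stmt (fun _ : K => Γ) Λ σ | some q ∈ stmts M S}.Finite :=
    (stmts M S).finite_toSet.preimage (Option.some_injective _).injOn
  refine ((h.insert .halt).prod (Set.finite_univ (α := σ))).subset ?_
  rintro p (hp | hp)
  · exact ⟨.inl hp, trivial⟩
  · exact ⟨.inr hp, trivial⟩

lemma mem_states_of_mem {S : Finset Λ} {l : Λ} (hl : l ∈ S) (v : σ) : (M l, v) ∈ states M S := by
  refine .inr ?_
  simp only [stmts, Finset.mem_insertNone, Finset.mem_biUnion, Option.mem_def, Option.some.injEq,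
    forall_eq']
  exact ⟨l, hl, stmts₁_self⟩

variable [Inhabited K]

/-- The stack machine executing the statements of a multi-stack Turing machine one by one. -/
def ofTM2 : StackMachine K Γ (Stmt (fun _ : K => Γ) Λ σ × σ) where
  stk
    | (.push k _ _, _) => k
    | (.peek k _ _, _) => k
    | (.pop k _ _, _) => k
    | _ => default
  act
    | (.push _ f q, v), o => (f v :: o.toList, (q, v))
    | (.peek _ f q, v), o => (o.toList, (q, f v o))
    | (.pop _ f q, v), o => ([], (q, f v o))
    | (.load f q, v), o => (o.toList, (q, f v))
    | (.branch f q₁ q₂, v), o => (o.toList, (cond (f v) q₁ q₂, v))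
    | (.goto f, v), o => (o.toList, (M (f v), v))
    | (.halt, v), o => (o.toList, (.halt, v))

lemma act_mem_states [Inhabited Λ] {S : Finset Λ} (hS : TM2.Supports M S) :
    ∀ p ∈ states M S, ∀ o, ((ofTM2 M).act p o).2 ∈ states M S := by
  rintro ⟨q, v⟩ (rfl | hq) o
  · exact .inl rfl
  cases q with
  | halt => exact .inl rfl
  | goto f => exact mem_states_of_mem M (stmts_supportsStmt hS hq v) v
  | branch f q₁ q₂ =>
    refine .inr (stmts_trans ?_ hq)
    cases h : f v <;> simp [ofTM2, stmts₁, h, stmts₁_self]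
  | load | push | peek | pop =>
    exact .inr (stmts_trans (by simp [ofTM2, stmts₁, stmts₁_self]) hq)

end States

variable {K Γ Q : Type} [DecidableEq K]

section Enc

variable [Fintype Γ] {M : StackMachine K Γ Q}

lemma enc_iterate_congr {c d : Q × (K → List Γ)} (h : enc c = enc d) (n : ℕ) :
    enc (M.step^[n] c) = enc (M.step^[n] d) := by
  induction n with
  | zero => exact h
  | succ n ih =>
    rw [Function.iterate_succ_apply', Function.iterate_succ_apply']
    have h1 := step_enc (M := M) (M.step^[n] c)
    rw [ih] at h1
    exact h1.eq (step_enc _)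

/-- The gadget group of a machine with two different fixed final configurations has a nontrivial
central generator. -/
theorem of_c_ne_one {k : K} {c s t : Q × (K → List Γ)}
    (hc : ∀ l ≠ k, c.2 l = []) (hs : ∀ l ≠ k, s.2 l = []) (ht : ∀ l ≠ k, t.2 l = [])
    (hs' : M.step s = s) (ht' : M.step t = t) (hst : s.1 = t.1)
    (hne : num (s.2 k) ≠ num (t.2 k)) :
    (PresentedGroup.of Gadget.c : Gadget.Grp
      (M.allRels k s.1 (num (s.2 k)) (num (t.2 k)) (num (c.2 k)) c.1)) ≠ 1 := by
  refine of_c_ne_one_of_not_reach hc hs ht hs' ht' hst hne ?_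
  by_contra! ⟨⟨N, hN⟩, ⟨N', hN'⟩⟩
  have h1 := enc_iterate_congr (M := M) hN N'
  have h2 := enc_iterate_congr (M := M) hN' N
  rw [Function.iterate_fixed hs', ← Function.iterate_add_apply] at h1
  rw [Function.iterate_fixed ht', ← Function.iterate_add_apply, add_comm, h1] at h2
  have : (num (s.2 k) : ℚ) = num (t.2 k) := congrFun (congrArg Prod.snd h2) k
  exact hne (by exact_mod_cast this)

end Enc

section Restrict

/-- The restriction of a machine to a set of states closed under its actions. -/
def restrict (M : StackMachine K Γ Q) (F : Set Q) (hF : ∀ p ∈ F, ∀ o, (M.act p o).2 ∈ F) :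
    StackMachine K Γ F where
  stk p := M.stk p
  act p o := ((M.act p o).1, ⟨(M.act p o).2, hF p p.2 o⟩)

lemma iterate_restrict {M : StackMachine K Γ Q} {F : Set Q}
    {hF : ∀ p ∈ F, ∀ o, (M.act p o).2 ∈ F} (c : F × (K → List Γ)) (n : ℕ) :
    Prod.map Subtype.val id ((M.restrict F hF).step^[n] c) =
      M.step^[n] (Prod.map Subtype.val id c) :=
  Function.Semiconj.iterate_right (f := Prod.map Subtype.val id)
    (ga := (M.restrict F hF).step) (gb := M.step) (fun _ => rfl) n c

end Restrict

section OfTM2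

open Turing TM2

variable [Inhabited K] {Λ σ : Type} (M : Λ → Stmt (fun _ : K => Γ) Λ σ)

/-- The configuration of the stack machine corresponding to a configuration of the multi-stack
Turing machine. -/
def ofCfg (c : Cfg (fun _ : K => Γ) Λ σ) :
    (Stmt (fun _ : K => Γ) Λ σ × σ) × (K → List Γ) :=
  ((c.l.elim .halt M, c.var), c.stk)

lemma head?_toList_append_tail (l : List Γ) : l.head?.toList ++ l.tail = l := by
  cases l <;> rfl

lemma ofTM2_step_halt (v : σ) (S : K → List Γ) :
    (ofTM2 M).step ((.halt, v), S) = ((.halt, v), S) := by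
  simp [step, ofTM2, head?_toList_append_tail]

lemma exists_iterate_ofTM2 (q : Stmt (fun _ : K => Γ) Λ σ) (v : σ) (S : K → List Γ) :
    ∃ n, (ofTM2 M).step^[n] ((q, v), S) = ofCfg M (stepAux q v S) := by
  have key : ∀ {x x' y : (Stmt (fun _ : K => Γ) Λ σ × σ) × (K → List Γ)},
      (∃ n, (ofTM2 M).step^[n] x' = y) → (ofTM2 M).step x = x' → ∃ n, (ofTM2 M).step^[n] x = y :=
    fun ⟨n, hn⟩ h => ⟨n + 1, by rw [Function.iterate_succ_apply, h, hn]⟩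
  induction q generalizing v S with
  | push k f q ih =>
    exact key (ih _ _) (by simp [step, ofTM2, head?_toList_append_tail])
  | peek k f q ih =>
    exact key (ih _ _) (by simp [step, ofTM2, head?_toList_append_tail])
  | pop k f q ih => exact key (ih _ _) rfl
  | load f q ih =>
    exact key (ih _ _) (by simp [step, ofTM2, head?_toList_append_tail])
  | branch f q₁ q₂ ih₁ ih₂ =>
    rw [stepAux]
    cases h : f v with
    | true => exact key (ih₁ _ _) (by simp [step, ofTM2, head?_toList_append_tail, h])
    | false => exact key (ih₂ _ _) (by simp [step, ofTM2, head?_toList_append_tail, h])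
  | goto f =>
    exact ⟨1, by simp [step, ofTM2, head?_toList_append_tail, ofCfg, stepAux]⟩
  | halt => exact ⟨0, rfl⟩

lemma exists_iterate_of_reaches {c d : Cfg (fun _ : K => Γ) Λ σ} (h : TM2.Reaches M c d) :
    ∃ n, (ofTM2 M).step^[n] (ofCfg M c) = ofCfg M d := by
  induction h with
  | refl => exact ⟨0, rfl⟩
  | @tail b d _ h ih =>
    obtain ⟨n, hn⟩ := ih
    obtain ⟨_ | l, v, S⟩ := b
    · cases h
    · obtain rfl : stepAux (M l) v S = d := by simpa [TM2.step] using h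
      obtain ⟨m, hm⟩ := exists_iterate_ofTM2 M (M l) v S
      exact ⟨m + n, by rw [Function.iterate_add_apply, hn]; exact hm⟩

end OfTM2

end StackMachine

namespace StackMachine

open Turing PartrecToTM2

lemma trNat_bit {b : Bool} {n : ℕ} (h : Nat.bit b n ≠ 0) :
    trNat (Nat.bit b n) = cond b Γ'.bit1 Γ'.bit0 :: trNat n := by
  rw [trNat, trNat, ← Num.ofNat'_eq, ← Num.ofNat'_eq, Num.ofNat'_bit]
  cases b
  · obtain ⟨m, hm⟩ : ∃ m, Num.ofNat' n = Num.pos m := by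
      cases h' : Num.ofNat' n with
      | zero =>
        rw [Num.ofNat'_eq] at h'
        have h2 : n = 0 := by
          have := congrArg (fun x : Num => (x : ℕ)) h'
          simpa using this
        simp [h2] at h
      | pos m => exact ⟨m, rfl⟩
    rw [hm]
    rfl
  · cases Num.ofNat' n <;> rfl

lemma num_trList_bit {b : Bool} {n : ℕ} (h : Nat.bit b n ≠ 0) :
    num (trList [Nat.bit b n]) =
      digit (some (cond b Γ'.bit1 Γ'.bit0)) + base Γ' * num (trList [n]) := by
  rw [trList, trNat_bit h]
  rfl

lemma num_trList_zero : num (trList [0]) = digit (some Γ'.cons) := by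
  simp [trList, num]

/-- The number representing the stack holding the input `n` is computable from `n`. -/
lemma primrec_num_trList : Primrec fun n => num (trList [n]) := by
  let g : List ℕ → Option ℕ := fun l => some (if l.length = 0 then digit (some Γ'.cons) else
    (if l.length % 2 = 1 then digit (some Γ'.bit1) else digit (some Γ'.bit0)) +
      base Γ' * l.getI (l.length / 2))
  have hl : Primrec fun l : List ℕ => l.length := Primrec.list_length
  have hg : Primrec g := by
    refine Primrec.option_some.comp (Primrec.ite (Primrec.eq.comp hl (Primrec.const 0))
      (Primrec.const _) (Primrec.nat_add.comp (Primrec.ite (Primrec.eq.comp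
        (Primrec.nat_mod.comp hl (Primrec.const 2)) (Primrec.const 1)) (Primrec.const _)
        (Primrec.const _)) (Primrec.nat_mul.comp (Primrec.const _) (Primrec.list_getI.comp
          Primrec.id (Primrec.nat_div.comp hl (Primrec.const 2))))))
  refine (Primrec.nat_strong_rec (fun (_ : Unit) n => num (trList [n])) (g := fun _ l => g l)
    (hg.comp Primrec.snd) fun _ n => ?_).comp (Primrec.const ()) Primrec.id
  simp only [g, List.length_map, List.length_range, Option.some.injEq]
  split_ifs with h0 h1
  · rw [h0, num_trList_zero]
  · have h2 : n / 2 < n := Nat.div_lt_self (Nat.pos_of_ne_zero h0) one_lt_two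
    have h3 : n = Nat.bit true (n / 2) := by simp [Nat.bit]; omega
    conv_rhs => rw [h3, num_trList_bit (h3 ▸ h0)]
    rw [List.getI_eq_getElem _ (by simpa using h2)]
    simp
  · have h2 : n / 2 < n := Nat.div_lt_self (Nat.pos_of_ne_zero h0) one_lt_two
    have h3 : n = Nat.bit false (n / 2) := by simp [Nat.bit]; omega
    conv_rhs => rw [h3, num_trList_bit (h3 ▸ h0)]
    rw [List.getI_eq_getElem _ (by simpa using h2)]
    simp

end StackMachine

namespace StackMachine

open Turing PartrecToTM2

instance : Fintype K' where
  elems := {.main, .rev, .aux, .stack}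
  complete k := by cases k <;> simp

/-- The states used by the stack machine evaluating a code. -/
abbrev CodeState (c : ToPartrec.Code) : Type := states tr (codeSupp c .halt)

instance (c : ToPartrec.Code) : Finite (CodeState c) := finite_states _ _

/-- The stack machine evaluating a code. -/
def ofCode (c : ToPartrec.Code) : StackMachine K' Γ' (CodeState c) :=
  (ofTM2 tr).restrict _
    (letI : Inhabited Λ' := ⟨trNormal c .halt⟩; act_mem_states tr (tr_supports c .halt))

/-- The initial state of the stack machine evaluating a code. -/
def initState (c : ToPartrec.Code) : CodeState c :=
  ⟨(tr (trNormal c .halt), none), mem_states_of_mem _ (tr_supports c .halt).1 _⟩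

/-- The final state of the stack machine evaluating a code. -/
def haltState (c : ToPartrec.Code) : CodeState c := ⟨(.halt, none), .inl rfl⟩

/-- The mainStack with a list of numbers on the main stack. -/
def mainStack (v : List ℕ) : K' → List Γ' := K'.elim (trList v) [] [] []

lemma mainStack_of_ne (v : List ℕ) : ∀ l ≠ K'.main, mainStack v l = [] := by
  rintro (_ | _) h <;> first | rfl | exact absurd rfl h

lemma ofCode_step_halt (c : ToPartrec.Code) (S : K' → List Γ') :
    (ofCode c).step (haltState c, S) = (haltState c, S) := by
  have h := iterate_restrict (F := states tr (codeSupp c .halt)) (hF :=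
    letI : Inhabited Λ' := ⟨trNormal c .halt⟩; act_mem_states tr (tr_supports c .halt))
    (haltState c, S) 1
  exact (Subtype.val_injective.prodMap Function.injective_id) (h.trans (ofTM2_step_halt tr none S))

lemma exists_iterate_ofCode {c : ToPartrec.Code} {v w : List ℕ} (h : w ∈ c.eval v) :
    ∃ n, (ofCode c).step^[n] (initState c, mainStack v) = (haltState c, mainStack w) := by
  have h1 : PartrecToTM2.halt w ∈ StateTransition.eval (TM2.step tr) (init c v) := by
    rw [tr_eval]
    exact Part.mem_map _ h
  obtain ⟨n, hn⟩ := exists_iterate_of_reaches tr (StateTransition.mem_eval.1 h1).1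
  refine ⟨n, (Subtype.val_injective.prodMap Function.injective_id) ?_⟩
  exact (iterate_restrict _ _).trans hn

/-- For every partial recursive function `f` there are a finite set of relations and a family of
further relations depending on the argument `n` such that the central generator of the
corresponding gadget group is nontrivial, has order `2` if `f n = 0`, and order `3` if `f n = 1`. -/
theorem exists_gadget {f : ℕ →. ℕ} (hf : Nat.Partrec f) :
    ∃ (ι : Type) (_ : Finite ι) (F : Set (FreeGroup ι × ℕ)) (x t κ : ι) (α : ℕ → ℕ),
      F.Finite ∧ Primrec α ∧ ∀ n,
        letI R := insert (⁅(FreeGroup.of κ : FreeGroup ι),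
          FreeGroup.of x ^ α n * FreeGroup.of t * (FreeGroup.of x ^ α n)⁻¹⁆, 0) F
        (PresentedGroup.of Gadget.c : Gadget.Grp R) ≠ 1 ∧
          (0 ∈ f n → (PresentedGroup.of Gadget.c : Gadget.Grp R) ^ 2 = 1) ∧
          (1 ∈ f n → (PresentedGroup.of Gadget.c : Gadget.Grp R) ^ 3 = 1) := by
  obtain ⟨c, hc⟩ := ToPartrec.Code.exists_code
    (Nat.Partrec'.part_iff₁.2 (Partrec.nat_iff.2 hf))
  have hc' : ∀ n m, m ∈ f n → [m] ∈ c.eval [n] := fun n m h => by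
    have := hc ⟨[n], rfl⟩
    change c.eval [n] = pure <$> f n at this
    rw [this]
    exact Part.mem_map (fun x => [x]) h
  refine ⟨Gen K' Γ' (CodeState c), inferInstance, (ofCode c).fixedRels .main (haltState c)
    (num (trList [0])) (num (trList [1])), .inl (.inl .main), .inl (.inr (initState c)),
    .inr (.inr ()), fun n => num (trList [n]), finite_fixedRels _ _ _ _ _, primrec_num_trList,
    fun n => ⟨?_, fun h => ?_, fun h => ?_⟩⟩
  · refine of_c_ne_one (M := ofCode c) (k := .main) (c := (initState c, mainStack [n]))
      (s := (haltState c, mainStack [0])) (t := (haltState c, mainStack [1])) (mainStack_of_ne _)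
      (mainStack_of_ne _) (mainStack_of_ne _) (ofCode_step_halt _ _) (ofCode_step_halt _ _) rfl ?_
    change num (trList [0]) ≠ num (trList [1])
    have h1 : num (trList [1]) = _ := num_trList_bit (b := true) (n := 0) (by simp)
    have h2 : 1 ≤ digit (some Γ'.cons) := Nat.succ_le_succ (Nat.zero_le _)
    rw [h1, num_trList_zero]
    have h3 := digit_lt_base (some Γ'.cons)
    have h4 : base Γ' * 1 ≤ base Γ' * digit (some Γ'.cons) := Nat.mul_le_mul_left _ h2
    omega
  · obtain ⟨N, hN⟩ := exists_iterate_ofCode (hc' n 0 h)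
    exact Gadget.of_c_pow_eq_one 2 fun G _ m z _ hR =>
      pow_eq_one_of_iterate (M := ofCode c) hR rfl rfl (mainStack_of_ne _) hN rfl (mainStack_of_ne _)
        (.inl ⟨rfl, rfl⟩)
  · obtain ⟨N, hN⟩ := exists_iterate_ofCode (hc' n 1 h)
    exact Gadget.of_c_pow_eq_one 3 fun G _ m z _ hR =>
      pow_eq_one_of_iterate (M := ofCode c) hR rfl rfl (mainStack_of_ne _) hN rfl (mainStack_of_ne _)
        (.inr ⟨rfl, rfl⟩)

end StackMachine

/-- A sequence of elements of a free group that is given by a primitive recursive sequence of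
words. -/
def PrimrecWord {m : ℕ} (F : ℕ → FreeGroup (Fin m)) : Prop :=
  ∃ l : ℕ → Word m, Primrec l ∧ ∀ n, FreeGroup.mk (l n) = F n

namespace PrimrecWord

variable {m : ℕ} {F G : ℕ → FreeGroup (Fin m)}

lemma const (w : FreeGroup (Fin m)) : PrimrecWord fun _ => w :=
  ⟨fun _ => w.toWord, .const _, fun _ => FreeGroup.mk_toWord⟩

lemma mul : PrimrecWord F → PrimrecWord G → PrimrecWord fun n => F n * G n := by
  rintro ⟨l, hl, hF⟩ ⟨l', hl', hG⟩
  exact ⟨fun n => l n ++ l' n, Primrec.list_append.comp hl hl', fun n => by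
    rw [← FreeGroup.mul_mk, hF, hG]⟩

lemma inv : PrimrecWord F → PrimrecWord fun n => (F n)⁻¹ := by
  rintro ⟨l, hl, hF⟩
  refine ⟨fun n => FreeGroup.invRev (l n), ?_, fun n => by rw [← FreeGroup.inv_mk, hF]⟩
  exact Primrec.list_reverse.comp (Primrec.list_map hl
    ((Primrec.dom_finite fun p : Fin m × Bool => (p.1, !p.2)).comp Primrec.snd))

lemma pow (w : FreeGroup (Fin m)) {α : ℕ → ℕ} (hα : Primrec α) :
    PrimrecWord fun n => w ^ α n := by
  refine ⟨fun n => (fun l => w.toWord ++ l)^[α n] [], ?_, fun n => ?_⟩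
  · exact Primrec.nat_iterate hα (.const _) (Primrec.list_append.comp (.const _) .snd)
  · beta_reduce
    induction α n with
    | zero => rfl
    | succ k ih =>
      rw [Function.iterate_succ_apply', ← FreeGroup.mul_mk, ih, FreeGroup.mk_toWord, pow_succ']

lemma commutatorElement (hF : PrimrecWord F) (hG : PrimrecWord G) :
    PrimrecWord fun n => ⁅F n, G n⁆ := by
  simp only [commutatorElement_def]
  exact ((hF.mul hG).mul hF.inv).mul hG.inv

end PrimrecWord

lemma Gadget.finite_baseRels (ι : Type) [Finite ι] : (Gadget.baseRels ι).Finite :=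
  (((Set.finite_range _).union (Set.finite_singleton _)).union (Set.finite_range _)).union
    (Set.finite_range _)

/-- For every partial recursive function `f` there is a computable sequence of finite presentations
of groups containing a nontrivial element `c` whose powers include all torsion elements, such
that `c` has order `2` if `f n = 0`, and order `3` if `f n = 1`. -/
theorem exists_finPres {f : ℕ →. ℕ} (hf : Nat.Partrec f) :
    ∃ P : ℕ → FinPres, Computable (fun n => Encodable.encode (P n)) ∧ ∀ n, ∃ c : (P n).Grp,
      c ≠ 1 ∧ c ^ 6 = 1 ∧ (∀ (g : (P n).Grp) (k : ℕ), k ≠ 0 → g ^ k = 1 → g ∈ Subgroup.zpowers c) ∧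
        (0 ∈ f n → c ^ 2 = 1) ∧ (1 ∈ f n → c ^ 3 = 1) := by
  obtain ⟨ι, _, F, x, t, κ, α, hF, hα, h⟩ := StackMachine.exists_gadget hf
  obtain ⟨m, ⟨e⟩⟩ := Finite.exists_equiv_fin (GadgetGen ι)
  let φ : FreeGroup (GadgetGen ι) ≃* FreeGroup (Fin m) := FreeGroup.freeGroupCongr e
  let w : ℕ → FreeGroup ι × ℕ := fun n => (⁅(FreeGroup.of κ : FreeGroup ι),
    FreeGroup.of x ^ α n * FreeGroup.of t * (FreeGroup.of x ^ α n)⁻¹⁆, 0)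
  obtain ⟨l, hl, hlw⟩ : PrimrecWord fun n => φ (Gadget.twistRel (w n)) := by
    have hY : PrimrecWord fun n => φ (FreeGroup.map Gadget.y (w n).1) := by
      simp only [w, map_commutatorElement, map_mul, map_pow, map_inv]
      exact (PrimrecWord.const _).commutatorElement
        (((PrimrecWord.pow _ hα).mul (.const _)).mul (PrimrecWord.pow _ hα).inv)
    simp only [Gadget.twistRel, map_mul, map_inv, w, pow_zero, mul_one]
    exact (((PrimrecWord.const _).mul hY).mul (.const _)).mul hY.inv
  have hfin : (φ '' (Gadget.baseRels ι ∪ Gadget.twistRel '' F)).Finite :=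
    ((Gadget.finite_baseRels ι).union (hF.image _)).image _
  let L : List (Word m) := hfin.toFinset.toList.map FreeGroup.toWord
  let P : ℕ → FinPres := fun n => ⟨m, l n :: L⟩
  have hP : ∀ n, (P n).rels = φ '' Gadget.rels (insert (w n) F) := by
    intro n
    have h1 : Gadget.rels (insert (w n) F) =
        insert (Gadget.twistRel (w n)) (Gadget.baseRels ι ∪ Gadget.twistRel '' F) := by
      rw [Gadget.rels, Set.image_insert_eq, Set.union_insert]
    rw [h1, Set.image_insert_eq]
    ext g
    simp only [FinPres.rels, P, List.mem_cons, L, List.mem_map, Finset.mem_toList,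
      Set.Finite.mem_toFinset, Set.mem_ofPred_eq, Set.mem_insert_iff]
    constructor
    · rintro ⟨r, rfl | ⟨g', hg', rfl⟩, rfl⟩
      · exact .inl (hlw n)
      · rw [FreeGroup.mk_toWord]
        exact .inr hg'
    · rintro (rfl | hg)
      · exact ⟨_, .inl rfl, (hlw n).symm⟩
      · exact ⟨_, .inr ⟨g, hg, rfl⟩, FreeGroup.mk_toWord.symm⟩
  refine ⟨P, ?_, fun n => ?_⟩
  · simp only [P, Encodable.encode_sigma_val]
    exact (Primrec₂.natPair.comp (.const _)
      (Primrec.encode.comp (Primrec.list_cons.comp hl (.const L)))).to_comp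
  · let ψ : Gadget.Grp (insert (w n) F) ≃* (P n).Grp :=
      (PresentedGroup.equivPresentedGroup _ e).trans
        (QuotientGroup.congr _ _ (MulEquiv.refl _) (by rw [hP n]; simp; rfl))
    obtain ⟨h1, h2, h3⟩ := h n
    refine ⟨ψ (PresentedGroup.of Gadget.c), ?_, ?_, fun g k hk hg => ?_, fun h => ?_, fun h => ?_⟩
    · exact mt (map_eq_one_iff ψ ψ.injective).1 h1
    · rw [← map_pow, Gadget.c_pow_six, map_one]
    · obtain ⟨g, rfl⟩ := ψ.surjective g
      rw [← map_pow, map_eq_one_iff ψ ψ.injective] at hg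
      obtain ⟨j, hj⟩ := Gadget.mem_zpowers_of_pow_eq_one hk hg
      exact ⟨j, (map_zpow ψ _ j).symm.trans (congrArg ψ hj)⟩
    · rw [← map_pow, h2 h, map_one]
    · rw [← map_pow, h3 h, map_one]

/-- If a nontrivial element has prime order and its powers include all torsion elements, then
its order is the only order of a nontrivial torsion element. -/
lemma eq_of_mem_torOrd {G : Type*} [Group G] {c : G} {p n : ℕ} (hp : p.Prime) (hc : c ^ p = 1)
    (h : ∀ (g : G) (k : ℕ), k ≠ 0 → g ^ k = 1 → g ∈ Subgroup.zpowers c) (hn : n ∈ TorOrd G) :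
    n = p := by
  obtain ⟨hn, g, rfl⟩ := hn
  have h1 : g ^ p = 1 := by
    obtain ⟨j, rfl⟩ := h g _ (by omega) (pow_orderOf_eq_one g)
    change (c ^ j) ^ p = 1
    rw [← zpow_natCast, zpow_comm, zpow_natCast, hc, one_zpow]
  exact ((Nat.dvd_prime hp).1 (orderOf_dvd_of_pow_eq_one h1)).resolve_left (by omega)

/-- Theorem 6.8 (Chiodo): there is no algorithm that, on input of a finite presentation
of a group with torsion, halts and outputs some element of `TorOrd` of the presented
group, i.e. some `n ≥ 2` which is the order of an element of the presented group. -/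
theorem no_algorithm_torsion_order :
    ¬ ∃ g : ℕ →. ℕ, Nat.Partrec g ∧
      ∀ P : FinPres, (∃ x : P.Grp, x ≠ 1 ∧ orderOf x ≠ 0) →
        ∃ n : ℕ, n ∈ g (Encodable.encode P) ∧ n ∈ TorOrd P.Grp := by
  rintro ⟨g, hg, hgP⟩
  let f : ℕ →. ℕ := fun n => (Denumerable.ofNat Nat.Partrec.Code n).eval n
  have hf : Nat.Partrec f := Partrec.nat_iff.1 (Nat.Partrec.Code.eval_part.comp
    (Computable.ofNat _) Computable.id)
  obtain ⟨P, hP, hc⟩ := exists_finPres hf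
  have hs : Partrec fun n => (g (Encodable.encode (P n))).map
      fun k => if k = 2 then 1 else 0 := by
    refine Partrec.map ((Partrec.nat_iff.2 hg).comp hP) ?_
    exact (Primrec.ite (Primrec.eq.comp Primrec.snd (.const 2)) (.const 1) (.const 0)).to_comp
  obtain ⟨code, hcode⟩ := Nat.Partrec.Code.exists_code.1 (Partrec.nat_iff.1 hs)
  obtain ⟨c, hc1, hc6, htor, h0, h1⟩ := hc (Encodable.encode code)
  obtain ⟨k, hk, hkt⟩ := hgP (P (Encodable.encode code))
    ⟨c, hc1, fun h => orderOf_eq_zero_iff'.1 h 6 (by norm_num) hc6⟩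
  have hfk : (if k = 2 then 1 else 0) ∈ f (Encodable.encode code) := by
    simp only [f, Denumerable.ofNat_encode, hcode]
    exact Part.mem_map _ hk
  split_ifs at hfk with h
  · have := eq_of_mem_torOrd Nat.prime_three (h1 hfk) htor hkt
    omega
  · exact h (eq_of_mem_torOrd Nat.prime_two (h0 hfk) htor hkt)
end
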